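/- Let L and L' be flat-at-infinity planar Lagrangians, let a ∈ ℝ, and suppose both L and L' are transverse to {y₂ = a} and L ∩ {y₂ = a} = L' ∩ {y₂ = a} = S, where S is nonempty and connected. Then for every ε > 0 there exists a flat-at-infinity planar Lagrangian L'' such that L'' ∩ {p : y₂(p) < a − ε} = L ∩ {p : y₂(p) < a − ε} and L'' ∩ {p : y₂(p) > a + ε} = L' ∩ {p : y₂(p) > a + ε}. (Proposition: gluing two flat-at-infinity planar Lagrangians along a common connected slice.) -/

import Mathlib

noncomputable section

/-- ℝ⁴ with coordinates (x₁, x₂, y₁, y₂). -/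
abbrev R4 := ℝ × ℝ × ℝ × ℝ
/-- ℝ² with coordinates (x₁, y₁). -/
abbrev R2 := ℝ × ℝ
/-- ℝ³ with coordinates (x₁, x₂, y₁). -/
abbrev R3 := ℝ × ℝ × ℝ

/-- The standard symplectic form ω(u,v) = u₁v₃ − u₃v₁ + u₂v₄ − u₄v₂ on ℝ⁴. -/
def omega4 (u v : R4) : ℝ :=
  u.1 * v.2.2.1 - u.2.2.1 * v.1 + u.2.1 * v.2.2.2 - u.2.2.2 * v.2.1

/-- A symplectomorphism of ℝ⁴. -/
def IsSymplectomorphism (ψ : R4 → R4) : Prop :=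
  Function.Bijective ψ ∧ ContDiff ℝ (⊤ : ℕ∞) ψ ∧ ContDiff ℝ (⊤ : ℕ∞) (Function.invFun ψ) ∧
  ∀ p u v : R4, omega4 (fderiv ℝ ψ p u) (fderiv ℝ ψ p v) = omega4 u v

/-- The Hamiltonian vector field of H : ℝ⁴ → ℝ, coordinates (x₁, x₂, y₁, y₂). -/
def HamVF (H : R4 → ℝ) (p : R4) : R4 :=
  (fderiv ℝ H p (0, 0, 1, 0), fderiv ℝ H p (0, 0, 0, 1),
   -fderiv ℝ H p (1, 0, 0, 0), -fderiv ℝ H p (0, 1, 0, 0))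

/-- A global Hamiltonian flow of H on ℝ⁴. -/
def IsHamFlow (H : R4 → ℝ) (Φ : ℝ × R4 → R4) : Prop :=
  ContDiff ℝ (⊤ : ℕ∞) Φ ∧ (∀ p, Φ (0, p) = p) ∧
  ∀ (t : ℝ) (p : R4), HasDerivAt (fun s => Φ (s, p)) (HamVF H (Φ (t, p))) t

/-- A parametrization of a flat-at-infinity planar Lagrangian. -/
def IsFlatParam (f : R2 → R4) : Prop :=
  ContDiff ℝ (⊤ : ℕ∞) f ∧ Function.Injective f ∧ IsProperMap f ∧
  (∀ p : R2, Function.Injective (fderiv ℝ f p)) ∧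
  (∀ (p : R2) (u v : R2), omega4 (fderiv ℝ f p u) (fderiv ℝ f p v) = 0) ∧
  ∃ K : Set R2, IsCompact K ∧ ∀ p : R2, p ∉ K → f p = (p.1, p.2, 0, 0)

/-- A flat-at-infinity planar Lagrangian. -/
def IsFlatLagrangian (L : Set R4) : Prop :=
  ∃ f : R2 → R4, IsFlatParam f ∧ Set.range f = L

/-- `L` is transverse to the hyperplane {y₂ = a}. -/
def TransverseAt (L : Set R4) (a : ℝ) : Prop :=
  ∃ f : R2 → R4, IsFlatParam f ∧ Set.range f = L ∧
    ∀ p : R2, (f p).2.2.2 = a → fderiv ℝ (fun q => (f q).2.2.2) p ≠ 0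

/-- An area-preserving diffeomorphism of ℝ². -/
def IsAreaDiffeo (φ : R2 → R2) : Prop :=
  Function.Bijective φ ∧ ContDiff ℝ (⊤ : ℕ∞) φ ∧ ContDiff ℝ (⊤ : ℕ∞) (Function.invFun φ) ∧
  ∀ p : R2, LinearMap.det ((fderiv ℝ φ p) : R2 →ₗ[ℝ] R2) = 1

/-- φ equals the identity outside a compact set. -/
def IsCompactSupported (φ : R2 → R2) : Prop :=
  ∃ K : Set R2, IsCompact K ∧ ∀ p : R2, p ∉ K → φ p = p

/-- φ × id : ℝ³ → ℝ³. -/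
def phiTimesId (φ : R2 → R2) (p : R3) : R3 :=
  ((φ (p.1, p.2.2)).1, p.2.1, (φ (p.1, p.2.2)).2)

/-- The inclusion i_a : ℝ³ → ℝ⁴. -/
def iMap (a : ℝ) (p : R3) : R4 := (p.1, p.2.1, p.2.2, a)

/-- S ◁ S' : strict Lagrange cobordism relation. -/
def SliceRelStrict (S S' : Set R3) : Prop :=
  ∃ (L : Set R4) (a b : ℝ), a < b ∧ b < 0 ∧ IsFlatLagrangian L ∧
    TransverseAt L a ∧ TransverseAt L b ∧
    L ∩ {p : R4 | p.2.2.2 = a} = iMap a '' S ∧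
    L ∩ {p : R4 | p.2.2.2 = b} = iMap b '' S'

/-- S ⊴ S' : non-strict Lagrange cobordism relation. -/
def SliceRel (S S' : Set R3) : Prop :=
  ∃ (L : Set R4) (a b : ℝ), a ≤ b ∧ b < 0 ∧ IsFlatLagrangian L ∧
    TransverseAt L a ∧ TransverseAt L b ∧
    L ∩ {p : R4 | p.2.2.2 = a} = iMap a '' S ∧
    L ∩ {p : R4 | p.2.2.2 = b} = iMap b '' S'

/-- S ∼ S' : equivalence of slices. -/
def SliceEquiv (S S' : Set R3) : Prop :=
  ∃ φ : R2 → R2, IsAreaDiffeo φ ∧ IsCompactSupported φ ∧ phiTimesId φ '' S = S'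

/-- A negative slice. -/
def IsNegativeSlice (S : Set R3) : Prop :=
  ∃ (L : Set R4) (a : ℝ), a < 0 ∧ IsFlatLagrangian L ∧ TransverseAt L a ∧
    L ∩ {p : R4 | p.2.2.2 = a} = iMap a '' S
/-- Time-dependent Hamiltonian vector field on ℝ⁴. -/
def HamVF4t (H : ℝ × R4 → ℝ) (t : ℝ) (p : R4) : R4 :=
  (fderiv ℝ (fun q => H (t, q)) p (0, 0, 1, 0),
   fderiv ℝ (fun q => H (t, q)) p (0, 0, 0, 1),
   -fderiv ℝ (fun q => H (t, q)) p (1, 0, 0, 0),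
   -fderiv ℝ (fun q => H (t, q)) p (0, 1, 0, 0))

/-- A global Hamiltonian flow of a time-dependent Hamiltonian on ℝ⁴. -/
def IsHamFlow4t (H : ℝ × R4 → ℝ) (Φ : ℝ × R4 → R4) : Prop :=
  ContDiff ℝ (⊤ : ℕ∞) Φ ∧ (∀ p, Φ (0, p) = p) ∧
  ∀ (t : ℝ) (p : R4), HasDerivAt (fun s => Φ (s, p)) (HamVF4t H t (Φ (t, p))) t

/-- Time-dependent Hamiltonian vector field on ℝ², coordinates (x₁, y₁). -/
def HamVF2t (H : ℝ × R2 → ℝ) (t : ℝ) (q : R2) : R2 :=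
  (fderiv ℝ (fun r => H (t, r)) q (0, 1), -fderiv ℝ (fun r => H (t, r)) q (1, 0))

/-- A global Hamiltonian flow of a time-dependent Hamiltonian on ℝ². -/
def IsHamFlow2t (H : ℝ × R2 → ℝ) (φ : ℝ × R2 → R2) : Prop :=
  ContDiff ℝ (⊤ : ℕ∞) φ ∧ (∀ q, φ (0, q) = q) ∧
  ∀ (t : ℝ) (q : R2), HasDerivAt (fun s => φ (s, q)) (HamVF2t H t (φ (t, q))) t

/-- Translation of ℝ⁴ by s in the x₁-direction. -/
def trX1 (s : ℝ) (p : R4) : R4 := (p.1 + s, p.2.1, p.2.2.1, p.2.2.2)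

/-- Φ_φ : ℝ⁴ → ℝ⁴ induced by an area-preserving diffeomorphism φ of the x₁y₁-plane. -/
def PhiPhi (φ : R2 → R2) (p : R4) : R4 :=
  ((φ (p.1, p.2.2.1)).1, p.2.1, (φ (p.1, p.2.2.1)).2, p.2.2.2)

set_option linter.all false

namespace Glu
open Set Filter Topology Metric
open scoped ContDiff

abbrev tp : ℝ := 2 * Real.pi
lemma tp_pos : 0 < tp := by unfold tp; positivity

lemma per_int {Z : Type*} {R : ℝ → Z} (per : ∀ x, R (x + tp) = R x) (x : ℝ) (n : ℤ) :
    R (x + n * tp) = R x := by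
  have h : Function.Periodic R tp := per
  have := h.int_mul n
  simpa using this x

lemma exists_Ico (x : ℝ) : ∃ n : ℤ, 0 ≤ x + n * tp ∧ x + n * tp < tp := by
  obtain ⟨n, hn, -⟩ := existsUnique_add_zsmul_mem_Ico tp_pos x 0
  refine ⟨n, ?_⟩
  simpa using hn

lemma unif {P : ℝ → ℝ → Prop} (mono : ∀ x e e', P x e → e' ≤ e → P x e')
    (per : ∀ x e, P (x + tp) e ↔ P x e) (loc : ∀ x0, ∃ e > 0, ∀ᶠ x in 𝓝 x0, P x e) :
    ∃ e > 0, ∀ x, P x e := by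
  have key : ∃ e > 0, ∀ x ∈ Icc 0 tp, P x e := by
    refine isCompact_Icc.induction_on (p := fun s => ∃ e > 0, ∀ x ∈ s, P x e) ?_ ?_ ?_ ?_
    · exact ⟨1, one_pos, by simp⟩
    · rintro s t hst ⟨e, he, h⟩; exact ⟨e, he, fun x hx => h x (hst hx)⟩
    · rintro s t ⟨e, he, h⟩ ⟨e', he', h'⟩
      refine ⟨min e e', lt_min he he', ?_⟩
      rintro x (hx | hx)
      · exact mono _ _ _ (h x hx) (min_le_left _ _)
      · exact mono _ _ _ (h' x hx) (min_le_right _ _)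
    · intro x _
      obtain ⟨e, he, h⟩ := loc x
      exact ⟨_, mem_nhdsWithin_of_mem_nhds h, e, he, fun y hy => hy⟩
  obtain ⟨e, he, h⟩ := key
  refine ⟨e, he, fun x => ?_⟩
  obtain ⟨n, h0, h1⟩ := exists_Ico x
  have := per_int (R := fun x => P x e) (fun x => propext (per x e)) x n
  rw [← this]; exact h _ ⟨h0, h1.le⟩

lemma unif' {V : Type*} [NormedAddCommGroup V] {R : ℝ × V → Prop}
    (per : ∀ x v, R (x + tp, v) ↔ R (x, v)) (loc : ∀ x0, ∀ᶠ q in 𝓝 ((x0, 0) : ℝ × V), R q) :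
    ∃ e > 0, ∀ x v, ‖v‖ < e → R (x, v) := by
  refine unif (P := fun x e => ∀ v, ‖v‖ < e → R (x, v)) ?_ ?_ ?_
  · intro x e e' h hle v hv; exact h v (hv.trans_le hle)
  · intro x e; simp only [per]
  · intro x0
    obtain ⟨e, he, h⟩ := Metric.eventually_nhds_iff.1 (loc x0)
    refine ⟨e, he, ?_⟩
    filter_upwards [Metric.ball_mem_nhds x0 he] with x hx v hv
    apply h
    rw [Prod.dist_eq]; simp only [dist_zero_right]
    exact max_lt hx hv

lemma locInj {V F : Type*} [NormedAddCommGroup V] [TopologicalSpace F] [T2Space F]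
    {X : ℝ × V → F} (per : ∀ x v, X (x + tp, v) = X (x, v))
    (cont : ∀ x, ContinuousAt X (x, 0)) (loc : ∀ x, ∃ U ∈ 𝓝 ((x, 0) : ℝ × V), InjOn X U)
    (inj : ∀ x x', X (x, 0) = X (x', 0) → ∃ n : ℤ, x = x' + n * tp) :
    ∃ e > 0, ∀ q q' : ℝ × V, ‖q.2‖ < e → ‖q'.2‖ < e → X q = X q' →
      q.2 = q'.2 ∧ ∃ n : ℤ, q.1 = q'.1 + n * tp := by
  set S : ℝ × V → ℝ × V → Prop := fun q q' => X q = X q' → q.2 = q'.2 ∧ ∃ n : ℤ, q.1 = q'.1 + n * tp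
  have perX : ∀ x v (n : ℤ), X (x + n * tp, v) = X (x, v) := fun x v n =>
    per_int (R := fun x => X (x, v)) (fun x => per x v) x n
  have S1 : ∀ x v q, S (x + tp, v) q ↔ S (x, v) q := by
    intro x v q
    simp only [S, per]
    refine imp_congr_right fun _ => and_congr_right fun _ => ⟨?_, ?_⟩
    · rintro ⟨n, hn⟩; exact ⟨n - 1, by push_cast; linarith⟩
    · rintro ⟨n, hn⟩; exact ⟨n + 1, by push_cast; linarith⟩
  have S2 : ∀ x v q, S q (x + tp, v) ↔ S q (x, v) := by
    intro x v q
    simp only [S, per]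
    refine imp_congr_right fun _ => and_congr_right fun _ => ⟨?_, ?_⟩
    · rintro ⟨n, hn⟩; exact ⟨n + 1, by push_cast; linarith⟩
    · rintro ⟨n, hn⟩; exact ⟨n - 1, by push_cast; linarith⟩
  have step1 : ∀ x0 x1, ∀ᶠ pr in 𝓝 (((x0, 0) : ℝ × V), ((x1, 0) : ℝ × V)), S pr.1 pr.2 := by
    intro x0 x1
    by_cases h : X (x0, 0) = X (x1, 0)
    · obtain ⟨n, hn⟩ := inj _ _ h
      obtain ⟨U, hU, hinj⟩ := loc x0
      have h2 : Tendsto (fun q : ℝ × V => (q.1 + n * tp, q.2)) (𝓝 (x1, 0)) (𝓝 (x0, 0)) := by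
        have : Continuous (fun q : ℝ × V => (q.1 + n * tp, q.2)) := by fun_prop
        simpa [hn] using this.tendsto (x1, 0)
      rw [nhds_prod_eq]
      filter_upwards [prod_mem_prod hU (h2 hU)] with pr hpr heq
      have hh := @hinj pr.1 hpr.1 (pr.2.1 + n * tp, pr.2.2) hpr.2
        (by simp only [perX]; exact heq)
      exact ⟨by rw [hh], n, by rw [hh]⟩
    · have : ContinuousAt (fun pr : (ℝ × V) × (ℝ × V) => (X pr.1, X pr.2)) ((x0, 0), (x1, 0)) :=
        ((cont x0).comp (x := ((x0, 0), (x1, 0))) continuousAt_fst).prodMk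
          ((cont x1).comp (x := ((x0, 0), (x1, 0))) continuousAt_snd)
      have ho : IsOpen {p : F × F | p.1 ≠ p.2} := isOpen_ne_fun continuous_fst continuous_snd
      filter_upwards [this (ho.mem_nhds h)] with pr hpr heq
      exact absurd heq hpr
  have step2 : ∀ x0, ∃ e > 0, ∀ x1, ∀ q ∈ ball ((x0, 0) : ℝ × V) e, ∀ v, ‖v‖ < e → S q (x1, v) := by
    intro x0
    refine unif (P := fun x1 e => ∀ q ∈ ball ((x0, 0) : ℝ × V) e, ∀ v, ‖v‖ < e → S q (x1, v)) ?_ ?_ ?_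
    · intro x e e' h hle q hq v hv
      exact h q (ball_subset_ball hle hq) v (hv.trans_le hle)
    · intro x e; simp only [S2]
    · intro x1
      obtain ⟨e, he, h⟩ := Metric.eventually_nhds_iff.1 (step1 x0 x1)
      refine ⟨e, he, ?_⟩
      filter_upwards [Metric.ball_mem_nhds x1 he] with x hx q hq v hv
      refine @h (q, (x, v)) ?_
      rw [Prod.dist_eq, Prod.dist_eq (x := (x, v))]; simp only [dist_zero_right]
      exact max_lt hq (max_lt hx hv)
  have step3 : ∃ e > 0, ∀ x, ∀ v, ‖v‖ < e → ∀ q' : ℝ × V, ‖q'.2‖ < e → S (x, v) q' := by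
    refine unif (P := fun x e => ∀ v, ‖v‖ < e → ∀ q' : ℝ × V, ‖q'.2‖ < e → S (x, v) q') ?_ ?_ ?_
    · intro x e e' h hle v hv q hq
      exact h v (hv.trans_le hle) q (hq.trans_le hle)
    · intro x e; simp only [S1]
    · intro x0
      obtain ⟨e, he, h⟩ := step2 x0
      refine ⟨e, he, ?_⟩
      filter_upwards [Metric.ball_mem_nhds x0 he] with x hx v hv q' hq'
      refine h q'.1 (x, v) ?_ q'.2 hq'
      rw [mem_ball, Prod.dist_eq]; simp only [dist_zero_right]
      exact max_lt hx hv
  obtain ⟨e, he, h⟩ := step3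
  exact ⟨e, he, fun q q' hq hq' => h q.1 q.2 hq q' hq'⟩

section
variable {Y Z : Type*} [NormedAddCommGroup Y] [NormedSpace ℝ Y] [FiniteDimensional ℝ Y]
  [NormedAddCommGroup Z] [NormedSpace ℝ Z] [FiniteDimensional ℝ Z]

lemma isInvertible_of_inj (A : Y →L[ℝ] Z) (h : Function.Injective A)
    (hd : Module.finrank ℝ Y = Module.finrank ℝ Z) : A.IsInvertible := by
  refine ⟨(LinearEquiv.ofInjectiveOfFinrankEq A.toLinearMap h hd).toContinuousLinearEquiv, ?_⟩
  ext x; rfl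

lemma isOpen_invertible : IsOpen {A : Y →L[ℝ] Z | A.IsInvertible} := by
  have := ContinuousLinearEquiv.isOpen (𝕜 := ℝ) (E := Y) (F := Z)
  exact this

lemma pift (hd : Module.finrank ℝ Y = Module.finrank ℝ Z) {Φ : (ℝ × ℝ) × Y → Z}
    (per : ∀ x t y, Φ ((x + tp, t), y) = Φ ((x, t), y))
    (sm : ∀ x, ∀ᶠ v in 𝓝 (((x, 0), 0) : (ℝ × ℝ) × Y), ContDiffAt ℝ ∞ Φ v)
    (h0 : ∀ x, Φ ((x, 0), 0) = 0)
    (inv : ∀ x y, fderiv ℝ Φ ((x, 0), 0) (0, y) = 0 → y = 0) :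
    ∃ δ > 0, ∃ r > 0, ∃ y : ℝ × ℝ → Y, (∀ q, |q.2| < δ → ContDiffAt ℝ ∞ y q) ∧
      (∀ x t, y (x + tp, t) = y (x, t)) ∧ (∀ x, y (x, 0) = 0) ∧
      (∀ q, |q.2| < δ → Φ (q, y q) = 0 ∧ ‖y q‖ < r) ∧
      (∀ q y', |q.2| < δ → ‖y'‖ < r → Φ (q, y') = 0 → y' = y q) := by
  have inv' : ∀ x, (fderiv ℝ Φ ((x, 0), 0) ∘L .inr ℝ (ℝ × ℝ) Y).IsInvertible := by
    intro x
    refine isInvertible_of_inj _ ?_ hd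
    rw [injective_iff_map_eq_zero]
    intro y hy
    exact inv x y hy
  have uniq : ∃ r > 0, ∀ x, ∀ v : ℝ × Y × Y, ‖v‖ < r → (Φ ((x, v.1), v.2.1) = 0 →
      Φ ((x, v.1), v.2.2) = 0 → v.2.1 = v.2.2) := by
    refine unif' (R := fun q : ℝ × (ℝ × Y × Y) => Φ ((q.1, q.2.1), q.2.2.1) = 0 →
      Φ ((q.1, q.2.1), q.2.2.2) = 0 → q.2.2.1 = q.2.2.2) ?_ ?_
    · intro x v; simp only [per]
    · intro x0
      have hs := (sm x0).self_of_nhds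
      have hq := hs.eventually_apply_eq_iff_implicitFunction (by simp) (inv' x0)
      have t1 : Tendsto (fun q : ℝ × (ℝ × Y × Y) => (((q.1, q.2.1), q.2.2.1) : (ℝ × ℝ) × Y))
        (𝓝 (x0, 0)) (𝓝 ((x0, 0), 0)) := by
        have : Continuous (fun q : ℝ × (ℝ × Y × Y) => (((q.1, q.2.1), q.2.2.1) : (ℝ × ℝ) × Y)) := by
          fun_prop
        simpa using this.tendsto (x0, 0)
      have t2 : Tendsto (fun q : ℝ × (ℝ × Y × Y) => (((q.1, q.2.1), q.2.2.2) : (ℝ × ℝ) × Y))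
        (𝓝 (x0, 0)) (𝓝 ((x0, 0), 0)) := by
        have : Continuous (fun q : ℝ × (ℝ × Y × Y) => (((q.1, q.2.1), q.2.2.2) : (ℝ × ℝ) × Y)) := by
          fun_prop
        simpa using this.tendsto (x0, 0)
      filter_upwards [t1.eventually hq, t2.eventually hq] with q h1 h2 h3 h4
      rw [h0] at h1 h2
      exact (h1.1 h3).symm.trans (h2.1 h4)
  obtain ⟨r, hr, uniq⟩ := uniq
  have uniq2 : ∀ q : ℝ × ℝ, ∀ y y' : Y, |q.2| < r → ‖y‖ < r → ‖y'‖ < r → Φ (q, y) = 0 →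
      Φ (q, y') = 0 → y = y' := by
    intro q y y' h1 h2 h3 h4 h5
    refine uniq q.1 (q.2, y, y') ?_ h4 h5
    simp only [Prod.norm_def]
    exact max_lt h1 (max_lt h2 h3)

  have ex : ∃ δ > 0, ∀ x, ∀ t : ℝ, ‖t‖ < δ → (∃ y0 : Y, ‖y0‖ < r ∧ Φ ((x, t), y0) = 0 ∧
      ContDiffAt ℝ ∞ Φ ((x, t), y0) ∧
      (fderiv ℝ Φ ((x, t), y0) ∘L .inr ℝ (ℝ × ℝ) Y).IsInvertible) := by
    suffices h : ∃ δ > 0, ∀ x, ∀ t : ℝ, ‖t‖ < δ → (∃ y0 : Y, ‖y0‖ < r ∧ Φ ((x, t), y0) = 0 ∧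
      ∀ n : ℤ, ContDiffAt ℝ ∞ Φ ((x + n * tp, t), y0) ∧
      (fderiv ℝ Φ ((x + n * tp, t), y0) ∘L .inr ℝ (ℝ × ℝ) Y).IsInvertible) by
      obtain ⟨δ, hδ, h⟩ := h
      refine ⟨δ, hδ, fun x t ht => ?_⟩
      obtain ⟨y0, h1, h2, h3⟩ := h x t ht
      have := h3 0
      simp at this
      exact ⟨y0, h1, h2, this.1, this.2⟩
    refine unif' (R := fun q : ℝ × ℝ => ∃ y0 : Y, ‖y0‖ < r ∧ Φ ((q.1, q.2), y0) = 0 ∧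
      ∀ n : ℤ, ContDiffAt ℝ ∞ Φ ((q.1 + n * tp, q.2), y0) ∧
      (fderiv ℝ Φ ((q.1 + n * tp, q.2), y0) ∘L .inr ℝ (ℝ × ℝ) Y).IsInvertible) ?_ ?_
    · intro x t
      simp only [per]
      refine exists_congr fun y0 => and_congr_right fun _ => and_congr_right fun _ => ⟨?_, ?_⟩
      · intro h n; have := h (n - 1); push_cast at this; ring_nf at this ⊢; exact this
      · intro h n; have := h (n + 1); push_cast at this; ring_nf at this ⊢; exact this
    · intro x0
      have hs := (sm x0).self_of_nhds
      have hi := hs.eventually_apply_implicitFunction (by simp) (inv' x0)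
      have hc := hs.contDiffAt_implicitFunction (by simp) (inv' x0)
      have hv := hs.implicitFunction_apply_self (by simp) (inv' x0)
      set ψ := hs.implicitFunction (by simp) (inv' x0)
      simp only at hv hi hc
      have hc' : Tendsto ψ (𝓝 (x0, 0)) (𝓝 0) := by
        have := hc.continuousAt.tendsto; rwa [hv] at this
      have hpair : Tendsto (fun q => (q, ψ q)) (𝓝 ((x0, 0) : ℝ × ℝ)) (𝓝 ((x0, 0), 0)) := by
        exact tendsto_id.prodMk_nhds hc'
      have hfd : ContinuousAt (fderiv ℝ Φ) ((x0, 0), 0) := by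
        have := hs.fderiv_right (m := 0) (by simp)
        exact this.continuousAt
      have hfd2 : ∀ᶠ v in 𝓝 (((x0, 0), 0) : (ℝ × ℝ) × Y),
          (fderiv ℝ Φ v ∘L .inr ℝ (ℝ × ℝ) Y).IsInvertible := by
        have hcomp : ContinuousAt (fun v => fderiv ℝ Φ v ∘L .inr ℝ (ℝ × ℝ) Y) ((x0, 0), 0) := by
          exact hfd.clm_comp continuousAt_const
        exact hcomp (isOpen_invertible.mem_nhds (inv' x0))
      have hshift : ∀ (n : ℤ), (fun v : (ℝ × ℝ) × Y => Φ (v + ((n * tp, 0), 0))) = Φ := by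
        intro n; funext v
        have := per_int (R := fun x => Φ ((x, v.1.2), v.2)) (fun x => per x _ _) v.1.1 n
        simp only [Prod.mk.eta] at this
        rw [← this]; congr 1; ext <;> simp
      have hball := hc' (Metric.ball_mem_nhds 0 hr)
      filter_upwards [hi, hpair.eventually (sm x0), hpair.eventually hfd2, hball] with q h1 h2 h3 h4
      refine ⟨ψ q, by simpa using h4, by rw [← h0 x0]; exact h1, fun n => ?_⟩
      have e1 : ((q.1 + n * tp, q.2), ψ q) = (q, ψ q) + ((((n * tp : ℝ), 0), 0) : (ℝ × ℝ) × Y) := by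
        ext <;> simp
      have e2 : (q, ψ q) = ((q.1 + n * tp, q.2), ψ q) + (((((-n : ℤ) * tp : ℝ), 0), 0) : (ℝ × ℝ) × Y) := by
        ext <;> simp
      constructor
      · rw [← hshift (-n)]
        rw [e2] at h2
        have hh : ContDiffAt ℝ ∞ (fun v : (ℝ × ℝ) × Y => v + (((((-n : ℤ) * tp : ℝ), 0), 0) : (ℝ × ℝ) × Y)) ((q.1 + n * tp, q.2), ψ q) := by fun_prop
        exact ContDiffAt.comp (g := Φ) _ h2 hh
      · rw [← hshift (-n), fderiv_comp_add_right, ← e2]; exact h3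
  obtain ⟨δ, hδ, ex⟩ := ex
  set y : ℝ × ℝ → Y := fun q => Classical.epsilon (fun y0 : Y => ‖y0‖ < r ∧ Φ (q, y0) = 0 ∧
    (q.2 = 0 → y0 = 0)) with hy
  have hy1' : ∀ q : ℝ × ℝ, |q.2| < min δ r → ‖y q‖ < r ∧ Φ (q, y q) = 0 ∧ (q.2 = 0 → y q = 0) := by
    intro q hq
    obtain ⟨y0, hy0, hy0', -⟩ := ex q.1 q.2 (hq.trans_le (min_le_left _ _))
    refine Classical.epsilon_spec (p := fun y0 : Y => ‖y0‖ < r ∧ Φ (q, y0) = 0 ∧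
      (q.2 = 0 → y0 = 0)) ?_
    by_cases h : q.2 = 0
    · obtain ⟨a, b⟩ := q; simp only at h; subst h; exact ⟨0, by simp [h0, hr]⟩
    · exact ⟨y0, hy0, hy0', fun h' => absurd h' h⟩
  have hy1 : ∀ q : ℝ × ℝ, |q.2| < min δ r → Φ (q, y q) = 0 ∧ ‖y q‖ < r := fun q hq =>
    ⟨(hy1' q hq).2.1, (hy1' q hq).1⟩
  have hy2 : ∀ q y', |q.2| < min δ r → ‖y'‖ < r → Φ (q, y') = 0 → y' = y q := by
    intro q y' hq h1 h2
    exact uniq2 q y' (y q) (hq.trans_le (min_le_right _ _)) h1 (hy1 q hq).2 h2 (hy1 q hq).1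
  refine ⟨min δ r, lt_min hδ hr, r, hr, y, ?_, ?_, ?_, hy1, hy2⟩
  · intro q hq
    obtain ⟨y0, hy0, hy0', hs, hin⟩ := ex q.1 q.2 (hq.trans_le (min_le_left _ _))
    simp only [Prod.mk.eta] at hy0' hs hin
    have hi := hs.eventually_apply_implicitFunction (by simp) hin
    have hc := hs.contDiffAt_implicitFunction (by simp) hin
    have hv := hs.implicitFunction_apply_self (by simp) hin
    set ψ := hs.implicitFunction (by simp) hin
    refine hc.congr_of_eventuallyEq ?_
    have hb : ∀ᶠ q' in 𝓝 q, ‖ψ q'‖ < r := by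
      have : ContinuousAt (fun q' => ‖ψ q'‖) q := hc.continuousAt.norm
      refine this.eventually_lt continuousAt_const ?_
      simp only at hv; rw [hv]; exact hy0
    have hq2 : ∀ᶠ q' : ℝ × ℝ in 𝓝 q, |q'.2| < min δ r := by
      have : ContinuousAt (fun q' : ℝ × ℝ => |q'.2|) q := by fun_prop
      exact this.eventually_lt continuousAt_const hq
    filter_upwards [hi, hb, hq2] with q' h1 h2 h3
    exact (hy2 q' _ h3 h2 (h1.trans hy0')).symm
  · intro x t
    have : ∀ y0, Φ ((x + tp, t), y0) = Φ ((x, t), y0) := fun y0 => per x t y0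
    simp only [hy, this]
  · intro x; exact (hy1' (x, 0) (by simpa using ⟨hδ, hr⟩)).2.2 rfl

end
end Glu

namespace Glu
open Set Filter Topology Metric
open scoped ContDiff

structure Collar (D : Set ℂ) (c : ℝ × ℝ → ℂ) (δ : ℝ) : Prop where
  pos : 0 < δ
  opn : IsOpen D
  sm : ∀ q, |q.2| < δ → ContDiffAt ℝ ∞ c q
  per : ∀ x t, c (x + tp, t) = c (x, t)
  inj : ∀ q q', |q.2| < δ → |q'.2| < δ → c q = c q' → q.2 = q'.2 ∧ ∃ n : ℤ, q.1 = q'.1 + n * tp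
  imm : ∀ q u, |q.2| < δ → fderiv ℝ c q u = 0 → u = 0
  side : ∀ q, |q.2| < δ → (c q ∈ D ↔ q.2 < 0)
  cpt : ∀ δ', 0 < δ' → δ' < δ → IsCompact (D \ c '' {q | -δ' < q.2 ∧ q.2 < 0})

lemma abs_lt_nhds {q : ℝ × ℝ} {δ : ℝ} (h : |q.2| < δ) : ∀ᶠ q' : ℝ × ℝ in 𝓝 q, |q'.2| < δ := by
  have : ContinuousAt (fun q' : ℝ × ℝ => |q'.2|) q := by fun_prop
  exact this.eventually_lt continuousAt_const h

lemma exists_localInv {E F : Type*} [NormedAddCommGroup E] [NormedSpace ℝ E] [FiniteDimensional ℝ E]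
    [NormedAddCommGroup F] [NormedSpace ℝ F] [FiniteDimensional ℝ F]
    (hd : Module.finrank ℝ E = Module.finrank ℝ F) {f : E → F} {a : E} (hf : ContDiffAt ℝ ∞ f a)
    (hi : ∀ u, fderiv ℝ f a u = 0 → u = 0) :
    map f (𝓝 a) = 𝓝 (f a) ∧ (∃ U ∈ 𝓝 a, InjOn f U) ∧
      ∃ g : F → E, ContDiffAt ℝ ∞ g (f a) ∧ g (f a) = a ∧ (∀ᶠ z in 𝓝 (f a), f (g z) = z) ∧
        (∀ᶠ x in 𝓝 a, g (f x) = x) := by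
  have hcomp : CompleteSpace E := FiniteDimensional.complete ℝ E
  obtain ⟨e, he⟩ := isInvertible_of_inj (fderiv ℝ f a) (by rwa [injective_iff_map_eq_zero]) hd
  have h1 : HasFDerivAt f (e : E →L[ℝ] F) a := by
    rw [he]; exact (hf.differentiableAt (by simp)).hasFDerivAt
  have h2 : HasStrictFDerivAt f (e : E →L[ℝ] F) a := hf.hasStrictFDerivAt' h1 (by simp)
  have h3 := h2.eventually_left_inverse
  refine ⟨h2.map_nhds_eq_of_equiv, ⟨_, h3, ?_⟩, h2.localInverse f e a, hf.to_localInverse h1 (by simp), ?_,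
    h2.eventually_right_inverse, h3⟩
  · intro x hx y hy hxy
    have hx : h2.localInverse f e a (f x) = x := hx
    have hy : h2.localInverse f e a (f y) = y := hy
    rw [← hx, ← hy, hxy]
  · exact h2.localInverse_apply_image

namespace Collar
variable {D : Set ℂ} {c : ℝ × ℝ → ℂ} {δ : ℝ}

lemma fd : Module.finrank ℝ (ℝ × ℝ) = Module.finrank ℝ ℂ := by simp

lemma restrict (C : Collar D c δ) {δ' : ℝ} (h0 : 0 < δ') (h : δ' ≤ δ) : Collar D c δ' where
  pos := h0
  opn := C.opn
  sm q hq := C.sm q (hq.trans_le h)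
  per := C.per
  inj q q' hq hq' := C.inj q q' (hq.trans_le h) (hq'.trans_le h)
  imm q u hq := C.imm q u (hq.trans_le h)
  side q hq := C.side q (hq.trans_le h)
  cpt δ'' h1 h2 := C.cpt δ'' h1 (h2.trans_le h)

lemma map_nhds (C : Collar D c δ) {q : ℝ × ℝ} (hq : |q.2| < δ) : map c (𝓝 q) = 𝓝 (c q) :=
  (exists_localInv fd (C.sm q hq) (fun u => C.imm q u hq)).1

lemma ev_iff (C : Collar D c δ) {q : ℝ × ℝ} (hq : |q.2| < δ) {P : ℂ → Prop} :
    (∀ᶠ z in 𝓝 (c q), P z) ↔ ∀ᶠ q' in 𝓝 q, P (c q') := by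
  rw [← C.map_nhds hq, eventually_map]

lemma per' (C : Collar D c δ) (x t : ℝ) (n : ℤ) : c (x + n * tp, t) = c (x, t) :=
  per_int (R := fun x => c (x, t)) (fun x => C.per x t) x n

def inv (c : ℝ × ℝ → ℂ) (δ : ℝ) (z : ℂ) : ℝ × ℝ := Classical.epsilon (fun q => |q.2| < δ ∧ c q = z)

lemma inv_spec (C : Collar D c δ) {q : ℝ × ℝ} (hq : |q.2| < δ) :
    (inv c δ (c q)).2 = q.2 ∧ ∃ n : ℤ, (inv c δ (c q)).1 = q.1 + n * tp := by
  have h := Classical.epsilon_spec (p := fun q' => |q'.2| < δ ∧ c q' = c q) ⟨q, hq, rfl⟩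
  exact C.inj _ _ h.1 hq h.2

lemma push_eq (C : Collar D c δ) {Z : Type*} {H : ℝ × ℝ → Z} (per : ∀ x t, H (x + tp, t) = H (x, t))
    {q : ℝ × ℝ} (hq : |q.2| < δ) : H (inv c δ (c q)) = H q := by
  obtain ⟨h1, n, h2⟩ := C.inv_spec hq
  rw [← Prod.mk.eta (p := inv c δ (c q)), h1, h2]
  exact per_int (R := fun x => H (x, q.2)) (fun x => per x q.2) q.1 n

lemma push_cont (C : Collar D c δ) {Z : Type*} [TopologicalSpace Z] {H : ℝ × ℝ → Z}
    (per : ∀ x t, H (x + tp, t) = H (x, t)) {q : ℝ × ℝ} (hq : |q.2| < δ) (hH : ContinuousAt H q) :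
    ContinuousAt (fun z => H (inv c δ z)) (c q) := by
  unfold ContinuousAt
  rw [← C.map_nhds hq, tendsto_map'_iff]
  show Tendsto _ _ (𝓝 (H (inv c δ (c q))))
  rw [C.push_eq per hq]
  refine hH.congr' ?_
  filter_upwards [abs_lt_nhds hq] with q' hq'
  exact (C.push_eq per hq').symm

lemma push_smooth (C : Collar D c δ) {Z : Type*} [NormedAddCommGroup Z] [NormedSpace ℝ Z] {H : ℝ × ℝ → Z}
    (per : ∀ x t, H (x + tp, t) = H (x, t)) {q : ℝ × ℝ} (hq : |q.2| < δ) (hH : ContDiffAt ℝ ∞ H q) :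
    ContDiffAt ℝ ∞ (fun z => H (inv c δ z)) (c q) := by
  obtain ⟨-, -, g, hg, hgq, h1, h2⟩ := exists_localInv fd (C.sm q hq) (fun u => C.imm q u hq)
  have : ContDiffAt ℝ ∞ (fun z => H (g z)) (c q) := by
    refine ContDiffAt.comp (g := H) _ ?_ hg
    rwa [hgq]
  refine this.congr_of_eventuallyEq ?_
  rw [EventuallyEq, C.ev_iff hq]
  filter_upwards [h2, abs_lt_nhds hq] with q' h3 h4
  rw [h3, C.push_eq per h4]

lemma cont (C : Collar D c δ) {q : ℝ × ℝ} (hq : |q.2| < δ) : ContinuousAt c q := (C.sm q hq).continuousAt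

lemma isOpen_image (C : Collar D c δ) {S : Set (ℝ × ℝ)} (hS : IsOpen S) (hs : ∀ q ∈ S, |q.2| < δ) :
    IsOpen (c '' S) := by
  rw [isOpen_iff_mem_nhds]
  rintro _ ⟨q, hq, rfl⟩
  rw [← C.map_nhds (hs q hq)]
  exact image_mem_map (hS.mem_nhds hq)

lemma isCompact_band (C : Collar D c δ) {α β : ℝ} (hα : -δ < α) (hβ : β < δ) :
    IsCompact (c '' {q | α ≤ q.2 ∧ q.2 ≤ β}) := by
  have : c '' {q | α ≤ q.2 ∧ q.2 ≤ β} = c '' (Icc 0 tp ×ˢ Icc α β) := by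
    apply Subset.antisymm
    · rintro _ ⟨⟨x, t⟩, hq, rfl⟩
      obtain ⟨n, h0, h1⟩ := exists_Ico x
      exact ⟨(x + n * tp, t), ⟨⟨h0, h1.le⟩, hq⟩, C.per' x t n⟩
    · exact image_mono fun q hq => hq.2
  rw [this]
  refine (isCompact_Icc.prod isCompact_Icc).image_of_continuousOn fun q hq => ?_
  refine (C.cont ?_).continuousWithinAt
  have := hq.2
  rw [abs_lt]; constructor <;> linarith [this.1, this.2]

lemma bounded (C : Collar D c δ) : Bornology.IsBounded D := by
  have h1 := C.cpt (δ / 2) (by linarith [C.pos]) (by linarith [C.pos])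
  have h2 := C.isCompact_band (α := -(δ / 2)) (β := 0) (by linarith [C.pos]) C.pos
  refine (h1.union h2).isBounded.subset ?_
  intro z hz
  by_cases h : z ∈ c '' {q | -(δ / 2) < q.2 ∧ q.2 < 0}
  · right; exact (let ⟨q, hq, e⟩ := h; ⟨q, ⟨hq.1.le, hq.2.le⟩, e⟩)
  · left; exact ⟨hz, h⟩

def glue (c : ℝ × ℝ → ℂ) (δ : ℝ) (D : Set ℂ) {Z : Type*} (G : ℂ → Z) (H : ℝ × ℝ → Z) (E : ℂ → Z) (z : ℂ) : Z := by
  classical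
  exact if z ∈ c '' {q | -δ < q.2 ∧ q.2 < 0} then H (inv c δ z) else if z ∈ D then G z else E z

variable {Z : Type*} {G : ℂ → Z} {H : ℝ × ℝ → Z} {E : ℂ → Z}

lemma glue_c (C : Collar D c δ) (per : ∀ x t, H (x + tp, t) = H (x, t)) {q : ℝ × ℝ} (h1 : -δ < q.2)
    (h2 : q.2 < 0) : glue c δ D G H E (c q) = H q := by
  have : c q ∈ c '' {q | -δ < q.2 ∧ q.2 < 0} := ⟨q, ⟨h1, h2⟩, rfl⟩
  simp only [glue, if_pos this]
  exact C.push_eq per (by rw [abs_lt]; constructor <;> linarith [C.pos])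

lemma glue_deep (C : Collar D c δ) (per : ∀ x t, H (x + tp, t) = H (x, t)) {α : ℝ}
    (hG : ∀ q, -δ < q.2 → q.2 < α → q.2 < 0 → H q = G (c q)) {z : ℂ} (hz : z ∈ D)
    (h : z ∉ c '' {q | α ≤ q.2 ∧ q.2 < 0}) : glue c δ D G H E z = G z := by
  by_cases hz2 : z ∈ c '' {q | -δ < q.2 ∧ q.2 < 0}
  · obtain ⟨q, hq, rfl⟩ := hz2
    rw [C.glue_c per hq.1 hq.2]
    refine hG q hq.1 ?_ hq.2
    by_contra h'
    exact h ⟨q, ⟨not_lt.1 h', hq.2⟩, rfl⟩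
  · simp only [glue, if_neg hz2, if_pos hz]

lemma glue_out (C : Collar D c δ) {z : ℂ} (hz : z ∉ D) : glue c δ D G H E z = E z := by
  have : z ∉ c '' {q | -δ < q.2 ∧ q.2 < 0} := by
    rintro ⟨q, hq, rfl⟩
    exact hz ((C.side q (by rw [abs_lt]; constructor <;> linarith [C.pos, hq.1, hq.2])).2 hq.2)
  simp only [glue, if_neg this, if_neg hz]

lemma glue_ev_c (C : Collar D c δ) {q : ℝ × ℝ} (h1 : -δ < q.2) (h2 : q.2 < 0) :
    ∀ᶠ z in 𝓝 (c q), glue c δ D G H E z = H (inv c δ z) := by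
  rw [C.ev_iff (by rw [abs_lt]; constructor <;> linarith [C.pos])]
  have : ∀ᶠ q' : ℝ × ℝ in 𝓝 q, q' ∈ {q : ℝ × ℝ | -δ < q.2 ∧ q.2 < 0} := by
    refine IsOpen.mem_nhds ?_ ⟨h1, h2⟩
    exact (isOpen_lt continuous_const continuous_snd).inter (isOpen_lt continuous_snd continuous_const)
  filter_upwards [this] with q' hq'
  have : c q' ∈ c '' {q | -δ < q.2 ∧ q.2 < 0} := ⟨q', hq', rfl⟩
  simp only [glue, if_pos this]

lemma glue_ev_deep (C : Collar D c δ) (per : ∀ x t, H (x + tp, t) = H (x, t)) {α : ℝ} (hα : -δ < α)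
    (hG : ∀ q, -δ < q.2 → q.2 < α → q.2 < 0 → H q = G (c q)) {z : ℂ} (hz : z ∈ D)
    (h : z ∉ c '' {q | α ≤ q.2 ∧ q.2 < 0}) : ∀ᶠ z' in 𝓝 z, glue c δ D G H E z' = G z' := by
  have hcl : IsClosed (c '' {q | α ≤ q.2 ∧ q.2 ≤ 0}) := (C.isCompact_band hα C.pos).isClosed
  have hz' : z ∉ c '' {q | α ≤ q.2 ∧ q.2 ≤ 0} := by
    rintro ⟨q, hq, rfl⟩
    rcases hq.2.lt_or_eq with h0 | h0
    · exact h ⟨q, ⟨hq.1, h0⟩, rfl⟩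
    · have := (C.side q (by rw [h0]; simpa using C.pos)).1 hz
      linarith
  filter_upwards [C.opn.mem_nhds hz, hcl.isOpen_compl.mem_nhds hz'] with z' h1 h2
  exact C.glue_deep per hG h1 fun h3 => h2 (let ⟨q, hq, e⟩ := h3; ⟨q, ⟨hq.1, hq.2.le⟩, e⟩)

lemma glue_ev_out (C : Collar D c δ) (per : ∀ x t, H (x + tp, t) = H (x, t)) {β : ℝ} (hβ : 0 < β) (hβδ : β < δ)
    (hE : ∀ q, -β < q.2 → q.2 < 0 → H q = E (c q)) {z : ℂ} (hz : z ∉ D) :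
    ∀ᶠ z' in 𝓝 z, glue c δ D G H E z' = E z' := by
  have hcl := (C.cpt β hβ hβδ).isClosed
  filter_upwards [hcl.isOpen_compl.mem_nhds (fun h => hz h.1)] with z' h1
  by_cases h2 : z' ∈ D
  · have : z' ∈ c '' {q | -β < q.2 ∧ q.2 < 0} := by
      by_contra h; exact h1 ⟨h2, h⟩
    obtain ⟨q, hq, rfl⟩ := this
    rw [C.glue_c per (by linarith [hq.1]) hq.2, hE q hq.1 hq.2]
  · exact C.glue_out h2

lemma cases (C : Collar D c δ) (α : ℝ) (hα : -δ < α) {z : ℂ} (hz : z ∈ D) :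
    (∃ q : ℝ × ℝ, -δ < q.2 ∧ q.2 < 0 ∧ c q = z) ∨ z ∉ c '' {q | α ≤ q.2 ∧ q.2 < 0} := by
  by_cases h : z ∈ c '' {q | α ≤ q.2 ∧ q.2 < 0}
  · obtain ⟨q, hq, rfl⟩ := h
    exact Or.inl ⟨q, by linarith [hq.1], hq.2, rfl⟩
  · exact Or.inr h

lemma glue_cont_D [TopologicalSpace Z] (C : Collar D c δ) (per : ∀ x t, H (x + tp, t) = H (x, t)) {α : ℝ} (hα : -δ < α)
    (hG : ∀ q, -δ < q.2 → q.2 < α → q.2 < 0 → H q = G (c q)) (hGc : ContinuousOn G D)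
    (hHc : ContinuousOn H {q | -δ < q.2 ∧ q.2 < 0}) {z : ℂ} (hz : z ∈ D) :
    ContinuousAt (glue c δ D G H E) z := by
  rcases C.cases α hα hz with ⟨q, h1, h2, rfl⟩ | h
  · have ho : IsOpen {q : ℝ × ℝ | -δ < q.2 ∧ q.2 < 0} :=
      (isOpen_lt continuous_const continuous_snd).inter (isOpen_lt continuous_snd continuous_const)
    refine (C.push_cont per (by rw [abs_lt]; constructor <;> linarith [C.pos])
      (hHc.continuousAt (ho.mem_nhds ⟨h1, h2⟩))).congr ?_
    exact (C.glue_ev_c h1 h2).mono fun z hz => hz.symm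
  · exact (hGc.continuousAt (C.opn.mem_nhds hz)).congr
      ((C.glue_ev_deep per hα hG hz h).mono fun z hz => hz.symm)

lemma glue_cont [TopologicalSpace Z] (C : Collar D c δ) (per : ∀ x t, H (x + tp, t) = H (x, t)) {α β : ℝ} (hα : -δ < α)
    (hG : ∀ q, -δ < q.2 → q.2 < α → q.2 < 0 → H q = G (c q)) (hGc : ContinuousOn G D)
    (hHc : ContinuousOn H {q | -δ < q.2 ∧ q.2 < 0})
    (hβ : 0 < β) (hβδ : β < δ) (hE : ∀ q, -β < q.2 → q.2 < 0 → H q = E (c q))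
    (hEc : ∀ z ∉ D, ContinuousAt E z) : Continuous (glue c δ D G H E) := by
  rw [continuous_iff_continuousAt]
  intro z
  by_cases hz : z ∈ D
  · exact C.glue_cont_D per hα hG hGc hHc hz
  · exact (hEc z hz).congr ((C.glue_ev_out per hβ hβδ hE hz).mono fun z hz => hz.symm)

lemma preconn (C : Collar D c δ) : IsPreconnected D := by
  have hS : IsPreconnected (c '' {q | -δ < q.2 ∧ q.2 < 0}) := by
    refine IsPreconnected.image ?_ c fun q hq => (C.cont ?_).continuousWithinAt
    · have : Convex ℝ {q : ℝ × ℝ | -δ < q.2 ∧ q.2 < 0} := by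
        have h1 : {q : ℝ × ℝ | -δ < q.2 ∧ q.2 < 0} = (LinearMap.snd ℝ ℝ ℝ) ⁻¹' (Ioo (-δ) 0) := by
          ext; simp
        rw [h1]; exact (convex_Ioo _ _).linear_preimage _
      exact this.isPreconnected
    · rw [abs_lt]; constructor <;> linarith [C.pos, hq.1, hq.2]
  have hSD : c '' {q | -δ < q.2 ∧ q.2 < 0} ⊆ D := by
    rintro _ ⟨q, hq, rfl⟩
    exact (C.side q (by rw [abs_lt]; constructor <;> linarith [C.pos, hq.1, hq.2])).2 hq.2

  have key : ∀ A B : Set ℂ, IsOpen A → IsOpen B → D ⊆ A ∪ B → D ∩ (A ∩ B) = ∅ →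
      c '' {q | -δ < q.2 ∧ q.2 < 0} ⊆ A → D ∩ B = ∅ := by
    intro A B hA hB hAB hd hcA
    set K := D \ c '' {q | -(δ / 2) < q.2 ∧ q.2 < 0}
    have hK : IsCompact K := C.cpt (δ / 2) (by linarith [C.pos]) (by linarith [C.pos])
    have hBK : D ∩ B = K ∩ Aᶜ := by
      ext z; constructor
      · rintro ⟨h1, h2⟩
        have h3 : z ∉ A := fun h => (eq_empty_iff_forall_notMem.1 hd z) ⟨h1, h, h2⟩
        exact ⟨⟨h1, fun h => h3 (hcA (let ⟨q, hq, e⟩ := h; ⟨q, ⟨by linarith [hq.1, C.pos], hq.2⟩, e⟩))⟩, h3⟩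
      · rintro ⟨h1, h2⟩
        exact ⟨h1.1, (hAB h1.1).resolve_left h2⟩
    have hc : IsCompact (D ∩ B) := by rw [hBK]; exact hK.inter_right hA.isClosed_compl
    have hclopen : IsClopen (D ∩ B) := ⟨hc.isClosed, C.opn.inter hB⟩
    rcases isClopen_iff.1 hclopen with h | h
    · exact h
    · rw [h] at hc; exact absurd hc (noncompact_univ ℂ)
  intro A B hA hB hAB ⟨a, haD, haA⟩ ⟨b, hbD, hbB⟩
  by_contra hne
  rw [not_nonempty_iff_eq_empty] at hne
  have hmem := hS.subset_or_subset hA hB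
  have hsub : c '' {q | -δ < q.2 ∧ q.2 < 0} ⊆ A ∨ c '' {q | -δ < q.2 ∧ q.2 < 0} ⊆ B := by
    by_contra hcon
    push Not at hcon
    obtain ⟨h1, h2⟩ := hcon
    obtain ⟨x, hx, hxA⟩ := not_subset.1 h1
    obtain ⟨y, hy, hyB⟩ := not_subset.1 h2
    have := hS A B hA hB (hSD.trans hAB) ⟨y, hy, (hAB (hSD hy)).resolve_right hyB⟩
      ⟨x, hx, (hAB (hSD hx)).resolve_left hxA⟩
    obtain ⟨z, hz, hz2⟩ := this
    exact (eq_empty_iff_forall_notMem.1 hne z) ⟨hSD hz, hz2⟩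
  rcases hsub with h | h
  · exact (eq_empty_iff_forall_notMem.1 (key A B hA hB hAB hne h) b) ⟨hbD, hbB⟩
  · exact (eq_empty_iff_forall_notMem.1 (key B A hB hA (by rwa [union_comm]) (by rwa [inter_comm B A]) h) a) ⟨haD, haA⟩

end Collar
end Glu

namespace Glu
open Set Filter Topology Metric
open scoped ContDiff

lemma int_const {α : Type*} [TopologicalSpace α] {S : Set α} (hS : IsPreconnected S) {f : α → ℝ}
    (hf : ContinuousOn f S) (h : ∀ x ∈ S, ∃ n : ℤ, f x = n) {x y : α} (hx : x ∈ S) (hy : y ∈ S) :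
    f x = f y := by
  have hd : IsDiscrete (range ((↑) : ℤ → ℝ)) := by
    rw [isDiscrete_iff_discreteTopology]
    exact Int.isClosedEmbedding_coe_real.isEmbedding.toHomeomorph.symm.isEmbedding.discreteTopology
  refine hS.constant_of_mapsTo hd hf (fun x hx => ?_) hx hy
  obtain ⟨n, hn⟩ := h x hx
  exact ⟨n, hn.symm⟩

lemma log_const {α : Type*} [TopologicalSpace α] {S : Set α} (hS : IsPreconnected S) {u v : α → ℂ}
    (hu : ContinuousOn u S) (hv : ContinuousOn v S) (h : ∀ x ∈ S, Complex.exp (u x) = Complex.exp (v x))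
    (hne : S.Nonempty) : ∃ n : ℤ, ∀ x ∈ S, u x = v x + n * (tp * Complex.I) := by
  have h1 : ∀ x ∈ S, ∃ n : ℤ, u x = v x + n * (tp * Complex.I) := by
    intro x hx
    obtain ⟨n, hn⟩ := Complex.exp_eq_exp_iff_exists_int.1 (h x hx)
    exact ⟨n, by rw [hn]; push_cast; ring⟩
  have hp := tp_pos
  have h2 : ∀ x (n : ℤ), u x = v x + n * (tp * Complex.I) → (u x - v x).im / tp = n := by
    intro x n hn
    rw [hn]; simp [tp_pos.ne']
  obtain ⟨x0, hx0⟩ := hne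
  obtain ⟨n, hn⟩ := h1 x0 hx0
  refine ⟨n, fun x hx => ?_⟩
  obtain ⟨m, hm⟩ := h1 x hx
  have := int_const hS (f := fun x => (u x - v x).im / tp)
    ((Complex.continuous_im.comp_continuousOn (hu.sub hv)).div_const _)
    (fun x hx => by obtain ⟨n, hn⟩ := h1 x hx; exact ⟨n, h2 x n hn⟩) hx hx0
  simp only [h2 x m hm, h2 x0 n hn] at this
  have : m = n := by exact_mod_cast this
  rw [← this]; exact hm

lemma convex_strip (a b : ℝ) : Convex ℝ {q : ℝ × ℝ | a < q.2 ∧ q.2 < b} := by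
  have h1 : {q : ℝ × ℝ | a < q.2 ∧ q.2 < b} = (LinearMap.snd ℝ ℝ ℝ) ⁻¹' (Ioo a b) := by
    ext; simp
  rw [h1]; exact (convex_Ioo _ _).linear_preimage _

lemma isOpen_strip (a b : ℝ) : IsOpen {q : ℝ × ℝ | a < q.2 ∧ q.2 < b} :=
  (isOpen_lt continuous_const continuous_snd).inter (isOpen_lt continuous_snd continuous_const)

lemma exists_log {E : Type*} [NormedAddCommGroup E] [NormedSpace ℝ E] {U : Set E} (hc : Convex ℝ U)
    (ho : IsOpen U) (hne : U.Nonempty) {g : E → ℂ} (hg : ContinuousOn g U) (h0 : ∀ x ∈ U, g x ≠ 0) :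
    ∃ f : E → ℂ, ContinuousOn f U ∧ ∀ x ∈ U, Complex.exp (f x) = g x := by
  have hs : IsSimplyConnected U := by
    have : ContractibleSpace U := hc.contractibleSpace hne
    unfold IsSimplyConnected
    infer_instance
  obtain ⟨f, hf, h⟩ := Complex.exists_continuousOn_eqOn_exp_comp hs ho hg
    (by rintro ⟨x, hx, h⟩; exact h0 x hx h)
  exact ⟨f, hf, h⟩

lemma exists_log_univ {g : ℂ → ℂ} (hg : Continuous g) (h0 : ∀ x, g x ≠ 0) :
    ∃ f : ℂ → ℂ, Continuous f ∧ ∀ x, Complex.exp (f x) = g x := by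
  obtain ⟨f, hf, h⟩ := exists_log (E := ℂ) convex_univ isOpen_univ univ_nonempty hg.continuousOn
    (fun x _ => h0 x)
  exact ⟨f, continuousOn_univ.1 hf, fun x => h x trivial⟩

lemma lift_strip {a b : ℝ} (hab : a < b) {H : ℝ × ℝ → ℂ} (hH : ContinuousOn H {q | a < q.2 ∧ q.2 < b})
    (h0 : ∀ q : ℝ × ℝ, a < q.2 → q.2 < b → H q ≠ 0) (per : ∀ x t, H (x + tp, t) = H (x, t)) :
    ∃ (f : ℝ × ℝ → ℂ) (n : ℤ), ContinuousOn f {q | a < q.2 ∧ q.2 < b} ∧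
      (∀ q : ℝ × ℝ, a < q.2 → q.2 < b → Complex.exp (f q) = H q) ∧
      ∀ x t, a < t → t < b → f (x + tp, t) = f (x, t) + n * (tp * Complex.I) := by
  have hne : {q : ℝ × ℝ | a < q.2 ∧ q.2 < b}.Nonempty := ⟨(0, (a + b) / 2), by simp; constructor <;> linarith⟩
  obtain ⟨f, hf, h⟩ := exists_log (convex_strip a b) (isOpen_strip a b) hne hH (fun q hq => h0 q hq.1 hq.2)
  have hsh : Continuous (fun q : ℝ × ℝ => (q.1 + tp, q.2)) := by fun_prop
  obtain ⟨n, hn⟩ := log_const (u := fun q : ℝ × ℝ => f (q.1 + tp, q.2)) (v := f)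
    (convex_strip a b).isPreconnected
    (hf.comp hsh.continuousOn (fun q hq => hq)) hf (fun q hq => by
      rw [h q hq, h (q.1 + tp, q.2) hq, per]) hne
  exact ⟨f, n, hf, fun q h1 h2 => h q ⟨h1, h2⟩, fun x t h1 h2 => hn (x, t) ⟨h1, h2⟩⟩

namespace Collar
variable {D : Set ℂ} {c : ℝ × ℝ → ℂ} {δ : ℝ}

lemma exists_cut {δ : ℝ} (hδ : 0 < δ) : ∃ χ : ℝ → ℝ, Continuous χ ∧ (∀ t, t < -(2 * δ / 3) → χ t = 1) ∧
    ∀ t, -(δ / 3) < t → χ t = 0 := by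
  refine ⟨fun t => 1 - Real.smoothTransition (3 * t / δ + 2), ?_, ?_, ?_⟩
  · exact continuous_const.sub (Real.smoothTransition.continuous.comp (by fun_prop))
  · intro t ht
    beta_reduce
    rw [Real.smoothTransition.zero_of_nonpos]; · simp
    have : 3 * t / δ ≤ -2 := by rw [div_le_iff₀ hδ]; linarith
    linarith
  · intro t ht
    beta_reduce
    rw [Real.smoothTransition.one_of_one_le]; · simp
    have : -1 ≤ 3 * t / δ := by rw [le_div_iff₀ hδ]; linarith
    linarith

lemma mem_of (C : Collar D c δ) {q : ℝ × ℝ} (h1 : -δ < q.2) (h2 : q.2 < 0) : c q ∈ D :=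
  (C.side q (by rw [abs_lt]; constructor <;> linarith [C.pos])).2 h2

lemma contOn_strip (C : Collar D c δ) : ContinuousOn c {q | -δ < q.2 ∧ q.2 < 0} := fun q hq =>
  (C.cont (by rw [abs_lt]; constructor <;> linarith [C.pos, hq.1, hq.2])).continuousWithinAt

lemma log_of_zero (C : Collar D c δ) {g : ℂ → ℂ} (hg : ContinuousOn g D) (h0 : ∀ z ∈ D, g z ≠ 0)
    {f : ℝ × ℝ → ℂ} (hf : ContinuousOn f {q | -δ < q.2 ∧ q.2 < 0})
    (hfg : ∀ q : ℝ × ℝ, -δ < q.2 → q.2 < 0 → Complex.exp (f q) = g (c q))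
    (hp : ∀ x t, -δ < t → t < 0 → f (x + tp, t) = f (x, t)) :
    ∃ ℓ : ℂ → ℂ, ContinuousOn ℓ D ∧ ∀ z ∈ D, Complex.exp (ℓ z) = g z := by
  obtain ⟨χ, hχ, h1, h2⟩ := exists_cut C.pos
  have hδ := C.pos
  classical
  set S : Set (ℝ × ℝ) := {q | -δ < q.2 ∧ q.2 < 0} with hS

  set f' : ℝ × ℝ → ℂ := fun q => if -δ < q.2 ∧ q.2 < 0 then f q else 0 with hf'
  have hf'e : ∀ q : ℝ × ℝ, -δ < q.2 → q.2 < 0 → f' q = f q := fun q a b => by simp [hf', a, b]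
  have hf'p : ∀ x t, f' (x + tp, t) = f' (x, t) := by
    intro x t; simp only [hf']
    split_ifs with h
    · exact hp x t h.1 h.2
    · rfl
  have hf'c : ContinuousOn f' S := hf.congr fun q hq => hf'e q hq.1 hq.2
  have hχc : ContinuousOn (fun q : ℝ × ℝ => (χ q.2 : ℂ)) S :=
    (Complex.continuous_ofReal.comp (hχ.comp continuous_snd)).continuousOn
  set W := glue c δ D g (fun q => Complex.exp (χ q.2 * f' q)) (fun _ => 1) with hW
  have hα : -δ < -(2 * δ / 3) := by linarith
  have perH : ∀ x t, (fun q : ℝ × ℝ => Complex.exp (χ q.2 * f' q)) (x + tp, t) =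
    (fun q : ℝ × ℝ => Complex.exp (χ q.2 * f' q)) (x, t) := by intro x t; simp only [hf'p]
  have hdeep : ∀ q : ℝ × ℝ, -δ < q.2 → q.2 < -(2 * δ / 3) → q.2 < 0 →
    (fun q : ℝ × ℝ => Complex.exp (χ q.2 * f' q)) q = g (c q) := by
    intro q a b d
    simp only [h1 _ b, hf'e q a d]; simpa using hfg q a d
  have hWc : Continuous W := by
    refine C.glue_cont perH (α := -(2 * δ / 3)) (β := δ / 3) hα hdeep hg ?_ (by linarith) (by linarith) ?_ ?_
    · exact Complex.continuous_exp.comp_continuousOn (hχc.mul hf'c)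
    · intro q a b; simp [h2 q.2 a]
    · intro z _; exact continuousAt_const
  have hWne : ∀ z, W z ≠ 0 := by
    intro z
    by_cases hz : z ∈ D
    · rcases C.cases _ hα hz with ⟨q, a, b, rfl⟩ | h
      · rw [hW, C.glue_c perH a b]; exact Complex.exp_ne_zero _
      · rw [hW, C.glue_deep perH hdeep hz h]; exact h0 z hz
    · rw [hW, C.glue_out hz]; exact one_ne_zero
  obtain ⟨ℓ, hℓ, hℓW⟩ := exists_log_univ hWc hWne
  set T := glue c δ D (fun _ => (0 : ℂ)) (fun q => (1 - χ q.2) * f' q) (fun _ => 0) with hT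
  have perT : ∀ x t, (fun q : ℝ × ℝ => (1 - (χ q.2 : ℂ)) * f' q) (x + tp, t) =
    (fun q : ℝ × ℝ => (1 - (χ q.2 : ℂ)) * f' q) (x, t) := by intro x t; simp only [hf'p]
  have hdeepT : ∀ q : ℝ × ℝ, -δ < q.2 → q.2 < -(2 * δ / 3) → q.2 < 0 →
    (fun q : ℝ × ℝ => (1 - (χ q.2 : ℂ)) * f' q) q = 0 := by
    intro q a b d
    simp only [h1 _ b]; simp
  refine ⟨fun z => ℓ z + T z, ?_, ?_⟩
  · intro z hz
    refine (hℓ.continuousAt.add ?_).continuousWithinAt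
    refine C.glue_cont_D perT hα hdeepT continuousOn_const ?_ hz
    exact (continuousOn_const.sub hχc).mul hf'c
  · intro z hz
    rw [Complex.exp_add, hℓW]
    rcases C.cases _ hα hz with ⟨q, a, b, rfl⟩ | h
    · rw [hW, hT, C.glue_c perH a b, C.glue_c perT a b, ← Complex.exp_add, ← hfg q a b, hf'e q a b]
      congr 1; ring
    · rw [hW, hT, C.glue_deep perH hdeep hz h, C.glue_deep perT hdeepT hz h]; simp

lemma shift_line {δ t0 : ℝ} {F : ℝ → ℂ} (hF : Continuous F) (per : ∀ x, F (x + tp) = F x)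
    {v : ℝ → ℂ} (hv : Continuous v) (h : ∀ x, Complex.exp (F x) = Complex.exp (v x)) : v tp = v 0 := by
  obtain ⟨n, hn⟩ := log_const (S := univ) isPreconnected_univ hF.continuousOn hv.continuousOn
    (fun x _ => h x) univ_nonempty
  have h1 := hn tp trivial
  have h2 := hn 0 trivial
  have h3 := per 0
  rw [zero_add] at h3
  rw [h3, h2] at h1
  exact (add_right_cancel h1).symm

theorem hasLog (C : Collar D c δ) {g : ℂ → ℂ} (hg : ContinuousOn g D) (h0 : ∀ z ∈ D, g z ≠ 0) :
    ∃ ℓ : ℂ → ℂ, ContinuousOn ℓ D ∧ ∀ z ∈ D, Complex.exp (ℓ z) = g z := by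

  have hbase : ∃ z0 ∈ D, ∃ δ', ∃ C' : Collar D c δ', z0 ∉ c '' {q | -δ' < q.2 ∧ q.2 < 0} := by
    have hδ := C.pos
    refine ⟨c (0, -(δ / 2)), C.mem_of (by simp; linarith) (by simp; linarith), δ / 2,
      C.restrict (by linarith) (by linarith), ?_⟩
    rintro ⟨q, hq, h⟩
    have := (C.inj _ _ (by rw [abs_lt]; constructor <;> linarith [hq.1, hq.2]) (by
      rw [abs_lt]; constructor <;> simp <;> linarith) h).1
    simp at this
    linarith [hq.1]
  clear C
  obtain ⟨z0, hz0, δ, C, hz0c⟩ := hbase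
  have hδ := C.pos
  obtain ⟨χ, hχ, h1, h2⟩ := exists_cut C.pos
  set S : Set (ℝ × ℝ) := {q | -δ < q.2 ∧ q.2 < 0} with hS
  have hχc : ContinuousOn (fun q : ℝ × ℝ => (χ q.2 : ℂ)) S :=
    (Complex.continuous_ofReal.comp (hχ.comp continuous_snd)).continuousOn
  have hα : -δ < -(2 * δ / 3) := by linarith
  have hz0q : ∀ q : ℝ × ℝ, -δ < q.2 → q.2 < 0 → c q - z0 ≠ 0 := fun q a b h =>
    hz0c ⟨q, ⟨a, b⟩, sub_eq_zero.1 h⟩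
  obtain ⟨f0, m, hf0, hf0e, hf0p⟩ := lift_strip (a := -δ) (b := 0) (by linarith) (H := fun q => c q - z0)
    (C.contOn_strip.sub continuousOn_const) hz0q (fun x t => by simp only [C.per])
  obtain ⟨f, n, hf, hfe, hfp⟩ := lift_strip (a := -δ) (b := 0) (by linarith) (H := fun q => g (c q))
    (hg.comp C.contOn_strip (fun q hq => C.mem_of hq.1 hq.2)) (fun q a b => h0 _ (C.mem_of a b))
    (fun x t => by simp only [C.per])
  have hexp : ∀ k : ℤ, Complex.exp (k * (tp * Complex.I)) = 1 := fun k => by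
    rw [Complex.exp_eq_one_iff]; exact ⟨k, by push_cast; ring⟩
  have hne : ∀ z ∉ D, z - z0 ≠ 0 := fun z hz h => hz (by rw [sub_eq_zero.1 h]; exact hz0)
  classical

  have main : ∀ (G : ℂ → ℂ) (E : ℂ → ℂ) (u : ℝ × ℝ → ℂ), ContinuousOn G D → (∀ z ∈ D, G z ≠ 0) →
      (∀ z ∉ D, ContinuousAt E z) → (∀ z ∉ D, E z ≠ 0) → ContinuousOn u S →
      (∀ x t, -δ < t → t < 0 → Complex.exp (u (x + tp, t)) = Complex.exp (u (x, t))) →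
      (∀ q : ℝ × ℝ, -δ < q.2 → q.2 < -(2 * δ / 3) → q.2 < 0 → Complex.exp (u q) = G (c q)) →
      (∀ q : ℝ × ℝ, -(δ / 3) < q.2 → q.2 < 0 → Complex.exp (u q) = E (c q)) →
      ∃ ℓ : ℂ → ℂ, Continuous ℓ ∧ (∀ z ∉ D, Complex.exp (ℓ z) = E z) ∧
        ∀ q : ℝ × ℝ, -δ < q.2 → q.2 < 0 → Complex.exp (ℓ (c q)) = Complex.exp (u q) := by
    intro G E u hG hG0 hE hE0 hu hup huG huE
    set H : ℝ × ℝ → ℂ := fun q => if -δ < q.2 ∧ q.2 < 0 then Complex.exp (u q) else 1 with hH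
    have hHe : ∀ q : ℝ × ℝ, -δ < q.2 → q.2 < 0 → H q = Complex.exp (u q) := fun q a b => by simp [hH, a, b]
    have perH : ∀ x t, H (x + tp, t) = H (x, t) := by
      intro x t; simp only [hH]
      split_ifs with h
      · exact hup x t h.1 h.2
      · rfl
    have hdeep : ∀ q : ℝ × ℝ, -δ < q.2 → q.2 < -(2 * δ / 3) → q.2 < 0 → H q = G (c q) := by
      intro q a b d; rw [hHe q a d, huG q a b d]
    have hWc : Continuous (glue c δ D G H E) := by
      refine C.glue_cont perH (α := -(2 * δ / 3)) (β := δ / 3) hα hdeep hG ?_ (by linarith) (by linarith) ?_ hE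
      · exact (Complex.continuous_exp.comp_continuousOn hu).congr fun q hq => hHe q hq.1 hq.2
      · intro q a b; rw [hHe q (by linarith) b, huE q a b]
    have hWne : ∀ z, glue c δ D G H E z ≠ 0 := by
      intro z
      by_cases hz : z ∈ D
      · rcases C.cases _ hα hz with ⟨q, a, b, rfl⟩ | h
        · rw [C.glue_c perH a b, hHe q a b]; exact Complex.exp_ne_zero _
        · rw [C.glue_deep perH hdeep hz h]; exact hG0 z hz
      · rw [C.glue_out hz]; exact hE0 z hz
    obtain ⟨ℓ, hℓ, hℓW⟩ := exists_log_univ hWc hWne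
    refine ⟨ℓ, hℓ, fun z hz => by rw [hℓW, C.glue_out hz], fun q a b => by
      rw [hℓW, C.glue_c perH a b, hHe q a b]⟩

  have hm : m ≠ 0 := by
    intro hm
    subst hm
    obtain ⟨ℓ, hℓ, hℓE, -⟩ := main (fun _ => 1) (fun z => (z - z0)⁻¹) (fun q => (χ q.2 - 1) * f0 q)
      continuousOn_const (fun _ _ => one_ne_zero)
      (fun z hz => (continuousAt_id.sub continuousAt_const).inv₀ (hne z hz))
      (fun z hz => inv_ne_zero (hne z hz)) ((hχc.sub continuousOn_const).mul hf0)
      (fun x t a b => by simp only [hf0p x t a b]; simp)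
      (fun q a b d => by simp [h1 _ b])
      (fun q a b => by simp only [h2 _ a]; rw [← hf0e q (by linarith) b, ← Complex.exp_neg]; simp)
    obtain ⟨R, hR, hRD⟩ := C.bounded.subset_ball_lt 0 z0
    have hRz : ∀ x : ℝ, z0 + R * Complex.exp (x * Complex.I) ∉ D := by
      intro x h
      have := hRD h
      rw [mem_ball, dist_eq_norm] at this
      simp [Complex.norm_exp_ofReal_mul_I, abs_of_pos hR] at this
    have := shift_line (δ := δ) (t0 := 0) (F := fun x : ℝ => ℓ (z0 + R * Complex.exp (x * Complex.I)))
      (v := fun x : ℝ => -(Real.log R : ℂ) - x * Complex.I) (by fun_prop) (by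
        intro x
        have := hexp 1
        simp only [Complex.ofReal_add, add_mul, Complex.exp_add]
        simp at this ⊢) (by fun_prop) (by
        intro x
        rw [hℓE _ (hRz x), add_sub_cancel_left, Complex.exp_sub, Complex.exp_neg, ← Complex.ofReal_exp,
          Real.exp_log hR, mul_inv]
        rfl)
    simp at this
  have hn : n = 0 := by
    have hl : ∀ (F : ℂ) (k : ℤ), Complex.exp (k * F) = Complex.exp F ^ k := fun F k => Complex.exp_int_mul F k
    obtain ⟨ℓ, hℓ, -, hℓc⟩ := main (fun z => g z ^ m) (fun z => (z - z0) ^ n)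
      (fun q => χ q.2 * (m * f q) + (1 - χ q.2) * (n * f0 q))
      (hg.zpow₀ m (fun z hz => Or.inl (h0 z hz))) (fun z hz => zpow_ne_zero _ (h0 z hz))
      (fun z hz => (continuousAt_id.sub continuousAt_const).zpow₀ n (Or.inl (hne z hz)))
      (fun z hz => zpow_ne_zero _ (hne z hz))
      ((hχc.mul (continuousOn_const.mul hf)).add ((continuousOn_const.sub hχc).mul (continuousOn_const.mul hf0)))
      (fun x t a b => by
        simp only [hf0p x t a b, hfp x t a b]
        have : (χ t : ℂ) * (m * (f (x, t) + n * (tp * Complex.I))) + (1 - χ t) * (n * (f0 (x, t) + m * (tp * Complex.I)))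
          = (χ t * (m * f (x, t)) + (1 - χ t) * (n * f0 (x, t))) + ((m * n : ℤ) : ℂ) * (tp * Complex.I) := by
          push_cast; ring
        rw [this, Complex.exp_add, hexp, mul_one])
      (fun q a b d => by simp only [h1 _ b]; rw [← hfe q a d, ← hl]; simp)
      (fun q a b => by simp only [h2 _ a]; rw [← hf0e q (by linarith) b, ← hl]; simp)
    set t0 := -(5 * δ / 6) with ht0
    have hline : Continuous (fun x : ℝ => ((x, t0) : ℝ × ℝ)) := by fun_prop
    have hmem : ∀ x : ℝ, ((x, t0) : ℝ × ℝ) ∈ S := fun x => ⟨by simp [ht0]; linarith, by simp [ht0]; linarith⟩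
    have := shift_line (δ := δ) (t0 := 0) (F := fun x : ℝ => ℓ (c (x, t0))) (v := fun x => m * f (x, t0))
      (hℓ.comp (C.contOn_strip.comp_continuous hline hmem)) (by intro x; simp only [C.per])
      (continuous_const.mul (hf.comp_continuous hline hmem)) (by
        intro x
        rw [hℓc _ (hmem x).1 (hmem x).2]
        simp [h1 t0 (by rw [ht0]; linarith)])
    have h3 := hfp 0 t0 (hmem 0).1 (hmem 0).2
    rw [zero_add] at h3
    rw [h3] at this
    have h4 : (m : ℂ) * n * (tp * Complex.I) = 0 := by linear_combination this
    have h5 : (tp : ℂ) * Complex.I ≠ 0 := mul_ne_zero (by exact_mod_cast tp_pos.ne') Complex.I_ne_zero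
    have h6 := (mul_eq_zero.1 h4).resolve_right h5
    exact_mod_cast (mul_eq_zero.1 h6).resolve_left (by exact_mod_cast hm)
  subst hn
  exact C.log_of_zero hg h0 hf hfe (fun x t a b => by rw [hfp x t a b]; simp)

end Collar
end Glu

namespace Glu
open Set Filter Topology Metric
open scoped ContDiff

lemma log_diff {D : Set ℂ} (ho : IsOpen D) {ℓ h : ℂ → ℂ} (hl : ContinuousOn ℓ D)
    (hh : DifferentiableOn ℂ h D) (he : ∀ z ∈ D, Complex.exp (ℓ z) = h z) :
    DifferentiableOn ℂ ℓ D := by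
  intro z hz
  have hzn := ho.mem_nhds hz
  have h0 : h z ≠ 0 := by rw [← he z hz]; exact Complex.exp_ne_zero _
  have hc : ContinuousAt ℓ z := hl.continuousAt hzn
  have hi : Tendsto (fun w => (ℓ w - ℓ z).im) (𝓝 z) (𝓝 0) := by
    have : ContinuousAt (fun w => (ℓ w - ℓ z).im) z :=
      Complex.continuous_im.continuousAt.comp (hc.sub continuousAt_const)
    simpa [ContinuousAt] using this
  have h1 : ∀ᶠ w in 𝓝 z, (ℓ w - ℓ z).im ∈ Ioo (-Real.pi) Real.pi :=
    hi (Ioo_mem_nhds (by linarith [Real.pi_pos]) Real.pi_pos)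
  have heq : ℓ =ᶠ[𝓝 z] fun w => ℓ z + Complex.log (h w / h z) := by
    filter_upwards [h1, hzn] with w hw hwD
    rw [← he w hwD, ← he z hz, ← Complex.exp_sub, Complex.log_exp hw.1 hw.2.le]
    ring
  refine (DifferentiableAt.congr_of_eventuallyEq ?_ heq).differentiableWithinAt
  refine (differentiableAt_const _).add (DifferentiableAt.clog ?_ ?_)
  · exact (hh.differentiableAt hzn).div_const _
  · rw [div_self h0]; exact Complex.one_mem_slitPlane

lemma hurwitz {ι : Type*} {p : Filter ι} [p.NeBot] {D : Set ℂ} (ho : IsOpen D) {F : ι → ℂ → ℂ} {g : ℂ → ℂ}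
    (hF : TendstoLocallyUniformlyOn F g p D) (hd : ∀ n, DifferentiableOn ℂ (F n) D)
    (hn : ∀ n, ∀ z ∈ D, F n z ≠ 0) {z : ℂ} (hz : z ∈ D) (hg : g z = 0) : ∀ᶠ w in 𝓝 z, g w = 0 := by
  have hgd : DifferentiableOn ℂ g D := hF.differentiableOn (Eventually.of_forall hd) ho
  have hga : AnalyticAt ℂ g z := hgd.analyticAt (ho.mem_nhds hz)
  rcases hga.eventually_eq_zero_or_eventually_ne_zero with h | h
  · exact h
  exfalso
  rw [eventually_nhdsWithin_iff] at h
  obtain ⟨r, hr, hb⟩ := Metric.eventually_nhds_iff_ball.1 (h.and (ho.mem_nhds hz))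
  have hr2 : 0 < r/2 := by positivity
  have hsub : closedBall z (r/2) ⊆ D := fun w hw => (hb w (closedBall_subset_ball (by linarith) hw)).2
  have hsph : sphere z (r/2) ⊆ D := sphere_subset_closedBall.trans hsub
  obtain ⟨w0, hw0, hmin⟩ := (isCompact_sphere z (r/2)).exists_isMinOn (NormedSpace.sphere_nonempty.2 hr2.le)
    ((hgd.continuousOn.mono hsph).norm)
  have hm : 0 < ‖g w0‖ := by
    rw [norm_pos_iff]
    refine (hb w0 ?_).1 ?_
    · exact sphere_subset_closedBall.trans (closedBall_subset_ball (by linarith)) hw0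
    · intro h; rw [mem_singleton_iff.1 h] at hw0; simp at hw0; linarith
  set m := ‖g w0‖ with hmdef
  have hu := (tendstoLocallyUniformlyOn_iff_tendstoUniformlyOn_of_compact (isCompact_closedBall z (r/2))).1
    (hF.mono hsub)
  rw [Metric.tendstoUniformlyOn_iff] at hu
  obtain ⟨n, hn'⟩ := (hu (m/8) (by positivity)).exists
  have hz1 : ‖F n z‖ < m/8 := by
    have := hn' z (mem_closedBall_self hr2.le)
    rwa [hg, dist_zero_left] at this
  have hs : ∀ w ∈ sphere z (r/2), m/2 ≤ ‖F n w - F n z‖ := by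
    intro w hw
    have h1 := hn' w (sphere_subset_closedBall hw)
    have h2 : m ≤ ‖g w‖ := hmin hw
    rw [dist_eq_norm] at h1
    have h3 : ‖g w‖ ≤ ‖g w - F n w‖ + ‖F n w - F n z‖ + ‖F n z‖ := by
      calc ‖g w‖ = ‖(g w - F n w) + (F n w - F n z) + F n z‖ := by congr 1; ring
        _ ≤ _ := norm_add₃_le
    linarith
  have hdc : DiffContOnCl ℂ (F n) (ball z (r/2)) := by
    apply DifferentiableOn.diffContOnCl
    rw [closure_ball _ hr2.ne']
    exact (hd n).mono hsub
  have hfr : ∃ᶠ w in 𝓝 z, F n w ≠ F n z := by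
    intro hcon
    simp only [not_not] at hcon
    have han : AnalyticOnNhd ℂ (F n) (closedBall z (r/2)) := fun w hw => (hd n).analyticAt (ho.mem_nhds (hsub hw))
    have := han.eqOn_of_preconnected_of_eventuallyEq (g := fun _ => F n z) (fun _ _ => analyticAt_const)
      (convex_closedBall z (r/2)).isPreconnected (mem_closedBall_self hr2.le) hcon
    have h1 := hs w0 hw0
    rw [this (sphere_subset_closedBall hw0)] at h1
    simp at h1; linarith
  have := hdc.ball_subset_image_closedBall hr2 hs hfr (show (0:ℂ) ∈ _ by
    rw [mem_ball, dist_zero_left]; linarith)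
  obtain ⟨w, hw, hw'⟩ := this
  exact hn n w (hsub hw) hw'

def bl (w z : ℂ) : ℂ := (z - w) / (1 - (starRingEnd ℂ) w * z)

lemma bl_den {w z : ℂ} (hw : ‖w‖ < 1) (hz : ‖z‖ < 1) : 1 - (starRingEnd ℂ) w * z ≠ 0 := by
  intro h
  have : ‖(starRingEnd ℂ) w * z‖ = 1 := by rw [← sub_eq_zero.1 h]; simp
  rw [norm_mul, RCLike.norm_conj] at this
  nlinarith [norm_nonneg w, norm_nonneg z]

lemma bl_norm {w z : ℂ} (hw : ‖w‖ < 1) (hz : ‖z‖ < 1) :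
    1 - ‖bl w z‖^2 = (1 - ‖w‖^2) * (1 - ‖z‖^2) / ‖1 - (starRingEnd ℂ) w * z‖^2 := by
  have h := bl_den hw hz
  have h' : ‖1 - (starRingEnd ℂ) w * z‖^2 ≠ 0 := by simpa using h
  rw [bl, norm_div, div_pow, eq_div_iff h', sub_mul, div_mul_cancel₀ _ h']
  simp only [← Complex.normSq_eq_norm_sq, Complex.normSq_apply]
  simp
  ring

lemma bl_lt {w z : ℂ} (hw : ‖w‖ < 1) (hz : ‖z‖ < 1) : ‖bl w z‖ < 1 := by
  have h := bl_norm hw hz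
  have h1 : 0 < (1 - ‖w‖^2) * (1 - ‖z‖^2) / ‖1 - (starRingEnd ℂ) w * z‖^2 := by
    have := bl_den hw hz
    have a1 : 0 < 1 - ‖w‖^2 := by nlinarith [norm_nonneg w]
    have a2 : 0 < 1 - ‖z‖^2 := by nlinarith [norm_nonneg z]
    have a3 : 0 < ‖1 - (starRingEnd ℂ) w * z‖ := by simpa using this
    positivity
  nlinarith [norm_nonneg (bl w z)]

lemma bl_inj {w z z' : ℂ} (hw : ‖w‖ < 1) (hz : ‖z‖ < 1) (hz' : ‖z'‖ < 1) (h : bl w z = bl w z') : z = z' := by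
  rw [bl, bl, div_eq_div_iff (bl_den hw hz) (bl_den hw hz')] at h
  have h1 : (z - z') * (1 - w * (starRingEnd ℂ) w) = 0 := by linear_combination h
  rcases mul_eq_zero.1 h1 with h2 | h2
  · exact sub_eq_zero.1 h2
  · rw [mul_comm] at h2; exact absurd h2 (bl_den hw hw)

lemma bl_deriv {w z : ℂ} (hw : ‖w‖ < 1) (hz : ‖z‖ < 1) :
    HasDerivAt (bl w) ((1 - ‖w‖^2 : ℝ) / (1 - (starRingEnd ℂ) w * z)^2) z := by
  have h := bl_den hw hz
  have := ((hasDerivAt_id z).sub_const w).div (((hasDerivAt_id z).const_mul ((starRingEnd ℂ) w)).const_sub 1) h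
  refine this.congr_deriv ?_
  congr 1
  have : (‖w‖^2 : ℂ) = w * (starRingEnd ℂ) w := (Complex.mul_conj' w).symm
  push_cast
  rw [this]; simp; ring

structure Adm (D : Set ℂ) (f : ℂ → ℂ) : Prop where
  df : DifferentiableOn ℂ f D
  mp : ∀ z ∈ D, ‖f z‖ < 1
  nj : InjOn f D
  dn : ∀ z ∈ D, deriv f z ≠ 0

def qq (f : ℂ → ℂ) (z : ℂ) : ℝ := ‖deriv f z‖ / (1 - ‖f z‖^2)

lemma Adm.bl {D : Set ℂ} (ho : IsOpen D) {f : ℂ → ℂ} (A : Adm D f) {w : ℂ} (hw : ‖w‖ < 1) :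
    Adm D (fun z => bl w (f z)) ∧ ∀ z ∈ D, qq (fun z => Glu.bl w (f z)) z = qq f z := by
  have hd : ∀ z ∈ D, HasDerivAt (fun z => Glu.bl w (f z))
      (((1 - ‖w‖^2 : ℝ) / (1 - (starRingEnd ℂ) w * f z)^2) * deriv f z) z := fun z hz =>
    (bl_deriv hw (A.mp z hz)).comp z (A.df.differentiableAt (ho.mem_nhds hz)).hasDerivAt
  have a1 : 0 < 1 - ‖w‖^2 := by nlinarith [norm_nonneg w]
  refine ⟨⟨fun z hz => (hd z hz).differentiableAt.differentiableWithinAt, fun z hz => bl_lt hw (A.mp z hz),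
    fun z hz z' hz' h => A.nj hz hz' (bl_inj hw (A.mp z hz) (A.mp z' hz') h), fun z hz => ?_⟩, fun z hz => ?_⟩
  · rw [(hd z hz).deriv]
    have := bl_den hw (A.mp z hz)
    refine mul_ne_zero (div_ne_zero ?_ (pow_ne_zero _ this)) (A.dn z hz)
    exact_mod_cast a1.ne'
  · have h := bl_den hw (A.mp z hz)
    have h' : ‖1 - (starRingEnd ℂ) w * f z‖ ≠ 0 := by simpa using h
    have a2 : 0 < 1 - ‖f z‖^2 := by nlinarith [norm_nonneg (f z), A.mp z hz]
    rw [qq, qq, (hd z hz).deriv, bl_norm hw (A.mp z hz), norm_mul, norm_div, norm_pow, Complex.norm_real,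
      Real.norm_of_nonneg a1.le]
    field_simp

lemma rmt {D : Set ℂ} (ho : IsOpen D) (hb : Bornology.IsBounded D) (hc : IsPreconnected D) {z0 : ℂ} (hz0 : z0 ∈ D)
    (hlog : ∀ g : ℂ → ℂ, ContinuousOn g D → (∀ z ∈ D, g z ≠ 0) →
      ∃ ℓ : ℂ → ℂ, ContinuousOn ℓ D ∧ ∀ z ∈ D, Complex.exp (ℓ z) = g z) :
    ∃ f : ℂ → ℂ, Adm D f ∧ BijOn f D (ball 0 1) := by
  have hnb : ∀ z ∈ D, ∃ r > 0, ball z r ⊆ D := fun z hz => Metric.isOpen_iff.1 ho z hz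

  have hlip : ∀ {f}, Adm D f → ∀ {z r}, 0 < r → ball z r ⊆ D → ∀ w ∈ ball z r,
      dist (f w) (f z) ≤ 2 / r * dist w z := by
    intro f A z r hr hs w hw
    refine Complex.dist_le_div_mul_dist_of_mapsTo_ball (A.df.mono hs) ?_ hw
    intro y hy
    have h1 := A.mp y (hs hy)
    have h2 := A.mp z (hs (mem_ball_self hr))
    simp only [mem_closedBall, mem_ball, dist_eq_norm]
    have := norm_sub_le (f y) (f z); linarith

  set S := {x : ℝ | ∃ f, Adm D f ∧ x = ‖deriv f z0‖} with hS
  have hSb : BddAbove S := by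
    obtain ⟨r, hr, hs⟩ := hnb z0 hz0
    refine ⟨2 / r, ?_⟩
    rintro x ⟨f, A, rfl⟩
    refine Complex.norm_deriv_le_div_of_mapsTo_ball (A.df.mono hs) ?_ hr
    intro y hy
    have h1 := A.mp y (hs hy)
    have h2 := A.mp z0 hz0
    simp only [mem_closedBall, mem_ball, dist_eq_norm]
    have := norm_sub_le (f y) (f z0); linarith
  obtain ⟨x0, hx0, hx0S⟩ : ∃ x, 0 < x ∧ x ∈ S := by
    obtain ⟨R, hR, hRD⟩ := hb.subset_ball_lt 0 0
    have hRc : (R : ℂ) ≠ 0 := by exact_mod_cast hR.ne'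
    have hd : ∀ z : ℂ, HasDerivAt (fun z : ℂ => z / R) (1 / R) z := fun z => (hasDerivAt_id z).div_const _
    refine ⟨_, ?_, fun z => z / R, ⟨fun z hz => (hd z).differentiableAt.differentiableWithinAt, ?_, ?_, ?_⟩, rfl⟩
    · rw [(hd _).deriv]; simp [hR.ne']
    · intro z hz
      have := hRD hz
      rw [mem_ball_zero_iff] at this
      rw [norm_div, Complex.norm_real, Real.norm_of_nonneg hR.le, div_lt_one hR]; exact this
    · intro z _ z' _ h
      exact (div_left_inj' hRc).1 h
    · intro z _; rw [(hd _).deriv]; simp [hRc]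
  obtain ⟨u, -, hu, huS⟩ := exists_seq_tendsto_sSup ⟨x0, hx0S⟩ hSb
  choose F hF hFu using huS
  have hsup : 0 < sSup S := hx0.trans_le (le_csSup hSb hx0S)
  let p : Ultrafilter ℕ := Filter.hyperfilter ℕ
  have hp : (p : Filter ℕ) ≤ atTop := Nat.hyperfilter_le_atTop
  have hlim : ∀ z, ∃ y : ℂ, z ∈ D → Tendsto (fun n => F n z) p (𝓝 y) := by
    intro z
    by_cases hz : z ∈ D
    · obtain ⟨y, -, hy⟩ := (isCompact_closedBall (0:ℂ) 1).ultrafilter_le_nhds (p.map fun n => F n z) (by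
        rw [le_principal_iff]
        refine Filter.mem_map.2 (Filter.univ_mem' fun n => ?_)
        simpa using ((hF n).mp z hz).le)
      exact ⟨y, fun _ => hy⟩
    · exact ⟨0, fun h => absurd h hz⟩
  choose f hf using hlim
  have hloc : TendstoLocallyUniformlyOn F f p D := by
    rw [Metric.tendstoLocallyUniformlyOn_iff]
    intro ε hε z hz
    obtain ⟨r, hr, hs⟩ := hnb z hz
    have hlF : ∀ w ∈ ball z r, dist (f w) (f z) ≤ 2 / r * dist w z := fun w hw =>
      le_of_tendsto ((hf w (hs hw)).dist (hf z hz)) (Eventually.of_forall fun n => hlip (hF n) hr hs w hw)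
    refine ⟨ball z (min r (r / 2 * (ε/4))), mem_nhdsWithin_of_mem_nhds (ball_mem_nhds _ (by positivity)), ?_⟩
    filter_upwards [Metric.tendsto_nhds.1 (hf z hz) (ε/4) (by positivity)] with n hn w hw
    have hw1 : w ∈ ball z r := ball_subset_ball (min_le_left _ _) hw
    have hw2 : dist w z < r / 2 * (ε/4) := lt_of_lt_of_le hw (min_le_right _ _)
    have h3 : 2 / r * dist w z < ε / 4 := by
      calc 2 / r * dist w z < 2 / r * (r / 2 * (ε/4)) := by gcongr
        _ = ε / 4 := by field_simp
    have h1 := hlF w hw1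
    have h2 := hlip (hF n) hr hs w hw1
    calc dist (f w) (F n w) ≤ dist (f w) (f z) + dist (f z) (F n z) + dist (F n z) (F n w) := dist_triangle4 _ _ _ _
      _ < ε := by rw [dist_comm (f z), dist_comm (F n z) (F n w)]; linarith
  have hfd : DifferentiableOn ℂ f D := hloc.differentiableOn (Eventually.of_forall fun n => (hF n).df) ho
  have hlocd : TendstoLocallyUniformlyOn (deriv ∘ F) (deriv f) p D :=
    hloc.deriv (Eventually.of_forall fun n => (hF n).df) ho
  have hfz0 : ‖deriv f z0‖ = sSup S := by
    refine tendsto_nhds_unique ((hlocd.tendsto_at hz0).norm) ?_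
    have := hu.mono_left hp
    simpa only [Function.comp_apply, ← hFu] using this
  have hdd : DifferentiableOn ℂ (deriv f) D := hfd.deriv ho
  have key : ∀ z ∈ D, ¬ ∀ᶠ w in 𝓝 z, deriv f w = 0 := by
    intro z hz h
    have han : AnalyticOnNhd ℂ (deriv f) D := fun w hw => hdd.analyticAt (ho.mem_nhds hw)
    have := han.eqOn_of_preconnected_of_eventuallyEq (g := fun _ => 0) (fun _ _ => analyticAt_const) hc hz h hz0
    simp only at this
    rw [this] at hfz0; simp at hfz0; linarith
  have key2 : ∀ z ∈ D, ∀ c, ¬ ∀ᶠ w in 𝓝 z, f w = c := by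
    intro z hz c h
    refine key z hz ?_
    filter_upwards [h.eventually_nhds] with w hw
    have : f =ᶠ[𝓝 w] fun _ => c := hw
    rw [this.deriv_eq]; simp
  have hle : ∀ z ∈ D, ‖f z‖ ≤ 1 := fun z hz =>
    le_of_tendsto (hf z hz).norm (Eventually.of_forall fun n => ((hF n).mp z hz).le)
  have Af : Adm D f := by
    refine ⟨hfd, ?_, ?_, ?_⟩
    · intro z hz
      refine lt_of_le_of_ne (hle z hz) fun h1 => ?_
      have := Complex.eqOn_of_isPreconnected_of_isMaxOn_norm hc ho hfd hz (fun w hw => by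
        simpa [h1] using hle w hw)
      refine key2 z hz (f z) ?_
      filter_upwards [ho.mem_nhds hz] with w hw using this hw
    · intro z1 h1 z2 h2 h12
      by_contra hne
      have ho' : IsOpen (D \ {z1}) := ho.sdiff isClosed_singleton
      have hl : TendstoLocallyUniformlyOn (fun n z => F n z - F n z1) (fun z => f z - f z1) p (D \ {z1}) := by
        have ha := hloc.mono (diff_subset (s := D) (t := {z1}))
        rw [Metric.tendstoLocallyUniformlyOn_iff] at ha ⊢
        intro ε hε z hz
        obtain ⟨t, ht, hh⟩ := ha (ε/2) (by positivity) z hz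
        refine ⟨t, ht, ?_⟩
        filter_upwards [hh, Metric.tendsto_nhds.1 (hf z1 h1) (ε/2) (by positivity)] with n hn hn1 y hy
        have := dist_sub_sub_le (f y) (f z1) (F n y) (F n z1)
        have := hn y hy
        rw [dist_comm] at hn1
        linarith
      have := hurwitz ho' hl (fun n => ((hF n).df.mono diff_subset).sub_const _) (fun n z hz h => by
        exact hz.2 ((hF n).nj hz.1 h1 (sub_eq_zero.1 h))) (z := z2) ⟨h2, fun h => hne h.symm⟩ (by rw [h12, sub_self])
      exact key2 z2 h2 (f z1) (this.mono fun w hw => sub_eq_zero.1 hw)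
    · intro z hz h
      exact key z hz (hurwitz ho hlocd (fun n => (hF n).df.deriv ho) (fun n z hz => (hF n).dn z hz) hz h)
  refine ⟨f, Af, fun z hz => by simpa using Af.mp z hz, Af.nj, ?_⟩
  intro w hw
  by_contra hnot
  have hw1 : ‖w‖ < 1 := by simpa using hw
  obtain ⟨A1, hq1⟩ := Af.bl ho hw1
  set h := fun z => bl w (f z) with hh
  have hne : ∀ z ∈ D, h z ≠ 0 := by
    intro z hz h0
    rcases div_eq_zero_iff.1 h0 with h1 | h1
    · exact hnot ⟨z, hz, sub_eq_zero.1 h1⟩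
    · exact bl_den hw1 (Af.mp z hz) h1
  obtain ⟨ℓ, hlc, hle'⟩ := hlog h A1.df.continuousOn hne
  have hld := log_diff ho hlc A1.df hle'
  set g := fun z => Complex.exp (ℓ z / 2) with hg
  have hg2 : ∀ z ∈ D, g z ^ 2 = h z := by
    intro z hz
    rw [hg, ← hle' z hz]; simp only; rw [← Complex.exp_nat_mul]; congr 1; push_cast; ring
  have hgd : DifferentiableOn ℂ g D := (hld.div_const 2).cexp
  have hder : ∀ z ∈ D, deriv h z = 2 * g z * deriv g z := by
    intro z hz
    have h1 := ((hgd.differentiableAt (ho.mem_nhds hz)).hasDerivAt).pow 2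
    have h2 : h =ᶠ[𝓝 z] fun z => g z ^ 2 := by
      filter_upwards [ho.mem_nhds hz] with y hy using (hg2 y hy).symm
    rw [h2.deriv_eq]
    have := h1.deriv
    simp at this
    exact this
  have hgl : ∀ z ∈ D, ‖g z‖ < 1 := by
    intro z hz
    have h1 := A1.mp z hz
    have h2 : ‖g z‖^2 = ‖h z‖ := by rw [← norm_pow, hg2 z hz]
    change ‖h z‖ < 1 at h1
    nlinarith [norm_nonneg (g z)]
  have Ag : Adm D g := by
    refine ⟨hgd, hgl, ?_, ?_⟩
    · intro z hz z' hz' he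
      refine A1.nj hz hz' ?_
      change h z = h z'
      rw [← hg2 z hz, ← hg2 z' hz', he]
    · intro z hz h0
      refine A1.dn z hz ?_
      change deriv h z = 0
      rw [hder z hz, h0, mul_zero]
  obtain ⟨A2, hq2⟩ := Ag.bl ho (hgl z0 hz0)
  have hle2 : ‖deriv (fun z => bl (g z0) (g z)) z0‖ ≤ sSup S := le_csSup hSb ⟨_, A2, rfl⟩
  have e2 := hq2 z0 hz0
  have e1 := hq1 z0 hz0
  have b0 : bl (g z0) (g z0) = 0 := by simp [bl]
  rw [qq, b0] at e2
  simp at e2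
  have hgn : qq h z0 = qq g z0 * (2 * ‖g z0‖ / (1 + ‖g z0‖^2)) := by
    rw [qq, qq, hder z0 hz0, ← hg2 z0 hz0]
    have : 0 < 1 - ‖g z0‖^2 := by nlinarith [norm_nonneg (g z0), hgl z0 hz0]
    simp only [norm_mul, norm_pow, Complex.norm_ofNat]
    have e : (1 - (‖g z0‖^2)^2) = (1 - ‖g z0‖^2) * (1 + ‖g z0‖^2) := by ring
    rw [e]
    field_simp
  have hfq : sSup S ≤ qq f z0 := by
    rw [qq, hfz0]
    have : 0 < 1 - ‖f z0‖^2 := by nlinarith [norm_nonneg (f z0), Af.mp z0 hz0]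
    rw [le_div_iff₀ this]
    nlinarith [norm_nonneg (f z0), sq_nonneg ‖f z0‖]
  have hlt : 2 * ‖g z0‖ / (1 + ‖g z0‖^2) < 1 := by
    rw [div_lt_one (by positivity)]
    nlinarith [hgl z0 hz0]
  have hqpos : 0 < qq g z0 := by
    by_contra hcon
    rw [not_lt] at hcon
    rw [e2] at hle2
    have : qq h z0 ≤ 0 := by
      rw [hgn]; exact mul_nonpos_of_nonpos_of_nonneg hcon (by positivity)
    linarith
  have : qq h z0 < qq g z0 := by rw [hgn]; nlinarith
  rw [e2] at hle2
  linarith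

end Glu

namespace Glu
open Set Filter Topology Metric
open scoped ContDiff

lemma trig_span (P : C(AddCircle tp, ℂ)) (hP : P ∈ Submodule.span ℂ (range (@fourier tp))) :
    ∃ (p p' : ℂ → ℂ) (K : ℂ), (∀ w, HasDerivAt p (p' w) w) ∧ (∀ w, p (w + tp) = p w + K) ∧
      ∀ x : ℝ, p' x = P (x : AddCircle tp) := by
  induction hP using Submodule.span_induction with
  | mem P h =>
    obtain ⟨n, rfl⟩ := h
    have hf : ∀ x : ℝ, @fourier tp n (x : AddCircle tp) = Complex.exp (Complex.I * n * x) := by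
      intro x
      rw [fourier_coe_apply]
      congr 1
      have : (Real.pi : ℂ) ≠ 0 := by exact_mod_cast Real.pi_ne_zero
      simp only [tp]; push_cast; field_simp
    by_cases hn : n = 0
    · subst hn
      refine ⟨fun w => w, fun _ => 1, tp, fun w => hasDerivAt_id w, fun w => rfl, fun x => ?_⟩
      rw [hf]; simp
    · have hn' : Complex.I * n ≠ 0 := mul_ne_zero Complex.I_ne_zero (by exact_mod_cast hn)
      refine ⟨fun w => Complex.exp (Complex.I * n * w) / (Complex.I * n), fun w => Complex.exp (Complex.I * n * w), 0,
        fun w => ?_, fun w => ?_, fun x => (hf x).symm⟩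
      · have := (((hasDerivAt_id w).const_mul (Complex.I * n)).cexp).div_const (Complex.I * n)
        refine this.congr_deriv ?_
        simp only [id]; field_simp
      · rw [add_zero]
        simp only
        rw [mul_add, Complex.exp_add]
        have : Complex.I * n * (tp : ℝ) = n * (2 * Real.pi * Complex.I) := by simp only [tp]; push_cast; ring
        rw [this, Complex.exp_int_mul_two_pi_mul_I, mul_one]
  | zero => exact ⟨fun _ => 0, fun _ => 0, 0, fun w => hasDerivAt_const _ _, by simp, by simp⟩
  | add P P2 _ _ h1 h2 =>
    obtain ⟨p, p', K, a, b, c⟩ := h1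
    obtain ⟨q, q', K', a', b', c'⟩ := h2
    refine ⟨fun w => p w + q w, fun w => p' w + q' w, K + K', fun w => (a w).add (a' w), fun w => ?_, fun x => ?_⟩
    · simp only [b, b']; ring
    · simp only [c, c']; rfl
  | smul k P _ h1 =>
    obtain ⟨p, p', K, a, b, c⟩ := h1
    refine ⟨fun w => k * p w, fun w => k * p' w, k * K, fun w => (a w).const_mul k, fun w => ?_, fun x => ?_⟩
    · simp only [b]; ring
    · simp only [c]; rfl

lemma trig_approx {γ : ℝ → ℂ} (hγ : ContDiff ℝ ∞ γ) (per : ∀ x, γ (x + tp) = γ x) {ε : ℝ} (hε : 0 < ε) :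
    ∃ p : ℂ → ℂ, Differentiable ℂ p ∧ (∀ w, p (w + tp) = p w) ∧
      ∀ x : ℝ, ‖p x - γ x‖ ≤ ε ∧ ‖deriv p x - deriv γ x‖ ≤ ε := by
  haveI : Fact (0 < tp) := ⟨tp_pos⟩
  have hdper : Function.Periodic (deriv γ) tp := by
    intro x
    have : (fun y => γ (y + tp)) = γ := funext per
    have h := deriv_comp_add_const γ tp x
    rw [this] at h; exact h.symm
  have hdc : Continuous (deriv γ) := hγ.continuous_deriv (by simp)
  set η := ε / (2 + 2 * tp) with hη
  have hη0 : 0 < η := by have := tp_pos; positivity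
  let Γ : C(AddCircle tp, ℂ) := ⟨hdper.lift, continuous_coinduced_dom.mpr hdc⟩
  have hΓ : ∀ x : ℝ, Γ (x : AddCircle tp) = deriv γ x := fun x => hdper.lift_coe x
  have hmem : Γ ∈ (Submodule.span ℂ (range (@fourier tp))).topologicalClosure := by
    rw [span_fourier_closure_eq_top]; trivial
  obtain ⟨P, hP, hPΓ⟩ := Metric.mem_closure_iff.1 hmem η hη0
  obtain ⟨p, p', K, h1, h2, h3⟩ := trig_span P hP
  have hclose : ∀ x : ℝ, ‖p' x - deriv γ x‖ ≤ η := by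
    intro x
    rw [h3, ← hΓ, ← dist_eq_norm, dist_comm]
    exact (ContinuousMap.dist_apply_le_dist _).trans hPΓ.le
  have hd : ∀ x : ℝ, HasDerivAt (fun x : ℝ => p x - γ x) (p' x - deriv γ x) x := fun x =>
    ((h1 x).comp_ofReal).sub ((hγ.differentiable (by simp)) x).hasDerivAt
  have mv : ∀ (g g' : ℝ → ℂ) (C : ℝ), (∀ x, HasDerivAt g (g' x) x) → (∀ x, ‖g' x‖ ≤ C) → ∀ x y, ‖g y - g x‖ ≤ C * |y - x| := by
    intro g g' C hg hC x y
    have := Convex.norm_image_sub_le_of_norm_hasDerivWithin_le (fun x _ => (hg x).hasDerivWithinAt) (fun x _ => hC x)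
      convex_univ (mem_univ x) (mem_univ y)
    simpa using this
  have hK : ‖K‖ ≤ η * tp := by
    have := mv _ _ η hd hclose 0 tp
    have h4 : p tp = p 0 + K := by simpa using h2 0
    have h5 : γ tp = γ 0 := by simpa using per 0
    rw [h4, h5, sub_zero, abs_of_pos tp_pos] at this
    convert this using 2; simp
  have htc : (tp : ℂ) ≠ 0 := by exact_mod_cast tp_pos.ne'
  have hKt : ‖K / tp‖ ≤ η := by
    rw [norm_div, Complex.norm_real, Real.norm_of_nonneg tp_pos.le, div_le_iff₀ tp_pos]; exact hK
  set r : ℂ → ℂ := fun w => p w - K / tp * w + (γ 0 - p 0) with hr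
  have hrd : ∀ w, HasDerivAt r (p' w - K / tp) w := by
    intro w
    have := ((h1 w).sub ((hasDerivAt_id w).const_mul (K / tp))).add_const (γ 0 - p 0)
    refine this.congr_deriv (by simp)
  have hrper : ∀ w, r (w + tp) = r w := by
    intro w; simp only [hr, h2]; field_simp; ring
  have hcl : ∀ x : ℝ, ‖(p' x - K / tp) - deriv γ x‖ ≤ 2 * η := by
    intro x
    have : (p' x - K / tp) - deriv γ x = (p' x - deriv γ x) - K / tp := by ring
    rw [this]
    refine (norm_sub_le _ _).trans ?_
    have := hclose x; linarith
  have hηε : 2 * η * (1 + tp) = ε := by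
    rw [hη]; have := tp_pos; field_simp;
  refine ⟨r, fun w => (hrd w).differentiableAt, hrper, fun x => ⟨?_, ?_⟩⟩
  · have hrd' : ∀ x : ℝ, HasDerivAt (fun x : ℝ => r x - γ x) ((p' x - K / tp) - deriv γ x) x := fun x =>
      ((hrd x).comp_ofReal).sub ((hγ.differentiable (by simp)) x).hasDerivAt
    obtain ⟨n, hn0, hn1⟩ := exists_Ico x
    have e : (r x - γ x) = r ((x + n * tp : ℝ)) - γ (x + n * tp) :=
      (per_int (R := fun x : ℝ => r x - γ x) (fun x => by simp only [per, Complex.ofReal_add, hrper]) x n).symm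
    rw [e]
    have := mv _ _ _ hrd' hcl 0 (x + n * tp)
    have h0 : r (0:ℝ) - γ 0 = 0 := by simp [hr]
    rw [h0, sub_zero, sub_zero, abs_of_nonneg hn0] at this
    refine this.trans ?_
    nlinarith
  · rw [(hrd _).deriv]
    refine (hcl x).trans ?_
    nlinarith [tp_pos]

structure Diffeo (Q : ℂ → ℂ) : Prop where
  sm : ContDiff ℝ ∞ Q
  bij : Function.Bijective Q
  imm : ∀ z u, fderiv ℝ Q z u = 0 → u = 0

lemma Diffeo.homeo {Q : ℂ → ℂ} (h : Diffeo Q) : ∃ e : ℂ ≃ₜ ℂ, ⇑e = Q :=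
  ⟨(Equiv.ofBijective Q h.bij).toHomeomorphOfContinuousOpen h.sm.continuous (by
    refine isOpenMap_iff_nhds_le.2 fun z => ?_
    have := (exists_localInv rfl h.sm.contDiffAt (h.imm z)).1
    exact this.ge), rfl⟩

namespace Collar
variable {D : Set ℂ} {c : ℝ × ℝ → ℂ} {δ : ℝ}

lemma transport (C : Collar D c δ) {Q : ℂ → ℂ} (hQ : Diffeo Q) : Collar (Q '' D) (Q ∘ c) δ := by
  obtain ⟨e, he⟩ := hQ.homeo
  refine ⟨C.pos, ?_, fun q hq => hQ.sm.contDiffAt.comp q (C.sm q hq), fun x t => congrArg Q (C.per x t),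
    fun q q' hq hq' h => C.inj q q' hq hq' (hQ.bij.1 h), fun q u hq h => ?_, fun q hq => ?_, fun δ' h0 h1 => ?_⟩
  · rw [← he]; exact e.isOpenMap _ C.opn
  · rw [fderiv_comp _ (hQ.sm.contDiffAt.differentiableAt (by simp)) ((C.sm q hq).differentiableAt (by simp))] at h
    exact C.imm q u hq (hQ.imm _ _ h)
  · rw [← C.side q hq]; exact hQ.bij.1.mem_set_image
  · rw [image_comp, ← image_sdiff hQ.bij.1]
    exact (C.cpt δ' h0 h1).image hQ.sm.continuous

lemma fderiv_per (C : Collar D c δ) (x t : ℝ) (n : ℤ) : fderiv ℝ c (x + n * tp, t) = fderiv ℝ c (x, t) := by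
  have h := fderiv_comp_add_right (𝕜 := ℝ) (f := c) (x := (x, t)) ((n * tp, 0) : ℝ × ℝ)
  have h2 : (fun q : ℝ × ℝ => c (q + (n * tp, 0))) = c := by
    funext q
    have := C.per' q.1 q.2 n
    rw [show q + ((n * tp, 0) : ℝ × ℝ) = (q.1 + n * tp, q.2) from by ext <;> simp]
    exact this
  rw [h2] at h
  rw [h]; simp

lemma lower (C : Collar D c δ) : ∃ m > 0, ∀ q u, |q.2| ≤ δ/2 → m * ‖u‖ ≤ ‖fderiv ℝ c q u‖ := by
  have hδ := C.pos
  have hK : IsCompact ((Icc 0 tp ×ˢ Icc (-(δ/2)) (δ/2)) ×ˢ sphere (0 : ℝ × ℝ) 1) :=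
    (isCompact_Icc.prod isCompact_Icc).prod (isCompact_sphere _ _)
  have hne : ((Icc 0 tp ×ˢ Icc (-(δ/2)) (δ/2)) ×ˢ sphere (0 : ℝ × ℝ) 1).Nonempty := by
    refine Set.Nonempty.prod ⟨(0,0), ⟨⟨le_rfl, tp_pos.le⟩, ?_⟩⟩ (NormedSpace.sphere_nonempty.2 zero_le_one)
    constructor <;> simp <;> linarith
  have hcont : ContinuousOn (fun y : (ℝ × ℝ) × (ℝ × ℝ) => ‖fderiv ℝ c y.1 y.2‖)
      ((Icc 0 tp ×ˢ Icc (-(δ/2)) (δ/2)) ×ˢ sphere (0 : ℝ × ℝ) 1) := by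
    rintro ⟨q, u⟩ ⟨⟨-, h⟩, -⟩
    refine ContinuousAt.continuousWithinAt ?_
    have h2 : ContinuousAt (fderiv ℝ c) q := ((C.sm q (by
      rw [abs_lt]; constructor <;> linarith [h.1, h.2])).fderiv_right (m := 0) (by simp)).continuousAt
    have h3 : ContinuousAt (fun y : (ℝ × ℝ) × (ℝ × ℝ) => fderiv ℝ c y.1) (q, u) := h2.comp continuousAt_fst
    exact (h3.clm_apply continuousAt_snd).norm
  obtain ⟨⟨q0, u0⟩, hq0, hmin⟩ := hK.exists_isMinOn hne hcont
  refine ⟨‖fderiv ℝ c q0 u0‖, ?_, ?_⟩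
  · refine norm_pos_iff.2 fun h => ?_
    have := C.imm q0 u0 (by rw [abs_lt]; constructor <;> linarith [hq0.1.2.1, hq0.1.2.2]) h
    have h1 : u0 ∈ sphere (0 : ℝ × ℝ) 1 := hq0.2
    rw [this] at h1; simp at h1
  · rintro ⟨x, t⟩ u hq
    by_cases hu : u = 0
    · simp [hu]
    have hu' : 0 < ‖u‖ := norm_pos_iff.2 hu
    obtain ⟨n, h0, h1⟩ := exists_Ico x
    have := hmin (show ((x + n * tp, t), ‖u‖⁻¹ • u) ∈ _ from ⟨⟨⟨h0, h1.le⟩, abs_le.1 hq⟩, by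
      simp [norm_smul, inv_mul_cancel₀ hu'.ne']⟩)
    simp only [mem_setOf_eq] at this
    rw [C.fderiv_per, map_smul, norm_smul, norm_inv, norm_norm, ← div_eq_inv_mul, le_div_iff₀ hu'] at this
    exact this

lemma toAnalytic (C : Collar D c δ) : ∃ Q p : ℂ → ℂ, Diffeo Q ∧ Differentiable ℂ p ∧ (∀ w, p (w + tp) = p w) ∧
    ∀ x : ℝ, Q (c (x, 0)) = p x := by
  have hδ := C.pos
  obtain ⟨m, hm, hlow⟩ := C.lower
  let χ : ContDiffBump (0 : ℝ) := ⟨δ/4, δ/2, by positivity, by linarith⟩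
  have hχs : ContDiff ℝ ∞ χ := χ.contDiff
  obtain ⟨M, hM⟩ : ∃ M, ∀ t, ‖deriv χ t‖ ≤ M :=
    (χ.hasCompactSupport.deriv).exists_bound_of_continuous (hχs.continuous_deriv (by simp))
  have hM0 : 0 ≤ M := (norm_nonneg _).trans (hM 0)
  have hγ : ContDiff ℝ ∞ (fun x => c (x, 0)) := contDiff_iff_contDiffAt.2 fun x =>
    ContDiffAt.comp x (C.sm (x,0) (by simpa using hδ)) (contDiffAt_id.prodMk contDiffAt_const)
  obtain ⟨p, hp, hper, happ⟩ := trig_approx hγ (fun x => C.per x 0) (show 0 < m / (2 * (M + 1)) by positivity)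
  set ε := m / (2 * (M + 1)) with hε
  set v : ℝ → ℂ := fun x => p x - c (x, 0) with hv
  have hps : ContDiff ℝ ∞ (fun x : ℝ => p x) := by
    have : ContDiff ℝ ∞ p := (hp.contDiff (n := ∞)).restrict_scalars ℝ
    exact this.comp Complex.ofRealCLM.contDiff
  have hvs : ContDiff ℝ ∞ v := hps.sub hγ
  have hvd : ∀ x, ‖deriv v x‖ ≤ ε := by
    intro x
    have : deriv v x = deriv p x - deriv (fun x => c (x, 0)) x :=
      ((hp x).hasDerivAt.comp_ofReal.sub ((hγ.differentiable (by simp)) x).hasDerivAt).deriv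
    rw [this]; exact (happ x).2
  have hvper : ∀ x, v (x + tp) = v x := by
    intro x; simp only [hv, C.per, Complex.ofReal_add, hper]
  set H : ℝ × ℝ → ℂ := fun q => χ q.2 • v q.1 with hH
  have hHper : ∀ x t, H (x + tp, t) = H (x, t) := by intro x t; simp only [hH, hvper]
  have hHs : ContDiff ℝ ∞ H := (hχs.comp contDiff_snd).smul (hvs.comp contDiff_fst)
  have hHd : ∀ q u, ‖fderiv ℝ H q u‖ ≤ (M + 1) * ε * ‖u‖ := by
    intro q u
    have h1 : HasFDerivAt (fun q : ℝ × ℝ => χ q.2) _ q :=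
      (((hχs.differentiable (by simp)) q.2).hasDerivAt.hasFDerivAt).comp q hasFDerivAt_snd
    have h2 : HasFDerivAt (fun q : ℝ × ℝ => v q.1) _ q :=
      (((hvs.differentiable (by simp)) q.1).hasDerivAt.hasFDerivAt).comp q hasFDerivAt_fst
    have h3 : HasFDerivAt H _ q := h1.smul h2
    rw [h3.fderiv]
    simp only [ContinuousLinearMap.add_apply, ContinuousLinearMap.smul_apply, ContinuousLinearMap.smulRight_apply,
      ContinuousLinearMap.comp_apply, ContinuousLinearMap.coe_fst', ContinuousLinearMap.coe_snd', ContinuousLinearMap.toSpanSingleton_apply]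
    refine (norm_add_le _ _).trans ?_
    rw [norm_smul, norm_smul, norm_smul, norm_smul]
    have a1 := hM q.2
    have a2 : ‖χ q.2‖ ≤ 1 := by rw [Real.norm_of_nonneg χ.nonneg]; exact χ.le_one
    have a3 := hvd q.1
    have a4 : ‖v q.1‖ ≤ ε := (happ q.1).1
    have a5 : ‖u.1‖ ≤ ‖u‖ := norm_fst_le u
    have a6 : ‖u.2‖ ≤ ‖u‖ := norm_snd_le u
    calc _ ≤ 1 * (‖u‖ * ε) + (‖u‖ * M) * ε := by gcongr
      _ = _ := by ring
  classical
  set e : ℂ → ℂ := fun z => if z ∈ c '' {q | |q.2| < δ} then H (inv c δ z) else 0 with he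
  have hec : ∀ q : ℝ × ℝ, |q.2| < δ → e (c q) = H q := by
    intro q hq
    simp only [he]
    rw [if_pos ⟨q, hq, rfl⟩, C.push_eq hHper hq]
  have hev : ∀ q : ℝ × ℝ, |q.2| < δ → ContDiffAt ℝ ∞ e (c q) := by
    intro q hq
    refine (C.push_smooth hHper hq hHs.contDiffAt).congr_of_eventuallyEq ?_
    have : ∀ᶠ z in 𝓝 (c q), e z = H (inv c δ z) := by
      rw [C.ev_iff hq]
      filter_upwards [abs_lt_nhds hq] with q' hq'
      rw [hec q' hq', C.push_eq hHper hq']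
    exact this
  have hband : IsCompact (c '' {q | -(δ/2) ≤ q.2 ∧ q.2 ≤ δ/2}) := C.isCompact_band (by linarith) (by linarith)
  have heout : ∀ z, z ∉ c '' {q | -(δ/2) ≤ q.2 ∧ q.2 ≤ δ/2} → e =ᶠ[𝓝 z] fun _ => 0 := by
    intro z hz
    filter_upwards [hband.isClosed.isOpen_compl.mem_nhds hz] with y hy
    simp only [he]
    split_ifs with h
    · obtain ⟨q, hq, rfl⟩ := h
      rw [C.push_eq hHper hq]
      have : χ q.2 = 0 := χ.zero_of_le_dist (by
        rw [dist_zero_right, Real.norm_eq_abs]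
        by_contra hcon
        refine hy ⟨q, abs_le.1 (le_of_lt (not_le.1 hcon)), rfl⟩)
      simp [hH, this]
    · rfl
  have hes : ContDiff ℝ ∞ e := by
    rw [contDiff_iff_contDiffAt]
    intro z
    by_cases hz : z ∈ c '' {q | -(δ/2) ≤ q.2 ∧ q.2 ≤ δ/2}
    · obtain ⟨q, hq, rfl⟩ := hz
      exact hev q (by rw [abs_lt]; constructor <;> linarith [hq.1, hq.2])
    · exact contDiffAt_const.congr_of_eventuallyEq (heout z hz)
  have hed : ∀ z, ‖fderiv ℝ e z‖ ≤ 1/2 := by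
    intro z
    by_cases hz : z ∈ c '' {q | -(δ/2) ≤ q.2 ∧ q.2 ≤ δ/2}
    · obtain ⟨q, hq, rfl⟩ := hz
      have hq' : |q.2| < δ := by rw [abs_lt]; constructor <;> linarith [hq.1, hq.2]
      refine ContinuousLinearMap.opNorm_le_bound _ (by norm_num) fun y => ?_
      obtain ⟨E, hE⟩ := isInvertible_of_inj (fderiv ℝ c q) (by
        rw [injective_iff_map_eq_zero]; exact fun u => C.imm q u hq') fd
      obtain ⟨u, rfl⟩ : ∃ u, fderiv ℝ c q u = y := ⟨E.symm y, by rw [← hE]; simp⟩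
      have h1 : fderiv ℝ (e ∘ c) q = fderiv ℝ H q := by
        refine Filter.EventuallyEq.fderiv_eq ?_
        filter_upwards [abs_lt_nhds hq'] with q' hq' using hec q' hq'
      rw [fderiv_comp _ ((hes.differentiable (by simp)) _) ((C.sm q hq').differentiableAt (by simp))] at h1
      have h2 : fderiv ℝ e (c q) (fderiv ℝ c q u) = fderiv ℝ H q u := by rw [← h1]; rfl
      rw [h2]
      refine (hHd q u).trans ?_
      have h3 := hlow q u (abs_le.2 hq)
      have h4 : (M + 1) * ε = m / 2 := by rw [hε]; field_simp
      rw [h4]; linarith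
    · rw [(heout z hz).fderiv_eq]; simp
  have hlip : ∀ z z', ‖e z - e z'‖ ≤ 1/2 * ‖z - z'‖ := fun z z' =>
    Convex.norm_image_sub_le_of_norm_fderiv_le (fun x _ => (hes.differentiable (by simp)) x) (fun x _ => hed x)
      convex_univ (mem_univ z') (mem_univ z)
  refine ⟨fun z => z + e z, p, ⟨contDiff_id.add hes, ⟨?_, ?_⟩, ?_⟩, hp, hper, ?_⟩
  · intro z z' h
    have h1 : z - z' = -(e z - e z') := by
      have : z + e z = z' + e z' := h
      linear_combination this
    have h2 := hlip z z'
    have h3 : ‖z - z'‖ = ‖e z - e z'‖ := by rw [h1, norm_neg]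
    rw [← sub_eq_zero, ← norm_le_zero_iff]; linarith
  · intro y
    have hcw : ContractingWith (1/2) (fun z => y - e z) := by
      refine ⟨by rw [← NNReal.coe_lt_coe]; norm_num, LipschitzWith.of_dist_le_mul fun z z' => ?_⟩
      rw [dist_eq_norm, dist_eq_norm]
      have : y - e z - (y - e z') = -(e z - e z') := by ring
      rw [this, norm_neg]
      simpa using hlip z z'
    refine ⟨hcw.fixedPoint, ?_⟩
    have := hcw.fixedPoint_isFixedPt
    have h2 : y - e hcw.fixedPoint = hcw.fixedPoint := this
    simp only; linear_combination -h2
  · intro z u h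
    have h1 : fderiv ℝ (fun z => z + e z) z = ContinuousLinearMap.id ℝ ℂ + fderiv ℝ e z :=
      ((hasFDerivAt_id z).add ((hes.differentiable (by simp)) z).hasFDerivAt).fderiv
    rw [h1] at h
    have h2 : u = - fderiv ℝ e z u := by
      have : u + fderiv ℝ e z u = 0 := h
      linear_combination this
    have h3 : ‖u‖ ≤ 1/2 * ‖u‖ := by
      calc ‖u‖ = ‖fderiv ℝ e z u‖ := by conv_lhs => rw [h2, norm_neg]
        _ ≤ _ := (fderiv ℝ e z).le_of_opNorm_le (hed z) u
    rw [← norm_le_zero_iff]; linarith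
  · intro x
    simp only
    rw [hec (x, 0) (by simpa using hδ)]
    have : χ 0 = 1 := χ.one_of_mem_closedBall (mem_closedBall_self (by positivity))
    simp [hH, this, hv]

end Collar
end Glu

namespace Glu
open Set Filter Topology Metric MeasureTheory
open scoped ContDiff

abbrev ust (a b : ℝ) : Set ℂ := {w : ℂ | a < w.im ∧ w.im < b}

lemma ust_open (a b : ℝ) : IsOpen (ust a b) :=
  (isOpen_lt continuous_const Complex.continuous_im).inter (isOpen_lt Complex.continuous_im continuous_const)

lemma ust_convex (a b : ℝ) : Convex ℝ (ust a b) := by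
  have : ust a b = Complex.imLm ⁻¹' (Ioo a b) := by ext; simp [ust]
  rw [this]; exact (convex_Ioo _ _).linear_preimage _

lemma conj_cexp_int (n : ℤ) (w : ℂ) : (starRingEnd ℂ) (Complex.exp (Complex.I * n * w)) =
    Complex.exp (-(Complex.I * n * (starRingEnd ℂ) w)) := by
  rw [← Complex.exp_conj]; simp

lemma reflect {A : ℂ → ℂ} {η : ℝ} (hη : 0 < η) (hA : DifferentiableOn ℂ A (ust 0 η))
    (per : ∀ w ∈ ust 0 η, A (w + tp) = A w)
    (hlim : ∀ ε > 0, ∃ s > 0, ∀ w : ℂ, 0 < w.im → w.im < s → |(A w).im| ≤ ε) :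
    ∃ s1 > 0, s1 ≤ η ∧ ∃ G : ℂ → ℂ, DifferentiableOn ℂ G (ust (-s1) s1) ∧ (∀ w, G (w + tp) = G w) ∧
      (∀ w ∈ ust 0 s1, G w = A w) ∧ ∀ x : ℝ, (G x).im = 0 := by
  haveI : Fact (0 < tp) := ⟨tp_pos⟩
  have hcA : ∀ s, 0 < s → s < η → Continuous (fun x : ℝ => A (x + s * Complex.I)) := by
    intro s h0 h1
    refine continuous_iff_continuousAt.2 fun x => ?_
    have h2 : ContinuousAt A (x + s * Complex.I) :=
      (hA.differentiableAt ((ust_open 0 η).mem_nhds (by simp [ust, h0, h1]))).continuousAt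
    exact ContinuousAt.comp (f := fun x : ℝ => (x + s * Complex.I : ℂ)) h2 (by fun_prop)
  set al : ℤ → ℝ → ℂ := fun n s => ∫ x in (0:ℝ)..tp, A (x + s * Complex.I) * Complex.exp (-(Complex.I * n * (x + s * Complex.I)))
    with hal
  have hconst : ∀ n s s', 0 < s → s < η → 0 < s' → s' < η → al n s = al n s' := by
    intro n s s' h1 h2 h3 h4
    set g : ℂ → ℂ := fun w => A w * Complex.exp (-(Complex.I * n * w)) with hg
    have hgper : ∀ w ∈ ust 0 η, g (w + tp) = g w := by
      intro w hw
      simp only [hg, per w hw]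
      congr 1
      rw [mul_add, neg_add, Complex.exp_add]
      have : -(Complex.I * n * (tp : ℝ)) = ((-n : ℤ) : ℂ) * (2 * Real.pi * Complex.I) := by simp only [tp]; push_cast; ring
      rw [this, Complex.exp_int_mul_two_pi_mul_I, mul_one]
    have hsub : (uIcc ((s * Complex.I : ℂ)).re ((tp + s' * Complex.I : ℂ)).re ×ℂ uIcc ((s * Complex.I : ℂ)).im ((tp + s' * Complex.I : ℂ)).im) ⊆ ust 0 η := by
      intro w hw
      rw [Complex.mem_reProdIm] at hw
      have := hw.2
      simp at this
      rw [Set.mem_uIcc] at this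
      rcases this with h | h
      · exact ⟨by linarith [h.1], by linarith [h.2]⟩
      · exact ⟨by linarith [h.1], by linarith [h.2]⟩
    have := Complex.integral_boundary_rect_eq_zero_of_differentiableOn g (s * Complex.I) (tp + s' * Complex.I)
      (((hA.mul (by fun_prop : DifferentiableOn ℂ (fun w : ℂ => Complex.exp (-(Complex.I * n * w))) (ust 0 η)))).mono hsub)
    simp only [Complex.add_re, Complex.add_im, Complex.mul_re, Complex.mul_im, Complex.ofReal_re, Complex.ofReal_im,
      Complex.I_re, Complex.I_im, mul_zero, mul_one, sub_zero, zero_sub, zero_add, add_zero, zero_mul, neg_zero, sub_self] at this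
    have hv : (∫ y in s..s', g ((tp : ℝ) + y * Complex.I)) = ∫ y in s..s', g ((0 : ℝ) + y * Complex.I) := by
      refine intervalIntegral.integral_congr fun y hy => ?_
      have hy' : ((0:ℝ) + y * Complex.I : ℂ) ∈ ust 0 η := by
        rw [Set.mem_uIcc] at hy
        simp [ust]
        rcases hy with h | h
        · exact ⟨by linarith [h.1], by linarith [h.2]⟩
        · exact ⟨by linarith [h.1], by linarith [h.2]⟩
      rw [← hgper _ hy']; congr 1; simp; ring
    rw [hv] at this
    simp only [hal]
    have h5 : (∫ x in (0:ℝ)..tp, g (x + s * Complex.I)) - ∫ x in (0:ℝ)..tp, g (x + s' * Complex.I) = 0 := by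
      linear_combination this
    exact sub_eq_zero.1 h5
  set s0 := η / 2 with hs0
  have hs00 : 0 < s0 := by positivity
  have hs01 : s0 < η := by rw [hs0]; linarith
  set a : ℤ → ℂ := fun n => al n s0 with ha
  have hexp : ∀ (n : ℤ) (x s : ℝ), Complex.exp (-(Complex.I * n * (x + s * Complex.I))) =
      Complex.exp (-(Complex.I * n * x)) * Real.exp (n * s) := by
    intro n x s
    rw [Complex.ofReal_exp, ← Complex.exp_add]; congr 1; push_cast
    ring_nf; rw [Complex.I_sq]; ring

  have hcoef : ∀ (n : ℤ) (s : ℝ), 0 < s → s < η → ∫ x in (0:ℝ)..tp, A (x + s * Complex.I) * Complex.exp (-(Complex.I * n * x)) =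
      a n * Real.exp (-(n * s)) := by
    intro n s h0 h1
    have : a n = (∫ x in (0:ℝ)..tp, A (x + s * Complex.I) * Complex.exp (-(Complex.I * n * x))) * Real.exp (n * s) := by
      rw [ha]; simp only
      rw [hconst n s0 s hs00 hs01 h0 h1, hal, ← intervalIntegral.integral_mul_const]
      refine intervalIntegral.integral_congr fun x _ => ?_
      simp only [hexp]; ring
    rw [this, mul_assoc, ← Complex.ofReal_mul, ← Real.exp_add]; simp
  have hsym : ∀ n : ℤ, a n = (starRingEnd ℂ) (a (-n)) := by
    intro n
    set L : ℝ → ℂ := fun s => a n * Real.exp (-(n * s)) - (starRingEnd ℂ) (a (-n)) * Real.exp (n * s) with hL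
    have hLb : ∀ ε > 0, ∃ s1 > 0, ∀ s, 0 < s → s < s1 → ‖L s‖ ≤ 2 * ε * tp := by
      intro ε hε
      obtain ⟨s1, hs1, hb⟩ := hlim ε hε
      refine ⟨min s1 η, by positivity, fun s h0 h1 => ?_⟩
      have h2 := h1.trans_le (min_le_right _ _)
      have e1 := hcoef n s h0 h2
      have e2 := congrArg (starRingEnd ℂ) (hcoef (-n) s h0 h2)
      have e3 : (starRingEnd ℂ) (∫ x in (0:ℝ)..tp, A (x + s * Complex.I) * Complex.exp (-(Complex.I * ((-n : ℤ) : ℂ) * x))) =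
          ∫ x in (0:ℝ)..tp, (starRingEnd ℂ) (A (x + s * Complex.I)) * Complex.exp (-(Complex.I * n * x)) := by
        rw [intervalIntegral.integral_of_le tp_pos.le, intervalIntegral.integral_of_le tp_pos.le, ← integral_conj]
        refine integral_congr_ae (Eventually.of_forall fun x => ?_)
        simp only [map_mul]
        congr 1
        rw [← Complex.exp_conj]; simp
      rw [e3, map_mul, Complex.conj_ofReal] at e2
      have hL1 : L s = ∫ x in (0:ℝ)..tp, (A (x + s * Complex.I) - (starRingEnd ℂ) (A (x + s * Complex.I))) * Complex.exp (-(Complex.I * n * x)) := by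
        simp only [hL]
        have e4 : ((-n : ℤ) : ℝ) = -(n : ℝ) := by push_cast; rfl
        rw [e4, neg_mul, neg_neg] at e2
        rw [← e1, ← e2, ← intervalIntegral.integral_sub]
        · simp only [sub_mul]
        · exact ((hcA s h0 h2).mul (by fun_prop)).intervalIntegrable _ _
        · exact ((Complex.continuous_conj.comp (hcA s h0 h2)).mul (by fun_prop)).intervalIntegrable _ _
      rw [hL1]
      have := intervalIntegral.norm_integral_le_of_norm_le_const (a := 0) (b := tp) (C := 2 * ε)
        (f := fun x : ℝ => (A (x + s * Complex.I) - (starRingEnd ℂ) (A (x + s * Complex.I))) * Complex.exp (-(Complex.I * n * x))) (by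
          intro x _
          rw [norm_mul, Complex.sub_conj]
          have h3 : ‖Complex.exp (-(Complex.I * n * x))‖ = 1 := by
            rw [Complex.norm_exp]; simp
          rw [h3, mul_one]
          have h4 := hb (x + s * Complex.I) (by simpa using h0) (by simpa using h1.trans_le (min_le_left _ _))
          rw [norm_mul, Complex.norm_I, mul_one, Complex.norm_real, Real.norm_eq_abs, abs_mul, abs_two]
          linarith)
      rwa [sub_zero, abs_of_pos tp_pos] at this
    have hLc : Continuous L := by simp only [hL]; fun_prop
    have hz : ‖L 0‖ ≤ 0 := by
      refine le_of_forall_pos_le_add fun ε hε => ?_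
      rw [zero_add]
      obtain ⟨s1, hs1, hb⟩ := hLb (ε / (2 * tp)) (by have := tp_pos; positivity)
      have ht : Tendsto (fun s => ‖L s‖) (𝓝[>] 0) (𝓝 ‖L 0‖) := (hLc.norm.tendsto 0).mono_left nhdsWithin_le_nhds
      refine le_of_tendsto ht ?_
      filter_upwards [Ioo_mem_nhdsGT hs1] with s hs
      refine (hb s hs.1 hs.2).trans (le_of_eq ?_)
      have := tp_pos; field_simp
    have := norm_le_zero_iff.1 hz
    simp only [hL] at this
    simp at this
    exact sub_eq_zero.1 this
  obtain ⟨M, hM⟩ : ∃ M, ∀ n : ℤ, ‖a n‖ ≤ M * Real.exp (n * s0) := by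
    obtain ⟨B, hB⟩ := (isCompact_Icc (a := (0:ℝ)) (b := tp)).exists_bound_of_continuousOn (hcA s0 hs00 hs01).continuousOn
    refine ⟨B * tp, fun n => ?_⟩
    have e := hcoef n s0 hs00 hs01
    have h1 : a n = (∫ x in (0:ℝ)..tp, A (x + s0 * Complex.I) * Complex.exp (-(Complex.I * n * x))) * Real.exp (n * s0) := by
      rw [e, mul_assoc, ← Complex.ofReal_mul, ← Real.exp_add]; simp
    rw [h1, norm_mul, Complex.norm_real, Real.norm_of_nonneg (Real.exp_pos _).le]
    gcongr
    have := intervalIntegral.norm_integral_le_of_norm_le_const (a := 0) (b := tp) (C := B)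
        (f := fun x : ℝ => A (x + s0 * Complex.I) * Complex.exp (-(Complex.I * n * x))) (by
          intro x hx
          rw [uIoc_of_le tp_pos.le] at hx
          have h3 : ‖Complex.exp (-(Complex.I * n * x))‖ = 1 := by
            rw [Complex.norm_exp]; simp
          rw [norm_mul, h3, mul_one]
          exact hB x ⟨hx.1.le, hx.2⟩)
    rwa [sub_zero, abs_of_pos tp_pos] at this
  have hM0 : 0 ≤ M := by have := (norm_nonneg _).trans (hM 0); simpa using this
  have hMabs : ∀ n : ℤ, ‖a n‖ ≤ M * Real.exp (-(|(n:ℝ)| * s0)) := by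
    intro n
    rcases le_total (0:ℝ) n with h | h
    · rw [hsym n, RCLike.norm_conj, abs_of_nonneg h]
      have := hM (-n); push_cast at this; rwa [neg_mul] at this
    · rw [abs_of_nonpos h, neg_mul, neg_neg]; exact hM n
  set s1 := s0 / 2 with hs1
  have hs10 : 0 < s1 := by positivity
  set F : ℤ → ℂ → ℂ := fun n w => a n * Complex.exp (Complex.I * n * w) with hF
  have hFb : ∀ n w, w ∈ ust (-s1) s1 → ‖F n w‖ ≤ M * Real.exp (-(|(n:ℝ)| * s1)) := by
    intro n w hw
    simp only [hF]
    rw [norm_mul, Complex.norm_exp]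
    have h1 : (Complex.I * n * w).re ≤ |(n:ℝ)| * s1 := by
      have : (Complex.I * n * w).re = -(n * w.im) := by simp
      rw [this]
      calc -(n * w.im) ≤ |(n:ℝ) * w.im| := neg_le_abs _
        _ = |(n:ℝ)| * |w.im| := abs_mul _ _
        _ ≤ _ := by
          gcongr; exact (abs_lt.2 hw).le
    calc _ ≤ M * Real.exp (-(|(n:ℝ)| * s0)) * Real.exp (|(n:ℝ)| * s1) := by
          gcongr; exact hMabs n
      _ = _ := by rw [mul_assoc, ← Real.exp_add]; congr 2; rw [hs1]; ring
  have hsum : Summable (fun n : ℤ => M * Real.exp (-(|(n:ℝ)| * s1))) := by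
    refine Summable.mul_left M ?_
    have hn : Summable (fun n : ℕ => Real.exp (-((n:ℝ) * s1))) := by
      have := Real.summable_exp_nat_mul_iff.2 (show -s1 < 0 by linarith)
      refine this.congr fun n => ?_
      congr 1; ring
    refine Summable.of_nat_of_neg ?_ ?_
    · simpa using hn
    · simpa using hn
  refine ⟨s1, hs10, by rw [hs1, hs0]; linarith, fun w => ((1 / tp : ℝ) : ℂ) * ∑' n, F n w, ?_, ?_, ?_, ?_⟩
  · exact (Complex.differentiableOn_tsum_of_summable_norm hsum (fun n => by simp only [hF]; fun_prop) (ust_open _ _) hFb).const_mul _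
  · intro w
    refine congrArg (fun z => ((1 / tp : ℝ) : ℂ) * z) (tsum_congr fun n => ?_)
    simp only [hF]
    congr 1
    rw [mul_add, Complex.exp_add]
    have : Complex.I * n * (tp : ℝ) = n * (2 * Real.pi * Complex.I) := by simp only [tp]; push_cast; ring
    rw [this, Complex.exp_int_mul_two_pi_mul_I, mul_one]
  · intro w hw
    have hwη : w.im < η := by have := hw.2; rw [hs1, hs0] at this; linarith
    have hcw := hcA w.im hw.1 hwη
    have hpw : Function.Periodic (fun x : ℝ => A (x + w.im * Complex.I)) tp := by
      intro x
      simp only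
      rw [← per (x + w.im * Complex.I) (by simp [ust, hw.1, hwη])]; congr 1; push_cast; ring
    let Γ : C(AddCircle tp, ℂ) := ⟨hpw.lift, continuous_coinduced_dom.mpr hcw⟩
    have hΓ : ∀ x : ℝ, Γ (x : AddCircle tp) = A (x + w.im * Complex.I) := fun x => hpw.lift_coe x
    have hfour : ∀ (n : ℤ) (x : ℝ), @fourier tp n (x : AddCircle tp) = Complex.exp (Complex.I * n * x) := by
      intro n x
      rw [fourier_coe_apply]
      congr 1
      have : (Real.pi : ℂ) ≠ 0 := by exact_mod_cast Real.pi_ne_zero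
      simp only [tp]; push_cast; field_simp
    have hco : ∀ n, fourierCoeff Γ n = (1 / tp : ℝ) * (a n * Real.exp (-(n * w.im))) := by
      intro n
      rw [fourierCoeff_eq_intervalIntegral _ _ 0, ← hcoef n w.im hw.1 hwη, zero_add, Complex.real_smul]
      congr 1
      refine intervalIntegral.integral_congr fun x _ => ?_
      simp only [hΓ, hfour, smul_eq_mul]
      rw [mul_comm]; congr 2; push_cast; ring
    have hterm : ∀ n : ℤ, fourierCoeff Γ n * Complex.exp (Complex.I * n * w.re) = ((1 / tp : ℝ) : ℂ) * F n w := by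
      intro n
      rw [hco, hF]
      simp only
      rw [mul_assoc, mul_assoc, Complex.ofReal_exp, ← Complex.exp_add]
      congr 3
      conv_rhs => rw [← Complex.re_add_im w]
      push_cast
      ring_nf; rw [Complex.I_sq]; ring
    have hnorm : ∀ n : ℤ, ‖fourierCoeff Γ n‖ = ‖((1 / tp : ℝ) : ℂ) * F n w‖ := by
      intro n
      rw [← hterm, norm_mul]
      have : ‖Complex.exp (Complex.I * n * w.re)‖ = 1 := by rw [Complex.norm_exp]; simp
      rw [this, mul_one]
    have hw' : w ∈ ust (-s1) s1 := ⟨by linarith [hw.1], hw.2⟩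
    have hS : Summable (fun n => ((1 / tp : ℝ) : ℂ) * F n w) :=
      (Summable.of_norm_bounded hsum fun n => hFb n w hw').mul_left _
    have hS2 : Summable (fourierCoeff Γ) := by
      refine Summable.of_norm ?_
      simp only [hnorm]; exact hS.norm
    have := has_pointwise_sum_fourier_series_of_summable hS2 ((w.re : ℝ) : AddCircle tp)
    simp only [hfour, hΓ, smul_eq_mul, hterm, Complex.re_add_im] at this
    rw [← this.tsum_eq, tsum_mul_left]
  · intro x
    rw [← Complex.conj_eq_iff_im, map_mul, Complex.conj_ofReal, Complex.conj_tsum]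
    congr 1
    rw [← (Equiv.neg ℤ).tsum_eq]
    refine tsum_congr fun n => ?_
    simp only [hF, map_mul, Equiv.neg_apply]
    rw [← hsym, conj_cexp_int, Complex.conj_ofReal]; congr 2; push_cast; ring

end Glu

namespace Glu
open Set Filter Topology Metric
open scoped ContDiff

structure Kp (D : Set ℂ) (c : ℝ × ℝ → ℂ) (δ : ℝ) (p : ℂ → ℂ) (k : ℝ × ℝ → ℂ) (η : ℝ) : Prop where
  C : Collar D c δ
  hp : Differentiable ℂ p
  pp : ∀ w, p (w + tp) = p w
  pos : 0 < η
  le : η ≤ δ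
  ks : ∀ q : ℝ × ℝ, |q.2| < η → ContDiffAt ℝ ∞ k q
  kp : ∀ x t, k (x + tp, t) = k (x, t) + tp
  k0 : ∀ x, k (x, 0) = x
  kc : ∀ q : ℝ × ℝ, |q.2| < η → p (k q) = c q

lemma Collar.flip {D : Set ℂ} {c : ℝ × ℝ → ℂ} {δ : ℝ} (C : Collar D c δ) : Collar D (fun q => c (-q.1, q.2)) δ := by
  have hd : ∀ q : ℝ × ℝ, HasFDerivAt (fun q : ℝ × ℝ => (-q.1, q.2))
      ((-ContinuousLinearMap.fst ℝ ℝ ℝ).prod (ContinuousLinearMap.snd ℝ ℝ ℝ)) q := fun q =>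
    (hasFDerivAt_fst.neg).prodMk hasFDerivAt_snd
  refine ⟨C.pos, C.opn, fun q hq => ?_, fun x t => ?_, fun q q' hq hq' h => ?_, fun q u hq h => ?_, fun q hq => C.side (-q.1, q.2) hq, fun δ' h1 h2 => ?_⟩
  · exact ContDiffAt.comp (g := c) (f := fun q : ℝ × ℝ => (-q.1, q.2)) q (C.sm _ hq) (by fun_prop)
  · have := C.per (-(x + tp)) t
    simp only; rw [← this]; congr 2; ring
  · obtain ⟨h1, n, h2⟩ := C.inj (-q.1, q.2) (-q'.1, q'.2) hq hq' h
    refine ⟨h1, -n, ?_⟩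
    simp only at h2; push_cast; linarith
  · have h1 : HasFDerivAt (fun q : ℝ × ℝ => c (-q.1, q.2)) _ q :=
      HasFDerivAt.comp (g := c) (f := fun q : ℝ × ℝ => (-q.1, q.2)) q ((C.sm (-q.1, q.2) hq).differentiableAt (by simp)).hasFDerivAt (hd q)
    rw [h1.fderiv] at h
    have := C.imm (-q.1, q.2) _ hq h
    simp at this
    exact Prod.ext this.1 this.2
  · convert C.cpt δ' h1 h2 using 2
    ext z; constructor
    · rintro ⟨q, hq, rfl⟩; exact ⟨(-q.1, q.2), hq, rfl⟩
    · rintro ⟨q, hq, rfl⟩; exact ⟨(-q.1, q.2), hq, by simp⟩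

namespace Kp
variable {D : Set ℂ} {c : ℝ × ℝ → ℂ} {δ : ℝ} {p : ℂ → ℂ} {k : ℝ × ℝ → ℂ} {η : ℝ}

lemma psm (hp : Differentiable ℂ p) : ContDiff ℝ ∞ p := (hp.contDiff (n := ∞)).restrict_scalars ℝ

lemma exists_kp (C : Collar D c δ) (hp : Differentiable ℂ p) (pp : ∀ w, p (w + tp) = p w)
    (h0 : ∀ x : ℝ, c (x, 0) = p x) : ∃ k η, Kp D c δ p k η := by
  have hδ := C.pos
  have hd0 : ∀ x : ℝ, deriv p x ≠ 0 := by
    intro x h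
    have h1 : HasDerivAt (fun x : ℝ => p x) (deriv p x) x := (hp x).hasDerivAt.comp_ofReal
    have h2 : HasDerivAt (fun x : ℝ => c (x, 0)) (fderiv ℝ c (x, 0) (1, 0)) x := by
      have h3 : HasFDerivAt c (fderiv ℝ c (x, 0)) (x, 0) := ((C.sm (x, 0) (by simpa using hδ)).differentiableAt (by simp)).hasFDerivAt
      exact h3.comp_hasDerivAt x ((hasDerivAt_id x).prodMk (hasDerivAt_const x (0:ℝ)))
    simp only [h0] at h2
    have := h1.unique h2
    rw [h] at this
    have := C.imm (x, 0) (1, 0) (by simpa using hδ) this.symm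
    simp at this
  obtain ⟨δ', hδ', r, hr, y, ysm, yper, y0, yeq, -⟩ := pift (Y := ℂ) (Z := ℂ) rfl
    (Φ := fun v => p (v.1.1 + v.2) - c v.1)
    (by intro x t y
        simp only; rw [C.per, ← pp (x + y)]; congr 2; simp only [Complex.ofReal_add]; ring)
    (by intro x
        have : ∀ᶠ v in 𝓝 (((x, 0), 0) : (ℝ × ℝ) × ℂ), |v.1.2| < δ := by
          have : Continuous fun v : (ℝ × ℝ) × ℂ => |v.1.2| := by fun_prop
          exact this.continuousAt.eventually_lt continuousAt_const (by simpa using hδ)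
        filter_upwards [this] with v hv
        refine ContDiffAt.sub ?_ ((C.sm v.1 hv).comp v contDiffAt_fst)
        refine (psm hp).contDiffAt.comp v ?_
        exact (Complex.ofRealCLM.contDiff.contDiffAt.comp v (by fun_prop)).add (by fun_prop))
    (by intro x; simp [h0])
    (by intro x y h
        have e1 : HasFDerivAt (fun y : ℂ => ((x, (0:ℝ)), y)) (ContinuousLinearMap.inr ℝ (ℝ × ℝ) ℂ) 0 := hasFDerivAt_prodMk_right _ _
        have hdiff : DifferentiableAt ℝ (fun v : (ℝ × ℝ) × ℂ => p (v.1.1 + v.2) - c v.1) ((x, 0), 0) := by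
          refine DifferentiableAt.sub ?_ (DifferentiableAt.comp (g := c) (f := fun v : (ℝ × ℝ) × ℂ => v.1) _ ((C.sm (x, 0) (by simpa using hδ)).differentiableAt (by simp)) differentiableAt_fst)
          refine DifferentiableAt.comp (g := p) (f := fun v : (ℝ × ℝ) × ℂ => (v.1.1 + v.2 : ℂ)) _ ((psm hp).differentiable (by simp) _) ?_
          exact (Complex.ofRealCLM.differentiableAt.comp _ (by fun_prop)).add (by fun_prop)
        have e2 := hdiff.hasFDerivAt.comp (0:ℂ) e1
        have e3 : HasFDerivAt (fun y : ℂ => p (x + y) - c (x, 0)) ((ContinuousLinearMap.toSpanSingleton ℂ (deriv p x)).restrictScalars ℝ) 0 := by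
          have : HasDerivAt (fun y : ℂ => p (x + y) - c (x, 0)) (deriv p x) 0 := by
            have : HasDerivAt p (deriv p x) (x + 0) := by rw [add_zero]; exact (hp x).hasDerivAt
            exact (this.comp_const_add _ _).sub_const _
          exact this.hasFDerivAt.restrictScalars ℝ
        have e4 := congrArg (fun L => L y) (e2.unique e3)
        simp at e4
        rw [h] at e4
        rcases mul_eq_zero.1 e4.symm with h | h
        · exact h
        · exact absurd h (hd0 x))
  refine ⟨fun q => q.1 + y q, min δ δ', C, hp, pp, by positivity, min_le_left _ _, fun q hq => ?_, fun x t => ?_, fun x => ?_, fun q hq => ?_⟩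
  · exact (Complex.ofRealCLM.contDiff.contDiffAt.comp q (by fun_prop)).add (ysm q (hq.trans_le (min_le_right _ _)))
  · simp only [yper, Complex.ofReal_add]; ring
  · simp [y0]
  · exact sub_eq_zero.1 (yeq q (hq.trans_le (min_le_right _ _))).1

lemma imm (P : Kp D c δ p k η) {q u : ℝ × ℝ} (hq : |q.2| < η) (h : fderiv ℝ k q u = 0) : u = 0 := by
  have h1 : HasFDerivAt (p ∘ k) _ q := ((psm P.hp).differentiable (by simp) (k q)).hasFDerivAt.comp q ((P.ks q hq).differentiableAt (by simp)).hasFDerivAt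
  have h2 : p ∘ k =ᶠ[𝓝 q] c := by
    filter_upwards [abs_lt_nhds hq] with q' hq' using P.kc q' hq'
  have h3 := h2.fderiv_eq (𝕜 := ℝ)
  rw [h1.fderiv] at h3
  refine P.C.imm q u (hq.trans_le P.le) ?_
  rw [← h3, ContinuousLinearMap.comp_apply, h, map_zero]

lemma dx (P : Kp D c δ p k η) (x : ℝ) : fderiv ℝ k (x, 0) (1, 0) = 1 := by
  have h3 : HasFDerivAt k (fderiv ℝ k (x, 0)) (x, 0) := ((P.ks (x, 0) (by simpa using P.pos)).differentiableAt (by simp)).hasFDerivAt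
  have h4 : HasDerivAt (fun x : ℝ => k (x, 0)) _ x := h3.comp_hasDerivAt x ((hasDerivAt_id x).prodMk (hasDerivAt_const x (0:ℝ)))
  simp only [P.k0] at h4
  exact h4.unique Complex.ofRealCLM.hasDerivAt

lemma dt_ne (P : Kp D c δ p k η) (x : ℝ) : (fderiv ℝ k (x, 0) (0, 1)).im ≠ 0 := by
  intro h
  have : fderiv ℝ k (x, 0) (-(fderiv ℝ k (x, 0) (0, 1)).re, 1) = 0 := by
    have : ((-(fderiv ℝ k (x, 0) (0, 1)).re, 1) : ℝ × ℝ) = (-(fderiv ℝ k (x, 0) (0, 1)).re) • (1, 0) + (0, 1) := by simp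
    rw [this, map_add, map_smul, P.dx]
    apply Complex.ext <;> simp [h]
  have := P.imm (q := (x, 0)) (by simpa using P.pos) this
  simp at this

lemma dcont (P : Kp D c δ p k η) (u : ℝ × ℝ) {q : ℝ × ℝ} (hq : |q.2| < η) : ContinuousAt (fun q => fderiv ℝ k q u) q :=
  (((P.ks q hq).fderiv_right (m := 0) (by simp)).continuousAt).clm_apply continuousAt_const

lemma orient (P : Kp D c δ p k η) : (∀ x, (fderiv ℝ k (x, 0) (0, 1)).im < 0) ∨ ∀ x, 0 < (fderiv ℝ k (x, 0) (0, 1)).im := by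
  have hc : Continuous fun x : ℝ => (fderiv ℝ k (x, 0) (0, 1)).im := by
    refine Complex.continuous_im.comp (continuous_iff_continuousAt.2 fun x => ?_)
    exact ContinuousAt.comp (f := fun x : ℝ => (x, (0:ℝ))) (P.dcont (0, 1) (q := (x, 0)) (by simpa using P.pos)) (by fun_prop)
  rcases (P.dt_ne 0).lt_or_gt with h | h
  · left; intro x; by_contra hx
    obtain ⟨y, hy⟩ := mem_range_of_exists_le_of_exists_ge hc ⟨0, h.le⟩ ⟨x, not_lt.1 hx⟩
    exact P.dt_ne y hy
  · right; intro x; by_contra hx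
    obtain ⟨y, hy⟩ := mem_range_of_exists_le_of_exists_ge hc ⟨x, not_lt.1 hx⟩ ⟨0, h.le⟩
    exact P.dt_ne y hy

lemma flip (P : Kp D c δ p k η) : Kp D (fun q => c (-q.1, q.2)) δ (fun w => p (-w)) (fun q => - k (-q.1, q.2)) η := by
  refine ⟨P.C.flip, P.hp.comp differentiable_neg, fun w => ?_, P.pos, P.le, fun q hq => ?_, fun x t => ?_, fun x => by simp [P.k0], fun q hq => by simp [P.kc (-q.1, q.2) hq]⟩
  · rw [← P.pp]; congr 1; ring
  · exact (ContDiffAt.comp (g := k) (f := fun q : ℝ × ℝ => (-q.1, q.2)) q (P.ks (-q.1, q.2) hq) (by fun_prop)).neg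
  · have := P.kp (-(x + tp)) t
    rw [show -(x + tp) + tp = -x by ring] at this
    simp only; rw [this]; ring

lemma flip_dt (P : Kp D c δ p k η) (x : ℝ) : fderiv ℝ (fun q : ℝ × ℝ => - k (-q.1, q.2)) (x, 0) (0, 1) = - fderiv ℝ k (-x, 0) (0, 1) := by
  have hd : HasFDerivAt (fun q : ℝ × ℝ => (-q.1, q.2))
      ((-ContinuousLinearMap.fst ℝ ℝ ℝ).prod (ContinuousLinearMap.snd ℝ ℝ ℝ)) ((x, 0) : ℝ × ℝ) :=
    (hasFDerivAt_fst.neg).prodMk hasFDerivAt_snd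
  have h1 : HasFDerivAt (fun q : ℝ × ℝ => - k (-q.1, q.2)) _ (x, 0) :=
    (HasFDerivAt.comp (g := k) (f := fun q : ℝ × ℝ => (-q.1, q.2)) (x, 0) ((P.ks (-x, 0) (by simpa using P.pos)).differentiableAt (by simp)).hasFDerivAt hd).neg
  rw [h1.fderiv]; simp

lemma sgn (P : Kp D c δ p k η) (ho : ∀ x, (fderiv ℝ k (x, 0) (0, 1)).im < 0) :
    ∃ e > 0, e ≤ η ∧ ∀ x t, |t| < e → (0 < (k (x, t)).im ↔ t < 0) := by
  obtain ⟨e, he, h⟩ := unif' (V := ℝ) (R := fun q => |q.2| < η ∧ (fderiv ℝ k q (0, 1)).im < 0)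
    (by intro x t
        simp only
        have : fderiv ℝ k (x + tp, t) = fderiv ℝ k (x, t) := by
          have h1 : (fun q : ℝ × ℝ => k (q + (tp, 0))) = fun q => k q + tp := by
            funext q; simp only [Prod.add_def, add_zero]; exact P.kp _ _
          have h2 := fderiv_comp_add_right (𝕜 := ℝ) (f := k) (x := (x, t)) (tp, 0)
          rw [h1, fderiv_add_const] at h2
          rw [h2]; simp
        rw [this])
    (by intro x
        refine (abs_lt_nhds (by simpa using P.pos)).and ?_
        exact (Complex.continuous_im.continuousAt.comp (P.dcont (0, 1) (q := (x, 0)) (by simpa using P.pos))).eventually_lt continuousAt_const (ho x))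
  have hd : ∀ x t, |t| < e → HasDerivAt (fun t => (k (x, t)).im) (fderiv ℝ k (x, t) (0, 1)).im t := by
    intro x t ht
    have h3 : HasFDerivAt k (fderiv ℝ k (x, t)) (x, t) := ((P.ks (x, t) (h x t ht).1).differentiableAt (by simp)).hasFDerivAt
    have h4 : HasDerivAt (fun t : ℝ => k (x, t)) _ t := h3.comp_hasDerivAt t ((hasDerivAt_const t x).prodMk (hasDerivAt_id t))
    exact Complex.imCLM.hasFDerivAt.comp_hasDerivAt t h4
  have hanti : ∀ x, StrictAntiOn (fun t => (k (x, t)).im) (Ioo (-e) e) := by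
    intro x
    refine strictAntiOn_of_deriv_neg (convex_Ioo _ _) (fun t ht => (hd x t (abs_lt.2 ht)).continuousAt.continuousWithinAt) ?_
    intro t ht
    rw [interior_Ioo] at ht
    rw [(hd x t (abs_lt.2 ht)).deriv]
    exact (h x t (abs_lt.2 ht)).2
  refine ⟨min e η, by have := P.pos; positivity, min_le_right _ _, fun x t ht => ?_⟩
  have ht' := abs_lt.1 (ht.trans_le (min_le_left _ _))
  have := (hanti x).lt_iff_gt (a := 0) (b := t) ⟨by linarith, he⟩ ht'
  simpa [P.k0] using this

lemma pside (P : Kp D c δ p k η) (ho : ∀ x, (fderiv ℝ k (x, 0) (0, 1)).im < 0) :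
    ∃ e > 0, ∀ w : ℂ, |w.im| < e → (p w ∈ D ↔ 0 < w.im) := by
  obtain ⟨e, he, heη, hs⟩ := P.sgn ho
  obtain ⟨e', he', h⟩ := unif' (V := ℝ) (R := fun q => p (q.1 + q.2 * Complex.I) ∈ D ↔ 0 < q.2)
    (by intro x t
        simp only
        rw [← P.pp (x + t * Complex.I)]; simp only [Complex.ofReal_add]; rw [add_right_comm])
    (by intro x
        obtain ⟨hm, -⟩ := exists_localInv (E := ℝ × ℝ) (F := ℂ) (by simp) (P.ks (x, 0) (by simpa using P.pos)) (fun u hu => P.imm (q := (x, 0)) (by simpa using P.pos) hu)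
        have h1 : ∀ᶠ w in 𝓝 (k (x, 0)), (p w ∈ D ↔ 0 < w.im) := by
          rw [← hm, eventually_map]
          filter_upwards [abs_lt_nhds (q := (x, 0)) (by simpa using he)] with q hq
          rw [P.kc q (hq.trans_le heη), P.C.side q (hq.trans_le (heη.trans P.le)), hs q.1 q.2 hq]
        have h2 : Tendsto (fun q : ℝ × ℝ => (q.1 + q.2 * Complex.I : ℂ)) (𝓝 (x, 0)) (𝓝 (k (x, 0))) := by
          have : Continuous (fun q : ℝ × ℝ => (q.1 + q.2 * Complex.I : ℂ)) := by fun_prop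
          have := this.tendsto (x, 0)
          simpa [P.k0] using this
        filter_upwards [h2.eventually h1] with q hq
        simpa using hq)
  refine ⟨e', he', fun w hw => ?_⟩
  have := h w.re w.im hw
  simpa using this

end Kp
end Glu

namespace Glu
open Set Filter Topology Metric
open scoped ContDiff

lemma Adm.map_nhds {D : Set ℂ} (ho : IsOpen D) {f : ℂ → ℂ} (A : Adm D f) {z : ℂ} (hz : z ∈ D) : map f (𝓝 z) = 𝓝 (f z) := by
  have h1 : AnalyticAt ℂ f z := A.df.analyticAt (ho.mem_nhds hz)
  exact h1.hasStrictDerivAt.map_nhds_eq (A.dn z hz)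

lemma Adm.compact {D : Set ℂ} (ho : IsOpen D) {f : ℂ → ℂ} (A : Adm D f) (hb : BijOn f D (ball 0 1)) {r : ℝ} (hr : r < 1) :
    IsCompact {z ∈ D | ‖f z‖ ≤ r} := by
  have h1 : ContinuousOn (Function.invFunOn f D) (closedBall 0 r) := by
    intro w hw
    have hw1 : w ∈ ball (0:ℂ) 1 := closedBall_subset_ball hr hw
    obtain ⟨z, hz, rfl⟩ := hb.surjOn hw1
    refine ContinuousAt.continuousWithinAt ?_
    rw [ContinuousAt, ← A.map_nhds ho hz, hb.injOn.leftInvOn_invFunOn hz, tendsto_map'_iff]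
    refine tendsto_id.congr' ?_
    filter_upwards [ho.mem_nhds hz] with z' hz'
    exact (hb.injOn.leftInvOn_invFunOn hz').symm
  convert (isCompact_closedBall (0:ℂ) r).image_of_continuousOn h1 using 1
  ext z; constructor
  · rintro ⟨hz, hz'⟩
    exact ⟨f z, by simpa using hz', hb.injOn.leftInvOn_invFunOn hz⟩
  · rintro ⟨w, hw, rfl⟩
    have hw1 := closedBall_subset_ball hr hw
    have := hb.surjOn hw1
    refine ⟨Function.invFunOn_mem this, ?_⟩
    rw [Function.invFunOn_eq this]; simpa using hw

namespace Kp
variable {D : Set ℂ} {c : ℝ × ℝ → ℂ} {δ : ℝ} {p : ℂ → ℂ} {k : ℝ × ℝ → ℂ} {η : ℝ}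

lemma toOne (P : Kp D c δ p k η) (ho : ∀ x, (fderiv ℝ k (x, 0) (0, 1)).im < 0) {φ : ℂ → ℂ} (A : Adm D φ)
    (hb : BijOn φ D (ball 0 1)) {r : ℝ} (hr : r < 1) :
    ∃ e > 0, ∀ w : ℂ, 0 < w.im → w.im < e → p w ∈ D ∧ r < ‖φ (p w)‖ := by
  obtain ⟨e, he, hs⟩ := P.pside ho
  have hK := (A.compact P.C.opn hb hr).isClosed
  obtain ⟨e', he', h⟩ := unif' (V := ℝ) (R := fun q => p (q.1 + q.2 * Complex.I) ∉ {z ∈ D | ‖φ z‖ ≤ r})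
    (by intro x t
        simp only
        rw [← P.pp (x + t * Complex.I)]; simp only [Complex.ofReal_add]; rw [add_right_comm])
    (by intro x
        have : Continuous (fun q : ℝ × ℝ => p (q.1 + q.2 * Complex.I : ℂ)) := P.hp.continuous.comp (by fun_prop)
        refine this.continuousAt.eventually (hK.isOpen_compl.mem_nhds ?_)
        simp only [mem_compl_iff, mem_setOf_eq, not_and]
        intro h
        have := (hs _ (by simpa using he)).1 h
        simp at this)
  refine ⟨min e e', by positivity, fun w h0 h1 => ?_⟩
  have hD : p w ∈ D := (hs w (by rw [abs_of_pos h0]; exact h1.trans_le (min_le_left _ _))).2 h0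
  refine ⟨hD, ?_⟩
  have := h w.re w.im (by rw [Real.norm_eq_abs, abs_of_pos h0]; exact h1.trans_le (min_le_right _ _))
  rw [Complex.re_add_im] at this
  by_contra h
  exact this ⟨hD, not_lt.1 h⟩

lemma exists_lam (P : Kp D c δ p k η) (ho : ∀ x, (fderiv ℝ k (x, 0) (0, 1)).im < 0) {φ : ℂ → ℂ} (A : Adm D φ)
    (hb : BijOn φ D (ball 0 1)) :
    ∃ s1 > 0, ∃ (Λ : ℂ → ℂ) (d : ℤ), DifferentiableOn ℂ Λ (ust (-s1) s1) ∧ (∀ w, Λ (w + tp) = Λ w + d * tp) ∧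
      (∀ x : ℝ, (Λ x).im = 0) ∧
      (∀ w ∈ ust 0 s1, p w ∈ D ∧ Complex.exp (Complex.I * Λ w) = φ (p w)) := by
  obtain ⟨η1, hη1, h1⟩ := P.toOne ho A hb (r := 1/2) (by norm_num)
  have hmem : ∀ w ∈ ust 0 η1, p w ∈ D := fun w hw => (h1 w hw.1 hw.2).1
  have hdψ : DifferentiableOn ℂ (fun w => φ (p w)) (ust 0 η1) := A.df.comp P.hp.differentiableOn hmem
  have hne : (ust 0 η1).Nonempty := ⟨(η1/2 : ℝ) * Complex.I, by simp [ust]; exact hη1⟩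
  obtain ⟨ℓ, hℓ, hℓe⟩ := exists_log (ust_convex 0 η1) (ust_open 0 η1) hne hdψ.continuousOn
    (fun w hw h => by have := (h1 w hw.1 hw.2).2; rw [h] at this; norm_num at this)
  have hdℓ := log_diff (ust_open 0 η1) hℓ hdψ hℓe
  have hshift : ∀ w ∈ ust 0 η1, w + tp ∈ ust 0 η1 := fun w hw => by simpa [ust] using hw
  obtain ⟨d, hd⟩ := log_const (ust_convex 0 η1).isPreconnected (u := fun w => ℓ (w + tp)) (v := ℓ)
    (hℓ.comp (by fun_prop) hshift) hℓ (by
      intro w hw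
      rw [hℓe _ (hshift w hw), hℓe w hw, P.pp]) hne
  set Am : ℂ → ℂ := fun w => -Complex.I * ℓ w - d * w with hAm
  have hIm : ∀ w ∈ ust 0 η1, (Am w).im = - Real.log ‖φ (p w)‖ - d * w.im := by
    intro w hw
    rw [← hℓe w hw, Complex.norm_exp, Real.log_exp]; simp [hAm]
  obtain ⟨s1, hs1, hs1η, G, hG, hGp, hGA, hGr⟩ := reflect (A := Am) hη1
    ((hdℓ.const_mul _).sub (by fun_prop))
    (by intro w hw
        simp only [hAm]
        have := hd w hw
        rw [this]; ring_nf; rw [Complex.I_sq]; ring)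
    (by intro ε hε
        obtain ⟨e, he, h⟩ := P.toOne ho A hb (r := Real.exp (-(ε/2))) (by rw [Real.exp_lt_one_iff]; linarith)
        refine ⟨min (min e η1) (ε / (2 * (|(d:ℝ)| + 1))), by positivity, fun w h0 h1' => ?_⟩
        have i1 := h1'.trans_le ((min_le_left _ _).trans (min_le_left _ _))
        have i2 := h1'.trans_le ((min_le_left _ _).trans (min_le_right _ _))
        have i3 := h1'.trans_le (min_le_right _ _)
        rw [hIm w ⟨h0, i2⟩]
        obtain ⟨hD, hn⟩ := h w h0 i1
        have l1 : -(ε/2) < Real.log ‖φ (p w)‖ := by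
          rw [Real.lt_log_iff_exp_lt ((Real.exp_pos _).trans hn)]; exact hn
        have l2 : Real.log ‖φ (p w)‖ ≤ 0 := Real.log_nonpos (norm_nonneg _) (A.mp _ hD).le
        rw [lt_div_iff₀ (by positivity)] at i3
        have l3 : |(d:ℝ) * w.im| ≤ ε/2 := by
          rw [abs_mul, abs_of_pos h0]; nlinarith [abs_nonneg (d:ℝ)]
        rw [abs_le] at l3 ⊢
        constructor <;> linarith)
  refine ⟨s1, hs1, fun w => G w + d * w, d, hG.add (by fun_prop), fun w => ?_, fun x => ?_, fun w hw => ⟨hmem w ⟨hw.1, hw.2.trans_le hs1η⟩, ?_⟩⟩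
  · simp only [hGp]; ring
  · simp [hGr]
  · simp only
    rw [hGA w hw, ← hℓe w ⟨hw.1, hw.2.trans_le hs1η⟩]
    congr 1; simp only [hAm]; ring_nf; rw [Complex.I_sq]; ring

end Kp

lemma hopf {s1 : ℝ} (hs1 : 0 < s1) {Λ : ℂ → ℂ} {d : ℤ} (hΛ : DifferentiableOn ℂ Λ (ust (-s1) s1))
    (hp : ∀ w, Λ (w + tp) = Λ w + d * tp) (hr : ∀ x : ℝ, (Λ x).im = 0) (hpos : ∀ w ∈ ust 0 s1, 0 < (Λ w).im) (x : ℝ) :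
    (deriv Λ x).im = 0 ∧ 0 < (deriv Λ x).re := by
  have hdx : DifferentiableAt ℂ Λ x := hΛ.differentiableAt ((ust_open _ _).mem_nhds (by simp [ust, hs1]))
  refine ⟨?_, ?_⟩
  · have h1 : HasDerivAt (fun x : ℝ => (Λ x).im) (deriv Λ x).im x :=
      Complex.imCLM.hasFDerivAt.comp_hasDerivAt x hdx.hasDerivAt.comp_ofReal
    simp only [hr] at h1
    exact h1.unique (hasDerivAt_const x (0:ℝ))
  set s2 := s1 / 2 with hs2
  have hs20 : 0 < s2 := by positivity
  have hc : ContinuousOn (fun y : ℝ => (Λ (y + s2 * Complex.I)).im) (Icc 0 tp) := by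
    refine Complex.continuous_im.comp_continuousOn (hΛ.continuousOn.comp (by fun_prop) fun y _ => ?_)
    constructor <;> simp <;> linarith
  obtain ⟨y0, hy0, hmin⟩ := isCompact_Icc.exists_isMinOn (nonempty_Icc.2 tp_pos.le) hc
  set m := (Λ (y0 + s2 * Complex.I)).im with hm
  have hm0 : 0 < m := hpos _ (by constructor <;> simp <;> linarith)
  have hmle : ∀ y : ℝ, m ≤ (Λ (y + s2 * Complex.I)).im := by
    intro y
    obtain ⟨n, h0, h1⟩ := exists_Ico y
    have e := per_int (R := fun y : ℝ => (Λ (y + s2 * Complex.I)).im) (by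
      intro y; simp only [Complex.ofReal_add]; rw [add_right_comm, hp]; simp) y n
    rw [← e]
    exact hmin (⟨h0, h1.le⟩ : y + n * tp ∈ Icc 0 tp)
  set μ := m / s2 with hμ
  have hμ0 : 0 < μ := by positivity
  set u : ℂ → ℂ := fun w => Complex.exp (Complex.I * (Λ w - μ * w)) with hu
  have hun : ∀ w, ‖u w‖ = Real.exp (μ * w.im - (Λ w).im) := by
    intro w; rw [hu]; simp only; rw [Complex.norm_exp]; congr 1; simp
  have hcl : closure (Complex.im ⁻¹' Ioo 0 s2) ⊆ ust (-s1) s1 := by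
    rw [Complex.closure_preimage_im, closure_Ioo hs20.ne]
    intro w hw
    exact ⟨by linarith [hw.1], by linarith [hw.2]⟩
  have hle : ∀ w : ℂ, 0 ≤ w.im → w.im ≤ s2 → ‖u w‖ ≤ 1 := by
    intro w h0 h1
    refine PhragmenLindelof.horizontal_strip (a := 0) (b := s2) ?_ ?_ ?_ ?_ h0 h1
    · have : DifferentiableOn ℂ u (ust (-s1) s1) := ((hΛ.sub (by fun_prop)).const_mul _).cexp
      exact (this.mono hcl).diffContOnCl
    · refine ⟨0, by have := Real.pi_pos; positivity, μ * s2, ?_⟩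
      refine Asymptotics.IsBigO.of_bound 1 ?_
      refine eventually_inf_principal.2 (Eventually.of_forall fun w hw => ?_)
      rw [hun, one_mul, Real.norm_of_nonneg (Real.exp_pos _).le]
      simp only [zero_mul, Real.exp_zero, mul_one]
      refine Real.exp_le_exp.2 ?_
      have := hpos w ⟨hw.1, by linarith [hw.2]⟩
      have := mul_le_mul_of_nonneg_left hw.2.le hμ0.le
      linarith
    · intro z hz
      have : (Λ z).im = 0 := by
        rw [← Complex.re_add_im z, hz]; simpa using hr z.re
      rw [hun, hz, this]; simp
    · intro z hz
      have := hmle z.re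
      rw [← hz, Complex.re_add_im] at this
      rw [hun, hz, Real.exp_le_one_iff, hμ]
      field_simp; linarith
  have hlow : ∀ s, 0 ≤ s → s ≤ s2 → μ * s ≤ (Λ (x + s * Complex.I)).im := by
    intro s h0 h1
    have := hle (x + s * Complex.I) (by simpa using h0) (by simpa using h1)
    rw [hun, Real.exp_le_one_iff] at this
    simp at this; exact this
  have hd : HasDerivAt (fun s : ℝ => (Λ (x + s * Complex.I)).im) (deriv Λ x).re 0 := by
    have h2 : HasDerivAt (fun s : ℝ => (x + s * Complex.I : ℂ)) Complex.I 0 := by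
      have := (Complex.ofRealCLM.hasDerivAt (x := (0:ℝ))).mul_const Complex.I
      simpa using this.const_add (x:ℂ)
    have h1 : HasDerivAt Λ (deriv Λ x) ((fun s : ℝ => (x + s * Complex.I : ℂ)) 0) := by simpa using hdx.hasDerivAt
    have h3 := Complex.imCLM.hasFDerivAt.comp_hasDerivAt (0:ℝ) (h1.comp (0:ℝ) h2)
    exact h3.congr_deriv (by simp)
  have ht := (hasDerivWithinAt_iff_tendsto_slope' (s := Ioi 0) (by simp)).1 (hd.hasDerivWithinAt (s := Ioi 0))
  refine hμ0.trans_le (ge_of_tendsto ht ?_)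
  filter_upwards [Ioo_mem_nhdsGT hs20] with s hs
  rw [slope_def_field]
  have := hlow s hs.1.le hs.2.le
  simp only [Complex.ofReal_zero, zero_mul, add_zero, hr, sub_zero]
  rw [le_div_iff₀ hs.1]; exact this

end Glu

namespace Glu
open Set Filter Topology Metric
open scoped ContDiff

section dif
variable {E F G : Type*} [NormedAddCommGroup E] [NormedSpace ℝ E] [FiniteDimensional ℝ E]
  [NormedAddCommGroup F] [NormedSpace ℝ F] [FiniteDimensional ℝ F] [NormedAddCommGroup G] [NormedSpace ℝ G] [FiniteDimensional ℝ G]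

structure Dif (f : E → F) (U : Set E) (V : Set F) : Prop where
  bij : BijOn f U V
  sm : ∀ x ∈ U, ContDiffAt ℝ ∞ f x
  imm : ∀ x ∈ U, ∀ u, fderiv ℝ f x u = 0 → u = 0

lemma imm_comp {g : F → G} {f : E → F} {x : E} (hg : ContDiffAt ℝ ∞ g (f x)) (hf : ContDiffAt ℝ ∞ f x)
    (ig : ∀ u, fderiv ℝ g (f x) u = 0 → u = 0) (if' : ∀ u, fderiv ℝ f x u = 0 → u = 0) (u : E)
    (h : fderiv ℝ (fun x => g (f x)) x u = 0) : u = 0 := by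
  have h1 : HasFDerivAt (fun x => g (f x)) _ x :=
    HasFDerivAt.comp (g := g) x (hg.differentiableAt (by simp)).hasFDerivAt (hf.differentiableAt (by simp)).hasFDerivAt
  rw [h1.fderiv] at h
  exact if' u (ig _ h)

lemma imm_of_comp {g : F → G} {f : E → F} {x : E} (hg : ContDiffAt ℝ ∞ g (f x)) (hf : ContDiffAt ℝ ∞ f x)
    (ic : ∀ u, fderiv ℝ (fun x => g (f x)) x u = 0 → u = 0) (u : E) (h : fderiv ℝ f x u = 0) : u = 0 := by
  have h1 : HasFDerivAt (fun x => g (f x)) _ x :=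
    HasFDerivAt.comp (g := g) x (hg.differentiableAt (by simp)).hasFDerivAt (hf.differentiableAt (by simp)).hasFDerivAt
  refine ic u ?_
  rw [h1.fderiv, ContinuousLinearMap.comp_apply, h, map_zero]

lemma Dif.comp {g : F → G} {f : E → F} {U : Set E} {V : Set F} {W : Set G} (hg : Dif g V W) (hf : Dif f U V) :
    Dif (fun x => g (f x)) U W :=
  ⟨hg.bij.comp hf.bij, fun x hx => (hg.sm _ (hf.bij.mapsTo hx)).comp x (hf.sm x hx),
    fun x hx => imm_comp (hg.sm _ (hf.bij.mapsTo hx)) (hf.sm x hx) (hg.imm _ (hf.bij.mapsTo hx)) (hf.imm x hx)⟩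

lemma Dif.inv [Nonempty E] {f : E → F} {U : Set E} {V : Set F} (hU : IsOpen U) (hf : Dif f U V)
    (hd : Module.finrank ℝ E = Module.finrank ℝ F) : Dif (Function.invFunOn f U) V U := by
  have hl := hf.bij.injOn.leftInvOn_invFunOn
  have hbij : BijOn (Function.invFunOn f U) V U := hf.bij.symm ⟨hf.bij.surjOn.rightInvOn_invFunOn, hl⟩
  have key : ∀ x ∈ U, ∃ g : F → E, ContDiffAt ℝ ∞ g (f x) ∧ (∀ᶠ z in 𝓝 (f x), f (g z) = z) ∧ Function.invFunOn f U =ᶠ[𝓝 (f x)] g := by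
    intro x hx
    obtain ⟨hm, -, g, hg, hgx, h1, h2⟩ := exists_localInv hd (hf.sm x hx) (hf.imm x hx)
    refine ⟨g, hg, h1, ?_⟩
    rw [EventuallyEq, ← hm, eventually_map]
    filter_upwards [h2, hU.mem_nhds hx] with y hy hyU
    rw [hy, hl hyU]
  refine ⟨hbij, fun y hy => ?_, fun y hy u hu => ?_⟩
  · obtain ⟨x, hx, rfl⟩ := hf.bij.surjOn hy
    obtain ⟨g, hg, -, he⟩ := key x hx
    exact hg.congr_of_eventuallyEq he
  · obtain ⟨x, hx, rfl⟩ := hf.bij.surjOn hy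
    obtain ⟨g, hg, hr, he⟩ := key x hx
    have hi := hg.congr_of_eventuallyEq he
    have h3 : (fun z => f (Function.invFunOn f U z)) =ᶠ[𝓝 (f x)] fun z => z := by
      filter_upwards [hr, he] with z hz hz'
      rw [hz', hz]
    refine imm_of_comp (g := f) (f := Function.invFunOn f U) (x := f x) (by rw [hl hx]; exact hf.sm x hx) hi (fun u hu => ?_) u hu
    rw [h3.fderiv_eq] at hu
    simpa using hu

lemma Dif.congr {f g : E → F} {U : Set E} {V : Set F} (hU : IsOpen U) (hf : Dif f U V) (h : EqOn f g U) : Dif g U V := by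
  have hev : ∀ x ∈ U, g =ᶠ[𝓝 x] f := fun x hx => by
    filter_upwards [hU.mem_nhds hx] with y hy using (h hy).symm
  refine ⟨hf.bij.congr h, fun x hx => (hf.sm x hx).congr_of_eventuallyEq (hev x hx), fun x hx u hu => ?_⟩
  rw [(hev x hx).fderiv_eq] at hu
  exact hf.imm x hx u hu
end dif

lemma bump {a b : ℝ} (hab : a < b) : ∃ β : ℝ → ℝ, ContDiff ℝ ∞ β ∧ Monotone β ∧ (∀ t ≤ a, β t = 0) ∧ (∀ t ≥ b, β t = 1) ∧
    (∀ t, 0 ≤ β t ∧ β t ≤ 1) := by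
  refine ⟨fun t => Real.smoothTransition ((t - a) / (b - a)), ?_, ?_, ?_, ?_, fun t => ⟨Real.smoothTransition.nonneg _, Real.smoothTransition.le_one _⟩⟩
  · exact Real.smoothTransition.contDiff.comp (by fun_prop)
  · intro t t' h
    apply Real.smoothTransition.monotone
    have : 0 < b - a := by linarith
    gcongr
  · intro t ht
    exact Real.smoothTransition.zero_of_nonpos (div_nonpos_of_nonpos_of_nonneg (by linarith) (by linarith))
  · intro t ht
    refine Real.smoothTransition.one_of_one_le ?_
    rw [le_div_iff₀ (by linarith)]; linarith

abbrev HP : Set (ℝ × ℝ) := {q | 0 < q.2}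
lemma HP_open : IsOpen HP := isOpen_lt continuous_const continuous_snd

lemma slice_t {Z : Type*} [NormedAddCommGroup Z] [NormedSpace ℝ Z] {f : ℝ × ℝ → Z} {q : ℝ × ℝ} (h : ContDiffAt ℝ ∞ f q) : HasDerivAt (fun t => f (q.1, t)) (fderiv ℝ f q (0, 1)) q.2 := by
  have h3 : HasFDerivAt f (fderiv ℝ f q) (q.1, q.2) := (h.differentiableAt (by simp)).hasFDerivAt
  exact h3.comp_hasDerivAt q.2 ((hasDerivAt_const q.2 q.1).prodMk (hasDerivAt_id q.2))

lemma slice_x {Z : Type*} [NormedAddCommGroup Z] [NormedSpace ℝ Z] {f : ℝ × ℝ → Z} {q : ℝ × ℝ} (h : ContDiffAt ℝ ∞ f q) : HasDerivAt (fun x => f (x, q.2)) (fderiv ℝ f q (1, 0)) q.1 := by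
  have h3 : HasFDerivAt f (fderiv ℝ f q) (q.1, q.2) := (h.differentiableAt (by simp)).hasFDerivAt
  exact h3.comp_hasDerivAt q.1 ((hasDerivAt_id q.1).prodMk (hasDerivAt_const q.1 q.2))

lemma shearY {τ : ℝ × ℝ → ℝ} {e : ℝ} (he : 0 < e) (sm : ∀ q : ℝ × ℝ, |q.2| < e → ContDiffAt ℝ ∞ τ q)
    (per : ∀ x t, τ (x + tp, t) = τ (x, t)) (h0 : ∀ x, τ (x, 0) = 0)
    (hd : ∀ q : ℝ × ℝ, |q.2| < e → 0 < fderiv ℝ τ q (0, 1)) :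
    ∃ (Y : ℝ × ℝ → ℝ) (κ : ℝ), 0 ≤ κ ∧ Dif (fun q => (q.1, Y q)) HP HP ∧ (∀ x t, Y (x + tp, t) = Y (x, t)) ∧
      (∀ q : ℝ × ℝ, q.2 < e / 4 → Y q = τ q) ∧ (∀ q : ℝ × ℝ, e < q.2 → Y q = q.2 + κ) := by
  obtain ⟨β, βs, βm, β0, β1, βb⟩ := bump (show e/4 < e/2 by linarith)
  obtain ⟨κ, hκ0, hκ⟩ : ∃ κ ≥ 0, ∀ q : ℝ × ℝ, 0 ≤ q.2 → q.2 ≤ e/2 → τ q ≤ κ := by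
    have hc : ContinuousOn τ (Icc (0:ℝ) tp ×ˢ Icc (0:ℝ) (e/2)) := fun q hq =>
      (sm q (by rw [abs_of_nonneg hq.2.1]; linarith [hq.2.2])).continuousAt.continuousWithinAt
    obtain ⟨B, hB⟩ := (isCompact_Icc.prod isCompact_Icc).exists_bound_of_continuousOn hc
    refine ⟨max B 0, le_max_right _ _, fun q h1 h2 => ?_⟩
    obtain ⟨n, i1, i2⟩ := exists_Ico q.1
    have := per_int (R := fun x => τ (x, q.2)) (fun x => per x q.2) q.1 n
    have h := hB (q.1 + n * tp, q.2) ⟨⟨i1, i2.le⟩, ⟨h1, h2⟩⟩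
    rw [this] at h
    exact ((le_abs_self _).trans h).trans (le_max_left _ _)
  set Y : ℝ × ℝ → ℝ := fun q => (1 - β q.2) * τ q + β q.2 * (q.2 + κ) with hY
  have hYbig : ∀ q : ℝ × ℝ, e/2 < q.2 → Y q = q.2 + κ := by
    intro q hq; simp only [hY]; rw [β1 _ hq.le]; ring
  have hYs : ∀ q : ℝ × ℝ, -e < q.2 → ContDiffAt ℝ ∞ Y q := by
    intro q hq
    rcases lt_or_ge q.2 e with h | h
    · have hβ : ContDiffAt ℝ ∞ (fun q : ℝ × ℝ => β q.2) q := βs.contDiffAt.comp q contDiffAt_snd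
      exact ((contDiffAt_const.sub hβ).mul (sm q (abs_lt.2 ⟨hq, h⟩))).add (hβ.mul (contDiffAt_snd.add contDiffAt_const))
    · have : Y =ᶠ[𝓝 q] fun q => q.2 + κ := by
        filter_upwards [(isOpen_lt continuous_const continuous_snd).mem_nhds (show e/2 < q.2 by linarith)] with q' hq' using hYbig q' hq'
      exact ContDiffAt.congr_of_eventuallyEq (by fun_prop) this
  have hYd : ∀ q : ℝ × ℝ, 0 < q.2 → 0 < fderiv ℝ Y q (0, 1) := by
    intro q hq
    have h1 := slice_t (hYs q (by linarith))
    rcases le_or_gt q.2 (e/2) with h | h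
    · have hq' : |q.2| < e := by rw [abs_of_pos hq]; linarith
      have hβ : HasDerivAt β (deriv β q.2) q.2 := (βs.differentiable (by simp) _).hasDerivAt
      have h2 := ((hβ.const_sub 1).mul (slice_t (sm q hq'))).add (hβ.mul ((hasDerivAt_id q.2).add_const κ))
      have h3 := h1.unique h2
      rw [h3]
      have hb := βb q.2
      have hβ0 : 0 ≤ deriv β q.2 := βm.deriv_nonneg
      have hk := hκ q hq.le h
      have hdq := hd q hq'
      have e1 : 0 ≤ deriv β q.2 * (q.2 + κ - τ q) := mul_nonneg hβ0 (by linarith)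
      have e2 : 0 < (1 - β q.2) * fderiv ℝ τ q (0, 1) + β q.2 := by
        rcases hb.2.lt_or_eq with hlt | heq
        · have := mul_pos (sub_pos.2 hlt) hdq; linarith [hb.1]
        · rw [heq]; norm_num
      simp only [id]
      nlinarith
    · have : Y =ᶠ[𝓝 q] fun q => q.2 + κ := by
        filter_upwards [(isOpen_lt continuous_const continuous_snd).mem_nhds h] with q' hq' using hYbig q' hq'
      rw [this.fderiv_eq]
      have : HasFDerivAt (fun q : ℝ × ℝ => q.2 + κ) (ContinuousLinearMap.snd ℝ ℝ ℝ) q := hasFDerivAt_snd.add_const κ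
      rw [this.fderiv]; simp
  have hmono : ∀ x, StrictMonoOn (fun t => Y (x, t)) (Ici 0) := by
    intro x
    refine strictMonoOn_of_deriv_pos (convex_Ici 0) (fun t ht => ?_) fun t ht => ?_
    · exact (slice_t (hYs (x, t) (by simp at ht ⊢; linarith))).continuousAt.continuousWithinAt
    · rw [interior_Ici] at ht
      rw [(slice_t (hYs (x, t) (by simp at ht ⊢; linarith))).deriv]; exact hYd (x, t) ht
  have hY0 : ∀ x, Y (x, 0) = 0 := by intro x; simp only [hY]; rw [β0 0 (by positivity), h0]; ring
  refine ⟨Y, κ, hκ0, ⟨⟨?_, ?_, ?_⟩, ?_, ?_⟩, ?_, ?_, fun q hq => hYbig q (by linarith)⟩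
  · intro q hq
    have := hmono q.1 (mem_Ici.2 le_rfl) (mem_Ici.2 (le_of_lt hq)) hq
    simpa [hY0] using this
  · intro q hq q' hq' h
    simp only [Prod.mk.injEq] at h
    refine Prod.ext h.1 ((hmono q.1).injOn (mem_Ici.2 (le_of_lt hq)) (mem_Ici.2 (le_of_lt hq')) ?_)
    have := h.2; rw [show q' = (q.1, q'.2) from Prod.ext h.1.symm rfl] at this; exact this
  · rintro ⟨x, y⟩ hy
    simp only [mem_setOf_eq] at hy
    have hc : ContinuousOn (fun t => Y (x, t)) (Icc 0 (max e y)) := fun t ht =>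
      (slice_t (hYs (x, t) (by have := ht.1; simp; linarith))).continuousAt.continuousWithinAt
    have hmem : y ∈ Icc (Y (x, 0)) (Y (x, max e y)) := by
      rw [hY0, hYbig (x, max e y) (by have := le_max_left e y; simp only; linarith)]
      exact ⟨hy.le, by have := le_max_right e y; simp only; linarith⟩
    obtain ⟨t, ht, hty⟩ := intermediate_value_Icc (by positivity) hc hmem
    refine ⟨(x, t), ?_, Prod.ext rfl hty⟩
    rcases ht.1.lt_or_eq with h | h
    · exact h
    · exfalso; rw [← h] at hty; simp only [hY0] at hty; linarith
  · intro q hq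
    simp only [mem_setOf_eq] at hq
    exact contDiffAt_fst.prodMk (hYs q (by linarith))
  · intro q hq u hu
    simp only [mem_setOf_eq] at hq
    have h1 : HasFDerivAt (fun q => (q.1, Y q)) _ q := hasFDerivAt_fst.prodMk ((hYs q (by linarith)).differentiableAt (by simp)).hasFDerivAt
    rw [h1.fderiv] at hu
    simp only [ContinuousLinearMap.prod_apply, Prod.mk_eq_zero] at hu
    obtain ⟨h2, h3⟩ := hu
    have h2 : u.1 = 0 := h2
    have h4 : u = u.2 • (0, 1) := Prod.ext (by simp [h2]) (by simp)
    rw [h4, map_smul, smul_eq_mul] at h3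
    rcases mul_eq_zero.1 h3 with h | h
    · rw [h4, h, zero_smul]
    · exact absurd h (hYd q hq).ne'
  · intro x t; simp only [hY, per]
  · intro q hq; simp only [hY]; rw [β0 _ hq.le]; ring

lemma surj_of_shift {g : ℝ → ℝ} (hg : Continuous g) (per : ∀ x, g (x + tp) = g x + tp) : Function.Surjective g := by
  have hn : ∀ n : ℤ, g (n * tp) = g 0 + n * tp := by
    intro n
    have := per_int (R := fun x => g x - x) (by intro x; simp only [per]; ring) 0 n
    simp only [zero_add] at this; linarith
  intro y
  have hp := tp_pos
  obtain ⟨n, h0, h1⟩ := exists_Ico (y - g 0)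
  have hmem : y ∈ Icc (g ((-n : ℤ) * tp)) (g ((-n + 1 : ℤ) * tp)) := by
    rw [hn, hn]; push_cast; constructor <;> linarith
  obtain ⟨x, -, hx⟩ := intermediate_value_Icc (by push_cast; linarith) hg.continuousOn hmem
  exact ⟨x, hx⟩

lemma shearX {τ : ℝ × ℝ → ℝ} {e : ℝ} (he : 0 < e) (sm : ∀ q : ℝ × ℝ, |q.2| < e → ContDiffAt ℝ ∞ τ q)
    (per : ∀ x t, τ (x + tp, t) = τ (x, t) + tp)
    (hd : ∀ q : ℝ × ℝ, |q.2| < e → 0 < fderiv ℝ τ q (1, 0)) :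
    ∃ (X : ℝ × ℝ → ℝ), Dif (fun q => (X q, q.2)) HP HP ∧ (∀ x t, X (x + tp, t) = X (x, t) + tp) ∧
      (∀ q : ℝ × ℝ, q.2 < e / 4 → X q = τ q) ∧ (∀ q : ℝ × ℝ, e < q.2 → X q = q.1) := by
  obtain ⟨β, βs, βm, β0, β1, βb⟩ := bump (show e/4 < e/2 by linarith)
  set X : ℝ × ℝ → ℝ := fun q => (1 - β q.2) * τ q + β q.2 * q.1 with hX
  have hXbig : ∀ q : ℝ × ℝ, e/2 < q.2 → X q = q.1 := by
    intro q hq; simp only [hX]; rw [β1 _ hq.le]; ring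
  have hXs : ∀ q : ℝ × ℝ, 0 < q.2 → ContDiffAt ℝ ∞ X q := by
    intro q hq
    rcases lt_or_ge q.2 e with h | h
    · have hβ : ContDiffAt ℝ ∞ (fun q : ℝ × ℝ => β q.2) q := βs.contDiffAt.comp q contDiffAt_snd
      exact ((contDiffAt_const.sub hβ).mul (sm q (abs_lt.2 ⟨by linarith, h⟩))).add (hβ.mul contDiffAt_fst)
    · have : X =ᶠ[𝓝 q] fun q => q.1 := by
        filter_upwards [(isOpen_lt continuous_const continuous_snd).mem_nhds (show e/2 < q.2 by linarith)] with q' hq' using hXbig q' hq'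
      exact ContDiffAt.congr_of_eventuallyEq (by fun_prop) this
  have hXd : ∀ q : ℝ × ℝ, 0 < q.2 → 0 < fderiv ℝ X q (1, 0) := by
    intro q hq
    have h1 := slice_x (hXs q hq)
    rcases le_or_gt q.2 (e/2) with h | h
    · have hq' : |q.2| < e := by rw [abs_of_pos hq]; linarith
      have h2 := ((slice_x (sm q hq')).const_mul (1 - β q.2)).add ((hasDerivAt_id q.1).const_mul (β q.2))
      rw [h1.unique h2]
      have hb := βb q.2
      rcases hb.2.lt_or_eq with hlt | heq
      · have := mul_pos (sub_pos.2 hlt) (hd q hq'); linarith [hb.1]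
      · rw [heq]; norm_num
    · have : X =ᶠ[𝓝 q] fun q => q.1 := by
        filter_upwards [(isOpen_lt continuous_const continuous_snd).mem_nhds h] with q' hq' using hXbig q' hq'
      rw [this.fderiv_eq, hasFDerivAt_fst.fderiv]; simp
  have hmono : ∀ t, 0 < t → StrictMono (fun x => X (x, t)) := by
    intro t ht
    refine strictMono_of_deriv_pos fun x => ?_
    rw [(slice_x (hXs (x, t) ht)).deriv]; exact hXd (x, t) ht
  have hXp : ∀ x t, X (x + tp, t) = X (x, t) + tp := by intro x t; simp only [hX, per]; ring
  refine ⟨X, ⟨⟨fun q hq => hq, ?_, ?_⟩, ?_, ?_⟩, hXp, ?_, fun q hq => hXbig q (by linarith)⟩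
  · intro q hq q' hq' h
    simp only [Prod.mk.injEq] at h
    refine Prod.ext ((hmono q.2 hq).injective ?_) h.2
    have := h.1; rw [show q' = (q'.1, q.2) from Prod.ext rfl h.2.symm] at this; exact this
  · rintro ⟨x, y⟩ hy
    obtain ⟨x', hx'⟩ := surj_of_shift (g := fun x => X (x, y)) (continuous_iff_continuousAt.2 fun x => (slice_x (hXs (x, y) hy)).continuousAt) (fun x => hXp x y) x
    exact ⟨(x', y), hy, Prod.ext hx' rfl⟩
  · intro q hq
    exact (hXs q hq).prodMk contDiffAt_snd
  · intro q hq u hu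
    have h1 : HasFDerivAt (fun q => (X q, q.2)) _ q := ((hXs q hq).differentiableAt (by simp)).hasFDerivAt.prodMk hasFDerivAt_snd
    rw [h1.fderiv] at hu
    simp only [ContinuousLinearMap.prod_apply, Prod.mk_eq_zero] at hu
    obtain ⟨h3, h2⟩ := hu
    have h2 : u.2 = 0 := h2
    have h4 : u = u.1 • (1, 0) := Prod.ext (by simp) (by simp [h2])
    rw [h4, map_smul, smul_eq_mul] at h3
    rcases mul_eq_zero.1 h3 with h | h
    · rw [h4, h, zero_smul]
    · exact absurd h (hXd q hq).ne'
  · intro q hq; simp only [hX]; rw [β0 _ hq.le]; ring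

end Glu

namespace Glu
open Set Filter Topology Metric
open scoped ContDiff

def ex (q : ℝ × ℝ) : ℂ := Complex.exp (Complex.I * (q.1 + q.2 * Complex.I))

lemma ex_sm : ContDiff ℝ ∞ ex := by
  unfold ex
  refine ContDiff.cexp (contDiff_const.mul ?_)
  exact (Complex.ofRealCLM.contDiff.comp contDiff_fst).add ((Complex.ofRealCLM.contDiff.comp contDiff_snd).mul contDiff_const)

lemma ex_norm (q : ℝ × ℝ) : ‖ex q‖ = Real.exp (-q.2) := by
  rw [ex, Complex.norm_exp]; congr 1; simp

lemma ex_ne (q : ℝ × ℝ) : ex q ≠ 0 := Complex.exp_ne_zero _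

lemma ex_per (x s : ℝ) : ex (x + tp, s) = ex (x, s) := by
  simp only [ex]
  rw [Complex.exp_eq_exp_iff_exists_int]
  exact ⟨1, by simp only [tp]; push_cast; ring⟩

lemma ex_inj {q q' : ℝ × ℝ} (h : ex q = ex q') : q.2 = q'.2 ∧ ∃ n : ℤ, q.1 = q'.1 + n * tp := by
  rw [ex, ex, Complex.exp_eq_exp_iff_exists_int] at h
  obtain ⟨n, hn⟩ := h
  have h1 := congrArg Complex.re hn
  have h2 := congrArg Complex.im hn
  simp at h1 h2
  exact ⟨by linarith, n, by simp only [tp]; linarith⟩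

lemma ex_surj {z : ℂ} (hz : z ≠ 0) : ∃ q, ex q = z := by
  refine ⟨((Complex.log z).im, -(Complex.log z).re), ?_⟩
  conv_rhs => rw [← Complex.exp_log hz, ← Complex.re_add_im (Complex.log z)]
  rw [ex]; congr 1; push_cast; ring_nf; rw [Complex.I_sq]; ring

lemma ex_imm (q u : ℝ × ℝ) (h : fderiv ℝ ex q u = 0) : u = 0 := by
  have h1 : HasFDerivAt (fun q : ℝ × ℝ => Complex.I * ((q.1:ℂ) + q.2 * Complex.I))
      (Complex.I • (Complex.ofRealCLM.comp (ContinuousLinearMap.fst ℝ ℝ ℝ) + Complex.I • (Complex.ofRealCLM.comp (ContinuousLinearMap.snd ℝ ℝ ℝ)))) q := by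
    refine HasFDerivAt.const_mul ?_ _
    exact (Complex.ofRealCLM.hasFDerivAt.comp q hasFDerivAt_fst).add (HasFDerivAt.mul_const (Complex.ofRealCLM.hasFDerivAt.comp q hasFDerivAt_snd) _)
  have h2 : HasFDerivAt ex _ q := h1.cexp
  rw [h2.fderiv, ContinuousLinearMap.smul_apply, smul_eq_mul] at h
  replace h := (mul_eq_zero.1 h).resolve_left (Complex.exp_ne_zero _)
  have a1 := congrArg Complex.re h
  have a2 := congrArg Complex.im h
  simp at a1 a2
  exact Prod.ext a2 a1

lemma ex_HP {q : ℝ × ℝ} : ex q ∈ ball (0:ℂ) 1 ↔ 0 < q.2 := by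
  rw [mem_ball_zero_iff, ex_norm, Real.exp_lt_one_iff, neg_lt_zero]

lemma discT {M : ℝ × ℝ → ℝ × ℝ} (hM : Dif M HP HP) (per : ∀ x s, M (x + tp, s) = ((M (x, s)).1 + tp, (M (x, s)).2))
    {κ b : ℝ} (hbig : ∀ q : ℝ × ℝ, b < q.2 → M q = (q.1, q.2 + κ)) :
    ∃ T : ℂ → ℂ, Dif T (ball 0 1) (ball 0 1) ∧ ∀ q : ℝ × ℝ, 0 < q.2 → T (ex q) = ex (M q) := by
  classical
  have hpn : ∀ (q : ℝ × ℝ) (n : ℤ), M (q.1 + n * tp, q.2) = ((M q).1 + n * tp, (M q).2) := by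
    intro q n
    have := per_int (R := fun x => M (x, q.2) - (x, 0)) (by intro x; simp only [per]; ext <;> simp) q.1 n
    have e := sub_eq_sub_iff_add_eq_add.1 this
    ext
    · have := congrArg Prod.fst e; simp at this; simp; linarith
    · have := congrArg Prod.snd e; simpa using this
  have hexn : ∀ (x s : ℝ) (n : ℤ), ex (x + n * tp, s) = ex (x, s) := fun x s n => per_int (R := fun x => ex (x, s)) (fun x => ex_per x s) x n
  set T : ℂ → ℂ := fun z => if z = 0 then 0 else ex (M (Classical.epsilon (fun q => ex q = z))) with hT
  have hTex : ∀ q, T (ex q) = ex (M q) := by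
    intro q
    simp only [hT]; rw [if_neg (ex_ne q)]
    obtain ⟨h1, n, h2⟩ := ex_inj (Classical.epsilon_spec (p := fun q' => ex q' = ex q) ⟨q, rfl⟩)
    have : Classical.epsilon (fun q' => ex q' = ex q) = (q.1 + n * tp, q.2) := Prod.ext h2 h1
    rw [this, hpn, hexn]
  have hT0 : T 0 = 0 := by simp [hT]
  have hTdeep : ∀ z, ‖z‖ < Real.exp (-b) → T z = Real.exp (-κ) * z := by
    intro z hz
    by_cases h : z = 0
    · simp [h, hT0]
    · obtain ⟨q, rfl⟩ := ex_surj h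
      rw [ex_norm, Real.exp_lt_exp] at hz
      rw [hTex, hbig q (by linarith), ex, ex, Complex.ofReal_exp, ← Complex.exp_add]
      congr 1; push_cast; ring_nf; rw [Complex.I_sq]; ring
  have hTev : T =ᶠ[𝓝 0] fun z => Real.exp (-κ) * z := by
    filter_upwards [ball_mem_nhds (0:ℂ) (Real.exp_pos (-b))] with z hz
    exact hTdeep z (by simpa using hz)
  have hloc : ∀ q : ℝ × ℝ, 0 < q.2 → ∃ g : ℂ → ℝ × ℝ, ContDiffAt ℝ ∞ g (ex q) ∧ g (ex q) = q ∧
      (∀ u, fderiv ℝ g (ex q) u = 0 → u = 0) ∧ T =ᶠ[𝓝 (ex q)] fun z => ex (M (g z)) := by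
    intro q hq
    obtain ⟨-, -, g, hg, hgq, h1, -⟩ := exists_localInv (E := ℝ × ℝ) (F := ℂ) (by simp) ex_sm.contDiffAt (ex_imm q)
    refine ⟨g, hg, hgq, ?_, ?_⟩
    · refine imm_of_comp (g := ex) ex_sm.contDiffAt hg fun u hu => ?_
      have : (fun z => ex (g z)) =ᶠ[𝓝 (ex q)] fun z => z := h1
      rw [this.fderiv_eq] at hu; simpa using hu
    · filter_upwards [h1] with z hz
      rw [← hTex, hz]
  refine ⟨T, ⟨⟨?_, ?_, ?_⟩, ?_, ?_⟩, fun q _ => hTex q⟩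
  · intro z hz
    by_cases h : z = 0
    · simp [h, hT0]
    · obtain ⟨q, rfl⟩ := ex_surj h
      rw [hTex, ex_HP]; exact hM.bij.mapsTo (ex_HP.1 hz)
  · intro z hz z' hz' h
    by_cases h0 : z = 0
    · by_cases h0' : z' = 0
      · rw [h0, h0']
      · obtain ⟨q, rfl⟩ := ex_surj h0'
        rw [h0, hT0, hTex] at h; exact absurd h.symm (ex_ne _)
    · obtain ⟨q, rfl⟩ := ex_surj h0
      by_cases h0' : z' = 0
      · rw [h0', hT0, hTex] at h; exact absurd h (ex_ne _)
      · obtain ⟨q', rfl⟩ := ex_surj h0'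
        rw [hTex, hTex] at h
        obtain ⟨h1, n, h2⟩ := ex_inj h
        have h3 : M q = M (q'.1 + n * tp, q'.2) := by rw [hpn]; exact Prod.ext h2 h1
        have := hM.bij.injOn (ex_HP.1 hz) (show (q'.1 + n * tp, q'.2) ∈ HP by have := ex_HP.1 hz'; exact this) h3
        rw [this, hexn]
  · intro z hz
    by_cases h : z = 0
    · exact ⟨0, by simp, by rw [hT0, h]⟩
    · obtain ⟨q, rfl⟩ := ex_surj h
      obtain ⟨q', hq', rfl⟩ := hM.bij.surjOn (ex_HP.1 hz)
      exact ⟨ex q', ex_HP.2 hq', hTex q'⟩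
  · intro z hz
    by_cases h : z = 0
    · rw [h]; exact ContDiffAt.congr_of_eventuallyEq (by fun_prop) hTev
    · obtain ⟨q, rfl⟩ := ex_surj h
      obtain ⟨g, hg, hgq, -, hev⟩ := hloc q (ex_HP.1 hz)
      refine ContDiffAt.congr_of_eventuallyEq ?_ hev
      refine ex_sm.contDiffAt.comp _ (ContDiffAt.comp _ ?_ hg)
      rw [hgq]; exact hM.sm q (ex_HP.1 hz)
  · intro z hz u hu
    by_cases h : z = 0
    · rw [h, hTev.fderiv_eq] at hu
      have h1 : HasFDerivAt (fun z : ℂ => (Real.exp (-κ) : ℂ) * z) _ 0 := (hasFDerivAt_id (𝕜 := ℝ) (0:ℂ)).const_mul _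
      rw [h1.fderiv] at hu
      simpa using hu
    · obtain ⟨q, rfl⟩ := ex_surj h
      obtain ⟨g, hg, hgq, hgi, hev⟩ := hloc q (ex_HP.1 hz)
      rw [hev.fderiv_eq] at hu
      have hMs := hM.sm q (ex_HP.1 hz)
      rw [← hgq] at hMs
      have hMi := hM.imm q (ex_HP.1 hz)
      rw [← hgq] at hMi
      exact imm_comp (g := ex) (f := fun z => M (g z)) ex_sm.contDiffAt (hMs.comp _ hg) (ex_imm _) (imm_comp hMs hg hMi hgi) u hu

lemma fderiv_shift {Z : Type*} [NormedAddCommGroup Z] [NormedSpace ℝ Z] {f : ℝ × ℝ → Z} {K : Z} (h : ∀ x t, f (x + tp, t) = f (x, t) + K) (x t : ℝ) :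
    fderiv ℝ f (x + tp, t) = fderiv ℝ f (x, t) := by
  have h1 : (fun q : ℝ × ℝ => f (q + (tp, 0))) = fun q => f q + K := by
    funext q; simp only [Prod.add_def, add_zero]; exact h _ _
  have h2 := fderiv_comp_add_right (𝕜 := ℝ) (f := f) (x := (x, t)) (tp, 0)
  rw [h1, fderiv_add_const] at h2
  rw [h2]; simp

lemma ext_pos {f : ℝ × ℝ → ℝ} {K e : ℝ} (he : 0 < e) (sm : ∀ q : ℝ × ℝ, |q.2| < e → ContDiffAt ℝ ∞ f q)
    (per : ∀ x t, f (x + tp, t) = f (x, t) + K) {u : ℝ × ℝ} (h : ∀ x, 0 < fderiv ℝ f (x, 0) u) :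
    ∃ e' > 0, e' ≤ e ∧ ∀ q : ℝ × ℝ, |q.2| < e' → 0 < fderiv ℝ f q u := by
  obtain ⟨e', he', h'⟩ := unif' (V := ℝ) (R := fun q => 0 < fderiv ℝ f q u)
    (fun x t => by simp only [fderiv_shift per])
    (fun x => by
      have : ContinuousAt (fun q => fderiv ℝ f q u) (x, 0) :=
        (((sm (x, 0) (by simpa using he)).fderiv_right (m := 0) (by simp)).continuousAt).clm_apply continuousAt_const
      exact continuousAt_const.eventually_lt this (h x))
  exact ⟨min e e', by positivity, min_le_left _ _, fun q hq => h' q.1 q.2 (hq.trans_le (min_le_right _ _))⟩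

lemma ext_small {f : ℝ × ℝ → ℝ} {e : ℝ} (he : 0 < e) (hc : ∀ x, ContinuousAt f (x, 0))
    (per : ∀ x t, f (x + tp, t) = f (x, t)) (h0 : ∀ x, f (x, 0) = 0) :
    ∃ e' > 0, ∀ q : ℝ × ℝ, |q.2| < e' → |f q| < e := by
  obtain ⟨e', he', h'⟩ := unif' (V := ℝ) (R := fun q => |f q| < e)
    (fun x t => by simp only [per])
    (fun x => (hc x).abs.eventually_lt continuousAt_const (by simpa [h0] using he))
  exact ⟨e', he', fun q hq => h' q.1 q.2 hq⟩

lemma Adm.dif {D : Set ℂ} (ho : IsOpen D) {f : ℂ → ℂ} (A : Adm D f) (hb : BijOn f D (ball 0 1)) : Dif f D (ball 0 1) := by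
  refine ⟨hb, fun z hz => ?_, fun z hz u hu => ?_⟩
  · exact ((A.df.analyticAt (ho.mem_nhds hz)).contDiffAt (n := ∞)).restrict_scalars ℝ
  · have h1 : HasFDerivAt f _ z := (A.df.differentiableAt (ho.mem_nhds hz)).hasDerivAt.hasFDerivAt.restrictScalars ℝ
    rw [h1.fderiv] at hu
    simp at hu
    exact hu.resolve_right (A.dn z hz)

end Glu

namespace Glu
open Set Filter Topology Metric
open scoped ContDiff

lemma mono_t {τ : ℝ × ℝ → ℝ} {e : ℝ} (sm : ∀ q : ℝ × ℝ, |q.2| < e → ContDiffAt ℝ ∞ τ q)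
    (hd : ∀ q : ℝ × ℝ, |q.2| < e → 0 < fderiv ℝ τ q (0, 1)) (x : ℝ) :
    StrictMonoOn (fun t => τ (x, t)) (Ioo (-e) e) := by
  have h : ∀ t ∈ Ioo (-e) e, HasDerivAt (fun t => τ (x, t)) (fderiv ℝ τ (x, t) (0, 1)) t :=
    fun t ht => slice_t (q := (x, t)) (sm _ (abs_lt.2 ht))
  refine strictMonoOn_of_deriv_pos (convex_Ioo _ _)
    (fun t ht => (h t ht).continuousAt.continuousWithinAt) fun t ht => ?_
  rw [interior_Ioo] at ht
  rw [(h t ht).deriv]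
  exact hd _ (abs_lt.2 ht)

lemma mono_x {τ : ℝ × ℝ → ℝ} {e : ℝ} (sm : ∀ q : ℝ × ℝ, |q.2| < e → ContDiffAt ℝ ∞ τ q)
    (hd : ∀ q : ℝ × ℝ, |q.2| < e → 0 < fderiv ℝ τ q (1, 0)) {t : ℝ} (ht : |t| < e) :
    StrictMono (fun x => τ (x, t)) ∧ Continuous (fun x => τ (x, t)) := by
  have h : ∀ x, HasDerivAt (fun x => τ (x, t)) (fderiv ℝ τ (x, t) (1, 0)) x :=
    fun x => slice_x (q := (x, t)) (sm _ ht)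
  refine ⟨strictMono_of_deriv_pos fun x => ?_, continuous_iff_continuousAt.2 fun x => (h x).continuousAt⟩
  rw [(h x).deriv]; exact hd _ ht

lemma sig {τ1 τ2 : ℝ × ℝ → ℝ} {e0 K : ℝ} (he : 0 < e0)
    (sm1 : ∀ q : ℝ × ℝ, |q.2| < e0 → ContDiffAt ℝ ∞ τ1 q)
    (sm2 : ∀ q : ℝ × ℝ, |q.2| < e0 → ContDiffAt ℝ ∞ τ2 q)
    (per1 : ∀ x t, τ1 (x + tp, t) = τ1 (x, t) + K) (per2 : ∀ x t, τ2 (x + tp, t) = τ2 (x, t))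
    (h0 : ∀ x, τ2 (x, 0) = 0) (hd1 : ∀ x, 0 < fderiv ℝ τ1 (x, 0) (1, 0))
    (hd2 : ∀ q : ℝ × ℝ, |q.2| < e0 → 0 < fderiv ℝ τ2 q (0, 1)) :
    ∃ e > 0, ∃ σ X : ℝ × ℝ → ℝ, (∀ q : ℝ × ℝ, |q.2| < e → ContDiffAt ℝ ∞ X q) ∧
      (∀ x t, X (x + tp, t) = X (x, t) + K) ∧
      (∀ q : ℝ × ℝ, |q.2| < e → 0 < fderiv ℝ X q (1, 0)) ∧
      (∀ q : ℝ × ℝ, |q.2| < e → |σ q| < e0 ∧ τ2 (q.1, σ q) = q.2 ∧ X q = τ1 (q.1, σ q)) ∧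
      ∃ ε > 0, ε ≤ e0 ∧ ∀ q : ℝ × ℝ, |q.2| < ε → |τ2 q| < e ∧ X (q.1, τ2 q) = τ1 q := by
  have hz : ∀ x : ℝ, |((x, 0) : ℝ × ℝ).2| < e0 := fun x => by simpa using he
  have evs : ∀ x : ℝ, ∀ᶠ v in 𝓝 (((x, 0), 0) : (ℝ × ℝ) × ℝ), |v.2| < e0 := fun x => by
    have : ContinuousAt (fun v : (ℝ × ℝ) × ℝ => |v.2|) ((x, 0), 0) := by fun_prop
    exact this.eventually_lt_const (by simpa using he)
  have smv : ∀ v : (ℝ × ℝ) × ℝ, |v.2| < e0 →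
      ContDiffAt ℝ ∞ (fun v : (ℝ × ℝ) × ℝ => τ2 (v.1.1, v.2) - v.1.2) v := fun v hv =>
    ((sm2 (v.1.1, v.2) hv).comp v (f := fun v : (ℝ × ℝ) × ℝ => (v.1.1, v.2))
      (by fun_prop)).sub (by fun_prop)
  obtain ⟨δσ, hδσ, r, hr, σ, σs, σp, σ0, σe, -⟩ := pift (Y := ℝ) (Z := ℝ) rfl
    (Φ := fun v : (ℝ × ℝ) × ℝ => τ2 (v.1.1, v.2) - v.1.2)
    (by intro x t y; simp only [per2])
    (by intro x; filter_upwards [evs x] with v hv using smv v hv)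
    (by intro x; simp [h0])
    (by
      intro x y h
      have h1 : HasFDerivAt (fun v : (ℝ × ℝ) × ℝ => τ2 (v.1.1, v.2) - v.1.2) _ ((x, 0), 0) :=
        (HasFDerivAt.comp (g := τ2) (f := fun v : (ℝ × ℝ) × ℝ => (v.1.1, v.2)) ((x, 0), 0)
          ((sm2 (x, 0) (hz x)).differentiableAt (by simp)).hasFDerivAt
          ((hasFDerivAt_fst.fst).prodMk hasFDerivAt_snd)).sub (hasFDerivAt_fst.snd)
      rw [h1.fderiv] at h
      have h2 : fderiv ℝ τ2 (x, 0) (0, y) = 0 := by simpa using h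
      have h3 : ((0, y) : ℝ × ℝ) = y • ((0, 1) : ℝ × ℝ) := by simp
      rw [h3, map_smul] at h2
      rcases smul_eq_zero.1 h2 with h | h
      · exact h
      · exact absurd h (hd2 (x, 0) (hz x)).ne')
  obtain ⟨e4, he4, h4⟩ := ext_small (f := σ) he
    (fun x => (σs (x, 0) (by simpa using hδσ)).continuousAt) σp σ0
  have σfix : ∀ q : ℝ × ℝ, |q.2| < min e4 δσ → |σ q| < e0 ∧ τ2 (q.1, σ q) = q.2 := fun q hq =>
    ⟨h4 q (hq.trans_le (min_le_left _ _)), by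
      have := (σe q (hq.trans_le (min_le_right _ _))).1; simp only at this; linarith⟩
  have Xs : ∀ q : ℝ × ℝ, |q.2| < min e4 δσ → ContDiffAt ℝ ∞ (fun q : ℝ × ℝ => τ1 (q.1, σ q)) q :=
    fun q hq => (sm1 (q.1, σ q) (σfix q hq).1).comp q (f := fun q : ℝ × ℝ => (q.1, σ q))
      (contDiffAt_fst.prodMk (σs q (hq.trans_le (min_le_right _ _))))
  have Xp : ∀ x t, (fun q : ℝ × ℝ => τ1 (q.1, σ q)) (x + tp, t) =
      (fun q : ℝ × ℝ => τ1 (q.1, σ q)) (x, t) + K := fun x t => by simp only [σp, per1]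
  have hm : 0 < min e4 δσ := lt_min he4 hδσ
  obtain ⟨e, hep, hele, hepos⟩ := ext_pos (f := fun q : ℝ × ℝ => τ1 (q.1, σ q)) hm Xs Xp
    (u := (1, 0)) (by
      intro x
      have h1 := slice_x (q := (x, 0)) (Xs (x, 0) (by simpa using hm))
      have h2 := slice_x (q := (x, 0)) (sm1 (x, 0) (hz x))
      simp only [σ0] at h1 h2
      rw [h1.unique h2]; exact hd1 x)
  refine ⟨e, hep, σ, fun q => τ1 (q.1, σ q), fun q hq => Xs q (hq.trans_le hele), Xp, hepos,
    fun q hq => ⟨(σfix q (hq.trans_le hele)).1, (σfix q (hq.trans_le hele)).2, rfl⟩, ?_⟩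
  obtain ⟨ε, hε, h5⟩ := ext_small (f := τ2) hep (fun x => (sm2 (x, 0) (hz x)).continuousAt) per2 h0
  refine ⟨min ε e0, lt_min hε he, min_le_right _ _, fun q hq => ?_⟩
  have h6 := h5 q (hq.trans_le (min_le_left _ _))
  refine ⟨h6, ?_⟩
  have h7 := σfix (q.1, τ2 q) (h6.trans_le hele)
  have := (mono_t sm2 hd2 q.1).injOn (abs_lt.1 h7.1) (abs_lt.1 (hq.trans_le (min_le_right _ _))) h7.2
  simp only [this]

lemma ext_disc {τ1 τ2 : ℝ × ℝ → ℝ} {e0 : ℝ} {d : ℤ} (he : 0 < e0)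
    (sm1 : ∀ q : ℝ × ℝ, |q.2| < e0 → ContDiffAt ℝ ∞ τ1 q)
    (sm2 : ∀ q : ℝ × ℝ, |q.2| < e0 → ContDiffAt ℝ ∞ τ2 q)
    (per1 : ∀ x t, τ1 (x + tp, t) = τ1 (x, t) + d * tp) (per2 : ∀ x t, τ2 (x + tp, t) = τ2 (x, t))
    (h0 : ∀ x, τ2 (x, 0) = 0) (hd1 : ∀ x, 0 < fderiv ℝ τ1 (x, 0) (1, 0))
    (hd2 : ∀ q : ℝ × ℝ, |q.2| < e0 → 0 < fderiv ℝ τ2 q (0, 1))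
    (hinj : ∀ q q' : ℝ × ℝ, 0 < q.2 → q.2 < e0 → 0 < q'.2 → q'.2 < e0 →
      ex (τ1 q, τ2 q) = ex (τ1 q', τ2 q') → ∃ n : ℤ, q.1 = q'.1 + n * tp) :
    ∃ T : ℂ → ℂ, Dif T (ball 0 1) (ball 0 1) ∧ ∃ ε > 0, ∀ q : ℝ × ℝ, 0 < q.2 → q.2 < ε →
      T (ex q) = ex (τ1 q, τ2 q) := by
  obtain ⟨e, hep, σ, X, Xs, Xp, Xd, hσ, ε, hε, hεe, hX⟩ := sig he sm1 sm2 per1 per2 h0 hd1 hd2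
  have hdd : d = 1 := by
    have hy : |e/2| < e := by rw [abs_of_pos (by linarith)]; linarith
    obtain ⟨hm, hc⟩ := mono_x Xs Xd hy
    have h1 : X (0 + tp, e/2) = X (0, e/2) + d * tp := Xp 0 _
    rw [zero_add] at h1
    have h2 := hm tp_pos
    simp only [h1] at h2
    have h3 : 0 < d := by
      have : 0 < (d:ℝ) * tp := by linarith
      exact_mod_cast (pos_iff_pos_of_mul_pos this).2 tp_pos
    by_contra hne
    have h4 : (2:ℝ) ≤ d := by
      have : (2:ℤ) ≤ d := by omega
      exact_mod_cast this
    have htp := tp_pos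
    obtain ⟨x, hx, hxe⟩ := intermediate_value_Icc tp_pos.le hc.continuousOn
      (show X (0, e/2) + tp ∈ Icc (X (0, e/2)) (X (tp, e/2)) by
        rw [h1]; constructor <;> nlinarith)
    simp only at hxe
    have hs : ∀ x, 0 < σ (x, e/2) ∧ σ (x, e/2) < e0 := fun x => by
      obtain ⟨ha, hb, -⟩ := hσ (x, e/2) hy
      refine ⟨?_, (abs_lt.1 ha).2⟩
      by_contra hcon
      have := (mono_t sm2 hd2 x).monotoneOn (abs_lt.1 ha) (show (0:ℝ) ∈ Ioo (-e0) e0 by constructor <;> linarith)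
        (not_lt.1 hcon)
      simp only [h0] at this hb
      linarith
    obtain ⟨n, hn⟩ := hinj (x, σ (x, e/2)) (0, σ (0, e/2)) (hs x).1 (hs x).2 (hs 0).1 (hs 0).2 (by
      have ha := hσ (x, e/2) hy
      have hb := hσ (0, e/2) hy
      simp only at ha hb
      rw [ha.2.1, hb.2.1, ← ha.2.2, ← hb.2.2, hxe, ex_per])
    simp only [zero_add] at hn
    rw [hn] at hxe hx
    have hn0 : n = 0 ∨ n = 1 := by
      have a1 : 0 ≤ (n:ℝ) := by by_contra hh; nlinarith [hx.1]
      have a2 : (n:ℝ) ≤ 1 := by by_contra hh; nlinarith [hx.2]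
      have a1' : 0 ≤ n := by exact_mod_cast a1
      have a2' : n ≤ 1 := by exact_mod_cast a2
      omega
    rcases hn0 with rfl | rfl
    · simp only [Int.cast_zero, zero_mul] at hxe; linarith
    · simp only [Int.cast_one, one_mul] at hxe; rw [h1] at hxe; nlinarith
  subst hdd
  simp only [Int.cast_one, one_mul] at Xp
  obtain ⟨Y, κ, hκ, hYD, hYp, hY1, hY2⟩ := shearY he sm2 per2 h0 hd2
  obtain ⟨Z, hZD, hZp, hZ1, hZ2⟩ := shearX hep Xs Xp Xd
  have hM := hZD.comp hYD
  obtain ⟨T, hT, hTe⟩ := discT (κ := κ) (b := max e0 e) hM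
    (by intro x s; simp only [hYp, hZp])
    (by
      intro q hq
      have h1 := hY2 q ((le_max_left _ _).trans_lt hq)
      have h2 := hZ2 (q.1, q.2 + κ) (by have := (le_max_right e0 e).trans_lt hq; simp only; linarith)
      simp only [h1, h2])
  refine ⟨T, hT, ?_⟩
  obtain ⟨ε', hε', h5⟩ := ext_small (f := τ2) (e := e/4) (by positivity)
    (fun x => (sm2 (x, 0) (by simpa using he)).continuousAt) per2 h0
  refine ⟨min (min ε ε') (e0/4), by positivity, fun q h1 h2 => ?_⟩
  rw [hTe q h1]
  simp only [lt_min_iff] at h2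
  have ha : |q.2| = q.2 := abs_of_pos h1
  rw [hY1 q h2.2, hZ1 (q.1, τ2 q) (abs_lt.1 (h5 q (by rw [ha]; exact h2.1.2))).2,
    (hX q (by rw [ha]; exact h2.1.1)).2]

end Glu

namespace Glu
open Set Filter Topology Metric
open scoped ContDiff

lemma ex_eq (z : ℂ) : ex (z.re, z.im) = Complex.exp (Complex.I * z) := by
  simp only [ex, Complex.re_add_im]

lemma Kp.disc {D : Set ℂ} {c : ℝ × ℝ → ℂ} {δ : ℝ} {p : ℂ → ℂ} {k : ℝ × ℝ → ℂ} {η : ℝ}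
    (P : Kp D c δ p k η) (ho : ∀ x, (fderiv ℝ k (x, 0) (0, 1)).im < 0) :
    ∃ Φ : ℂ → ℂ, Dif Φ (ball 0 1) D ∧ ∃ ε > 0, ∀ q : ℝ × ℝ, -ε < q.2 → q.2 < 0 →
      Φ (ex (q.1, -q.2)) = c q := by
  have hδ := P.C.pos
  have hη := P.pos
  obtain ⟨φ, A, hb⟩ := rmt P.C.opn P.C.bounded P.C.preconn
    (P.C.mem_of (q := (0, -δ/2)) (by simp only; linarith) (by simp only; linarith))
    (fun g hg h0 => P.C.hasLog hg h0)
  obtain ⟨s1, hs1, Λ, d, hΛ, Λp, Λr, hlam⟩ := P.exists_lam ho A hb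
  have hop := hopf hs1 hΛ Λp Λr (by
    intro w hw
    have h1 := A.mp _ (hlam w hw).1
    rw [← (hlam w hw).2, ← ex_eq, ex_norm, Real.exp_lt_one_iff] at h1
    simpa using h1)
  obtain ⟨e1, he1, he1η, hsgn⟩ := P.sgn ho
  obtain ⟨e2, he2, hk2⟩ := ext_small (f := fun q => (k q).im) hs1
    (fun x => Complex.continuous_im.continuousAt.comp (P.ks (x, 0) (by simpa using hη)).continuousAt)
    (by intro x t; rw [P.kp, Complex.add_im, Complex.ofReal_im, add_zero])
    (by intro x; rw [P.k0, Complex.ofReal_im])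
  set e := min e1 e2 with hedef
  have hep : 0 < e := lt_min he1 he2
  have hmem : ∀ t : ℝ × ℝ, |t.2| < e → k t ∈ ust (-s1) s1 := fun t ht =>
    abs_lt.1 (hk2 t (ht.trans_le (min_le_right _ _)))
  set τ : ℝ × ℝ → ℂ := fun q => Λ (k (q.1, -q.2)) with hτ
  have Λs : ∀ w ∈ ust (-s1) s1, ContDiffAt ℝ ∞ Λ w := fun w hw =>
    ((hΛ.analyticAt ((ust_open _ _).mem_nhds hw)).contDiffAt (n := ∞)).restrict_scalars ℝ
  have hle : e ≤ η := (min_le_left _ _).trans he1η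
  have ks' : ∀ q : ℝ × ℝ, |q.2| < e → ContDiffAt ℝ ∞ (fun q : ℝ × ℝ => k (q.1, -q.2)) q := fun q hq =>
    (P.ks (q.1, -q.2) (by simpa using hq.trans_le hle)).comp q (f := fun q : ℝ × ℝ => (q.1, -q.2))
      (by fun_prop)
  have hmem' : ∀ q : ℝ × ℝ, |q.2| < e → k (q.1, -q.2) ∈ ust (-s1) s1 := fun q hq =>
    hmem (q.1, -q.2) (by simpa using hq)
  have τs : ∀ q : ℝ × ℝ, |q.2| < e → ContDiffAt ℝ ∞ τ q := fun q hq =>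
    (Λs _ (hmem' q hq)).comp q (ks' q hq)
  have z0 : ∀ x : ℝ, |((x, 0) : ℝ × ℝ).2| < e := fun x => by simpa using hep
  have τd : ∀ x : ℝ, ∀ u : ℝ × ℝ, fderiv ℝ τ (x, 0) u = deriv Λ x * fderiv ℝ k (x, 0) (u.1, -u.2) := by
    intro x u
    have h1 : HasFDerivAt (fun q : ℝ × ℝ => (q.1, -q.2)) _ (x, 0) :=
      (hasFDerivAt_fst (𝕜 := ℝ) (E := ℝ) (F := ℝ)).prodMk hasFDerivAt_snd.neg
    have h2 : HasFDerivAt k (fderiv ℝ k (x, 0)) ((fun q : ℝ × ℝ => (q.1, -q.2)) (x, 0)) := by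
      simp only [neg_zero]
      exact ((P.ks (x, 0) (by simpa using hη)).differentiableAt (by simp)).hasFDerivAt
    have h3 : HasDerivAt Λ (deriv Λ x) (k (x, -0)) := by
      rw [neg_zero, P.k0]
      have := hmem' (x, 0) (z0 x)
      simp only [neg_zero, P.k0] at this
      exact ((hΛ _ this).differentiableAt ((ust_open _ _).mem_nhds this)).hasDerivAt
    have h4 : HasFDerivAt τ _ (x, 0) := (h3.hasFDerivAt.restrictScalars ℝ).comp
      (f := fun q : ℝ × ℝ => k (q.1, -q.2)) (x, 0) (h2.comp (x, 0) h1)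
    rw [h4.fderiv]
    simp [mul_comm]
  have re_fd : ∀ q : ℝ × ℝ, |q.2| < e → ∀ u, fderiv ℝ (fun q => (τ q).re) q u = (fderiv ℝ τ q u).re := by
    intro q hq u
    have : HasFDerivAt (fun q => (τ q).re) _ q := Complex.reCLM.hasFDerivAt.comp q
      ((τs q hq).differentiableAt (by simp)).hasFDerivAt
    rw [this.fderiv]; rfl
  have im_fd : ∀ q : ℝ × ℝ, |q.2| < e → ∀ u, fderiv ℝ (fun q => (τ q).im) q u = (fderiv ℝ τ q u).im := by
    intro q hq u
    have : HasFDerivAt (fun q => (τ q).im) _ q := Complex.imCLM.hasFDerivAt.comp q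
      ((τs q hq).differentiableAt (by simp)).hasFDerivAt
    rw [this.fderiv]; rfl
  have sm1 : ∀ q : ℝ × ℝ, |q.2| < e → ContDiffAt ℝ ∞ (fun q => (τ q).re) q := fun q hq =>
    Complex.reCLM.contDiff.contDiffAt.comp q (τs q hq)
  have sm2 : ∀ q : ℝ × ℝ, |q.2| < e → ContDiffAt ℝ ∞ (fun q => (τ q).im) q := fun q hq =>
    Complex.imCLM.contDiff.contDiffAt.comp q (τs q hq)
  have τp : ∀ x t, τ (x + tp, t) = τ (x, t) + d * tp := fun x t => by
    simp only [hτ, P.kp, Λp]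
  have per1 : ∀ x t, (fun q => (τ q).re) (x + tp, t) = (fun q => (τ q).re) (x, t) + d * tp := fun x t => by
    simp only [τp]; simp [Complex.add_re, Complex.mul_re]
  have per2 : ∀ x t, (fun q => (τ q).im) (x + tp, t) = (fun q => (τ q).im) (x, t) := fun x t => by
    simp only [τp]; simp [Complex.add_im, Complex.mul_im]
  obtain ⟨e', he', hle', hd2⟩ := ext_pos (K := 0) (u := (0, 1)) hep sm2 (by simpa using per2) (by
    intro x
    rw [im_fd _ (z0 x), τd]
    have h1 : ((0, -1) : ℝ × ℝ) = -(0, 1) := by simp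
    simp only [h1, map_neg]
    obtain ⟨h2, h3⟩ := hop x
    simp only [Complex.mul_im, Complex.neg_im, Complex.neg_re, h2]
    nlinarith [ho x])
  have key : ∀ q : ℝ × ℝ, 0 < q.2 → q.2 < e' → c (q.1, -q.2) ∈ D ∧
      ex ((τ q).re, (τ q).im) = φ (c (q.1, -q.2)) := by
    intro q h1 h2
    have hq : |q.2| < e := by rw [abs_of_pos h1]; linarith
    have hq1 : |-q.2| < e1 := by rw [abs_neg]; exact hq.trans_le (min_le_left _ _)
    have hw : k (q.1, -q.2) ∈ ust 0 s1 := ⟨(hsgn q.1 (-q.2) hq1).2 (by linarith), (hmem' q hq).2⟩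
    have h3 := hlam _ hw
    rw [P.kc _ (by simpa using hq.trans_le hle)] at h3
    exact ⟨h3.1, by rw [ex_eq, h3.2]⟩
  have hδ' : ∀ q : ℝ × ℝ, 0 < q.2 → q.2 < e' → |((q.1, -q.2) : ℝ × ℝ).2| < δ := fun q h1 h2 => by
    simp only [abs_neg, abs_of_pos h1]; linarith [P.le]
  obtain ⟨T, hT, ε, hε, hTe⟩ := ext_disc (d := d) he' (fun q hq => sm1 q (hq.trans_le hle'))
    (fun q hq => sm2 q (hq.trans_le hle')) per1 per2
    (by intro x; simp only [hτ, neg_zero, P.k0, Λr])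
    (by
      intro x
      rw [re_fd _ (z0 x), τd]
      simp only [neg_zero, P.dx, mul_one]
      exact (hop x).2)
    hd2
    (by
      intro q q' h1 h2 h3 h4 h
      obtain ⟨a1, a2⟩ := key q h1 h2
      obtain ⟨b1, b2⟩ := key q' h3 h4
      simp only [a2, b2] at h
      exact (P.C.inj _ _ (hδ' q h1 h2) (hδ' q' h3 h4) (A.nj a1 b1 h)).2)
  have hφ := A.dif P.C.opn hb
  refine ⟨fun z => Function.invFunOn φ D (T z), (hφ.inv P.C.opn rfl).comp hT, min ε e',
    lt_min hε he', fun q h1 h2 => ?_⟩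
  have h3 : -q.2 < ε := by have := min_le_left ε e'; linarith
  have h4 : -q.2 < e' := by have := min_le_right ε e'; linarith
  have h5 := hTe (q.1, -q.2) (by simp only; linarith) h3
  have h6 := key (q.1, -q.2) (by simp only; linarith) h4
  simp only [neg_neg] at h6
  simp only [h5, h6.2]
  exact hφ.bij.injOn.leftInvOn_invFunOn h6.1

lemma ex_conj (x s : ℝ) : ex (-x, s) = (starRingEnd ℂ) (ex (x, s)) := by
  simp only [ex, ← Complex.exp_conj]
  congr 1
  simp only [map_mul, map_add, Complex.conj_I, Complex.conj_ofReal, Complex.ofReal_neg]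
  ring

lemma conj_dif : Dif (starRingEnd ℂ) (ball 0 1) (ball 0 1) where
  bij := by
    refine ⟨fun z hz => by simpa using hz, (starRingEnd ℂ).injective.injOn, fun z hz =>
      ⟨(starRingEnd ℂ) z, by simpa using hz, by simp⟩⟩
  sm := fun x _ => Complex.conjCLE.contDiff.contDiffAt
  imm := fun x _ u h => by
    have : fderiv ℝ (starRingEnd ℂ) x = Complex.conjCLE :=
      (Complex.conjCLE : ℂ →L[ℝ] ℂ).hasFDerivAt.fderiv
    rw [this] at h
    simpa using h

lemma Collar.disc {D : Set ℂ} {c : ℝ × ℝ → ℂ} {δ : ℝ} (C : Collar D c δ) :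
    ∃ Φ : ℂ → ℂ, Dif Φ (ball 0 1) D ∧ ∃ ε > 0, ∀ q : ℝ × ℝ, -ε < q.2 → q.2 < 0 →
      Φ (ex (q.1, -q.2)) = c q := by
  obtain ⟨Q, p, hQ, hp, pp, h0⟩ := C.toAnalytic
  obtain ⟨k, η, P⟩ := Kp.exists_kp (C.transport hQ) hp pp h0
  have main : ∃ Φ : ℂ → ℂ, Dif Φ (ball 0 1) (Q '' D) ∧ ∃ ε > 0, ∀ q : ℝ × ℝ, -ε < q.2 → q.2 < 0 →
      Φ (ex (q.1, -q.2)) = Q (c q) := by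
    rcases P.orient with ho | ho
    · exact P.disc ho
    · obtain ⟨Φ, hΦ, ε, hε, h⟩ := P.flip.disc (by
        intro x; rw [P.flip_dt, Complex.neg_im]; linarith [ho (-x)])
      refine ⟨fun z => Φ ((starRingEnd ℂ) z), hΦ.comp conj_dif, ε, hε, fun q h1 h2 => ?_⟩
      have := h (-q.1, q.2) h1 h2
      simp only [neg_neg] at this
      simp only [← ex_conj]; exact this
  obtain ⟨Φ, hΦ, ε, hε, h⟩ := main
  have hQD : Dif Q D (Q '' D) :=
    ⟨hQ.bij.injective.injOn.bijOn_image, fun x _ => hQ.sm.contDiffAt, fun x _ => hQ.imm x⟩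
  refine ⟨_, (hQD.inv C.opn rfl).comp hΦ, min ε δ, lt_min hε C.pos, fun q h1 h2 => ?_⟩
  have := min_le_left ε δ
  have := min_le_right ε δ
  rw [h q (by linarith) h2]
  exact hQD.bij.injOn.leftInvOn_invFunOn (C.mem_of (by linarith) h2)

lemma Collar.pair {D D' : Set ℂ} {c c' : ℝ × ℝ → ℂ} {δ δ' : ℝ} (C : Collar D c δ) (C' : Collar D' c' δ') :
    ∃ Ψ : ℂ → ℂ, Dif Ψ D' D ∧ ∃ ε > 0, ∀ q : ℝ × ℝ, -ε < q.2 → q.2 < 0 → Ψ (c' q) = c q := by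
  obtain ⟨Φ, hΦ, ε, hε, h⟩ := C.disc
  obtain ⟨Φ', hΦ', ε', hε', h'⟩ := C'.disc
  refine ⟨_, hΦ.comp (hΦ'.inv isOpen_ball rfl), min ε ε', lt_min hε hε', fun q h1 h2 => ?_⟩
  have := min_le_left ε ε'
  have := min_le_right ε ε'
  rw [← h q (by linarith) h2, ← h' q (by linarith) h2]
  congr 1
  exact hΦ'.bij.injOn.leftInvOn_invFunOn (ex_HP.2 (by simp only; linarith))

end Glu

namespace Glu
open Set Filter Topology Metric
open scoped ContDiff

lemma flow {v : ℂ → ℂ} {K : NNReal} (hK : LipschitzWith K v) {B : NNReal} (hB : ∀ z, ‖v z‖ ≤ B) (z : ℂ) :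
    ∃ γ : ℝ → ℂ, γ 0 = z ∧ ∀ t, HasDerivAt γ (v (γ t)) t := by
  have h1 : ∀ n : ℕ, ∃ α : ℝ → ℂ, α 0 = z ∧ ∀ t ∈ Ioo (-(n:ℝ) - 1) (n + 1), HasDerivAt α (v (α t)) t := by
    intro n
    have hn : (0:ℝ) ≤ n := n.cast_nonneg
    have hP : IsPicardLindelof (fun _ => v) (tmin := -(n:ℝ) - 1) (tmax := n + 1)
        ⟨0, by constructor <;> linarith⟩ z (B * (n + 1)) 0 B K := by
      refine ⟨fun t _ => hK.lipschitzOnWith, fun x _ => continuousOn_const, fun t _ x _ => hB x, ?_⟩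
      simp only [sub_zero, zero_sub, neg_sub, sub_neg_eq_add]
      rw [add_comm (1:ℝ), max_self]
      simp
    obtain ⟨α, h0, h⟩ := hP.exists_eq_forall_mem_Icc_hasDerivWithinAt₀
    exact ⟨α, h0, fun t ht => (h t ⟨ht.1.le, ht.2.le⟩).hasDerivAt (Icc_mem_nhds ht.1 ht.2)⟩
  choose α h0 hα using h1
  have agree : ∀ n m : ℕ, n ≤ m → EqOn (α n) (α m) (Ioo (-(n:ℝ) - 1) (n + 1)) := by
    intro n m hnm
    have hn : (0:ℝ) ≤ n := n.cast_nonneg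
    have hm : (n:ℝ) ≤ m := by exact_mod_cast hnm
    refine ODE_solution_unique_of_mem_Ioo (v := fun _ => v) (s := fun _ => univ) (t₀ := 0) (K := K)
      (fun _ _ => hK.lipschitzOnWith) (by constructor <;> linarith) (fun t ht => ⟨hα n t ht, trivial⟩)
      (fun t ht => ⟨hα m t ⟨by linarith [ht.1], by linarith [ht.2]⟩, trivial⟩) (by rw [h0, h0])
  refine ⟨fun t => α ⌈|t|⌉₊ t, h0 _, fun t => ?_⟩
  have hmem : ∀ (s : ℝ) (n : ℕ), |s| < n + 1 → s ∈ Ioo (-(n:ℝ) - 1) (n + 1) := fun s n h => by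
    rw [abs_lt] at h; constructor <;> linarith [h.1, h.2]
  have hle : ∀ s : ℝ, |s| < (⌈|s|⌉₊ : ℝ) + 1 := fun s => by linarith [Nat.le_ceil |s|]
  set n := ⌈|t|⌉₊ with hn
  have h2 := hα n t (hmem t n (hle t))
  refine HasDerivAt.congr_of_eventuallyEq h2 ?_
  have : ∀ᶠ s in 𝓝 t, |s| < (n:ℝ) + 1 := continuous_abs.continuousAt.eventually_lt_const (hle t)
  filter_upwards [this] with s hs
  rcases le_total ⌈|s|⌉₊ n with h | h
  · exact agree _ _ h (hmem s _ (hle s))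
  · exact (agree _ _ h (hmem s _ hs)).symm

lemma ode_smooth {v : ℂ → ℂ} (hv : ContDiff ℝ ∞ v) {γ : ℝ → ℂ} (h : ∀ t, HasDerivAt γ (v (γ t)) t) :
    ContDiff ℝ ∞ γ := by
  have hd : deriv γ = fun t => v (γ t) := funext fun t => (h t).deriv
  rw [contDiff_infty]
  intro n
  induction n with
  | zero => exact contDiff_zero.2 (continuous_iff_continuousAt.2 fun t => (h t).continuousAt)
  | succ n ih =>
    push_cast
    rw [contDiff_succ_iff_deriv]
    refine ⟨fun t => (h t).differentiableAt, by simp, ?_⟩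
    rw [hd]
    exact (hv.of_le (by exact_mod_cast le_top)).comp ih

lemma cdecomp (u : ℂ) : u = u.re • (1:ℂ) + u.im • Complex.I := by
  simp [Complex.re_add_im]

lemma clm_dec (ℓ : ℂ →L[ℝ] ℝ) (u : ℂ) : ℓ u = u.re * ℓ 1 + u.im * ℓ Complex.I := by
  have := congrArg ℓ (cdecomp u)
  rw [map_add, map_smul, map_smul] at this
  exact this

lemma ker_line {ℓ : ℂ →L[ℝ] ℝ} (hl : ℓ ≠ 0) {w : ℂ} (hw : w ≠ 0) (h : ℓ w = 0) {u : ℂ} (hu : ℓ u = 0) :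
    ∃ s : ℝ, u = s • w := by
  rw [clm_dec] at h hu
  have hdet : u.re * w.im - u.im * w.re = 0 := by
    by_contra hne
    apply hl
    have a1 : (u.re * w.im - u.im * w.re) * ℓ 1 = 0 := by linear_combination w.im * hu - u.im * h
    have a2 : (u.re * w.im - u.im * w.re) * ℓ Complex.I = 0 := by linear_combination u.re * h - w.re * hu
    have a1' := (mul_eq_zero.1 a1).resolve_left hne
    have a2' := (mul_eq_zero.1 a2).resolve_left hne
    refine ContinuousLinearMap.ext fun x => ?_
    rw [clm_dec, a1', a2']; simp
  have hn : w.re * w.re + w.im * w.im ≠ 0 := by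
    intro h0
    apply hw
    apply Complex.ext <;> simp <;> nlinarith [mul_self_nonneg w.re, mul_self_nonneg w.im]
  refine ⟨(u.re * w.re + u.im * w.im) / (w.re * w.re + w.im * w.im), ?_⟩
  apply Complex.ext
  · rw [Complex.smul_re, smul_eq_mul, div_mul_eq_mul_div, eq_div_iff hn]; linear_combination w.im * hdet
  · rw [Complex.smul_im, smul_eq_mul, div_mul_eq_mul_div, eq_div_iff hn]; linear_combination -w.re * hdet

lemma level_open {h : ℂ → ℝ} (hs : ContDiff ℝ ∞ h) {a : ℝ} {γ : ℝ → ℂ} (hγ : ContDiff ℝ ∞ γ)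
    (hC : ∀ t, h (γ t) = a) {t0 : ℝ} (hd : deriv γ t0 ≠ 0) (hr : fderiv ℝ h (γ t0) ≠ 0)
    {N : Set ℝ} (hN : N ∈ 𝓝 t0) : ∀ᶠ z in 𝓝 (γ t0), h z = a → z ∈ γ '' N := by
  set w := deriv γ t0 with hw
  have hγd : ∀ t, HasDerivAt γ (deriv γ t) t := fun t => (hγ.differentiable (by simp) t).hasDerivAt
  have hhd : HasFDerivAt h (fderiv ℝ h (γ t0)) (γ t0) := (hs.differentiable (by simp) _).hasFDerivAt
  have hker : fderiv ℝ h (γ t0) w = 0 := by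
    have h1 := hhd.comp_hasDerivAt t0 (hγd t0)
    have h2 : h ∘ γ = fun _ => a := funext hC
    rw [h2] at h1
    exact h1.unique (hasDerivAt_const _ _)
  let ip : ℂ →L[ℝ] ℝ := w.re • Complex.reCLM + w.im • Complex.imCLM
  have hipw : ip w ≠ 0 := by
    intro h0
    apply hd
    have : w.re * w.re + w.im * w.im = 0 := by simpa [ip] using h0
    apply Complex.ext <;> simp <;> nlinarith [mul_self_nonneg w.re, mul_self_nonneg w.im]
  have hG : HasFDerivAt (fun z => (h z, ip z)) ((fderiv ℝ h (γ t0)).prod ip) (γ t0) :=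
    hhd.prodMk ip.hasFDerivAt
  obtain ⟨-, ⟨U, hU, hinj⟩, -⟩ := exists_localInv (f := fun z => (h z, ip z)) (a := γ t0) Collar.fd.symm
    (hs.contDiffAt.prodMk ip.contDiff.contDiffAt) (by
      intro u hu
      rw [hG.fderiv] at hu
      simp only [ContinuousLinearMap.prod_apply, Prod.mk_eq_zero] at hu
      obtain ⟨s, rfl⟩ := ker_line hr hd hker hu.1
      have hu2 := hu.2
      rw [map_smul] at hu2
      rcases smul_eq_zero.1 hu2 with h | h
      · simp [h]
      · exact absurd h hipw)
  have hm : map (fun t => ip (γ t)) (𝓝 t0) = 𝓝 (ip (γ t0)) := by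
    have h1 : HasStrictDerivAt γ w t0 := hγ.contDiffAt.hasStrictDerivAt (by simp)
    exact (ip.hasStrictFDerivAt.comp_hasStrictDerivAt t0 h1).map_nhds_eq hipw
  have hev : N ∩ γ ⁻¹' U ∈ 𝓝 t0 := inter_mem hN (hγ.continuous.continuousAt hU)
  have him : (fun t => ip (γ t)) '' (N ∩ γ ⁻¹' U) ∈ 𝓝 (ip (γ t0)) := by rw [← hm]; exact image_mem_map hev
  filter_upwards [hU, ip.continuous.continuousAt him] with z hz hz' hza
  obtain ⟨t, ⟨ht1, ht2⟩, ht3⟩ := hz'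
  refine ⟨t, ht1, hinj ht2 hz (Prod.ext ?_ ht3)⟩
  simp only [hC, hza]

lemma level_circle {h : ℂ → ℝ} (hs : ContDiff ℝ ∞ h) (hc : HasCompactSupport h) {a : ℝ} (ha : a ≠ 0)
    (hr : ∀ z, h z = a → fderiv ℝ h z ≠ 0) (hne : {z | h z = a}.Nonempty) (hcon : IsPreconnected {z | h z = a}) :
    ∃ γ : ℝ → ℂ, ContDiff ℝ ∞ γ ∧ (∀ x, γ (x + tp) = γ x) ∧ (∀ x, deriv γ x ≠ 0) ∧
      (∀ x y, γ x = γ y → ∃ n : ℤ, x = y + n * tp) ∧ range γ = {z | h z = a} := by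
  set C := {z | h z = a} with hCdef
  have hCcl : IsClosed C := isClosed_eq hs.continuous continuous_const
  have hCc : IsCompact C := hc.isCompact.of_isClosed_subset hCcl fun z hz => by
    apply subset_tsupport; simp only [Function.mem_support]; rw [show h z = a from hz]; exact ha
  let v : ℂ → ℂ := fun z => -(fderiv ℝ h z Complex.I : ℂ) + (fderiv ℝ h z 1 : ℂ) * Complex.I
  have hfs : ContDiff ℝ ∞ (fderiv ℝ h) := hs.fderiv_right (m := ∞) (by simp)
  have hvs : ContDiff ℝ ∞ v :=
    (Complex.ofRealCLM.contDiff.comp (hfs.clm_apply contDiff_const)).neg.add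
      ((Complex.ofRealCLM.contDiff.comp (hfs.clm_apply contDiff_const)).mul contDiff_const)
  have hvc : HasCompactSupport v := by
    refine (hc.fderiv ℝ).mono' fun z hz => ?_
    apply subset_tsupport
    intro h0
    apply hz
    simp only [v]; rw [h0]; simp
  obtain ⟨K, hK⟩ := hvs.lipschitzWith_of_hasCompactSupport hvc (by simp)
  obtain ⟨B, hB⟩ := hvc.exists_bound_of_continuous hvs.continuous
  have hB' : ∀ z, ‖v z‖ ≤ (B.toNNReal : ℝ) := fun z => (hB z).trans (Real.le_coe_toNNReal _)
  have hv0 : ∀ z, fderiv ℝ h z (v z) = 0 := by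
    intro z
    have : v z = (-(fderiv ℝ h z Complex.I)) • (1:ℂ) + (fderiv ℝ h z 1) • Complex.I := by simp [v]
    rw [this, map_add, map_smul, map_smul]; simp only [smul_eq_mul]; ring
  have hvne : ∀ z ∈ C, v z ≠ 0 := by
    intro z hz h0
    apply hr z hz
    have h1 := congrArg Complex.re h0
    have h2 := congrArg Complex.im h0
    simp [v] at h1 h2
    refine ContinuousLinearMap.ext fun x => ?_
    rw [clm_dec, h1, h2]; simp
  have curve : ∀ z ∈ C, ∃ γ : ℝ → ℂ, γ 0 = z ∧ (∀ t, HasDerivAt γ (v (γ t)) t) ∧ ∀ t, γ t ∈ C := by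
    intro z hz
    obtain ⟨γ, h0, hγ⟩ := flow hK hB' z
    refine ⟨γ, h0, hγ, fun t => ?_⟩
    have hd : ∀ t, HasDerivAt (fun t => h (γ t)) 0 t := fun t => by
      have := ((hs.differentiable (by simp) (γ t)).hasFDerivAt).comp_hasDerivAt t (hγ t)
      rw [hv0] at this; exact this
    have := is_const_of_deriv_eq_zero (fun t => (hd t).differentiableAt) (fun t => (hd t).deriv) t 0
    simp only [h0] at this
    exact this.trans hz
  have uniq : ∀ {γ γ' : ℝ → ℂ}, (∀ t, HasDerivAt γ (v (γ t)) t) → (∀ t, HasDerivAt γ' (v (γ' t)) t) →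
      ∀ {s s' : ℝ}, γ s = γ' s' → ∀ t, γ (s + t) = γ' (s' + t) := by
    intro γ γ' hγ hγ' s s' he t
    have := ODE_solution_unique_univ (v := fun _ => v) (s := fun _ => univ) (t₀ := 0) (K := K)
      (f := fun t => γ (s + t)) (g := fun t => γ' (s' + t)) (fun _ => hK.lipschitzOnWith)
      (fun t => ⟨(hγ (s + t)).comp_const_add s t, trivial⟩)
      (fun t => ⟨(hγ' (s' + t)).comp_const_add s' t, trivial⟩) (by simpa using he)
    exact congrFun this t
  have opn : ∀ {γ : ℝ → ℂ}, (∀ t, HasDerivAt γ (v (γ t)) t) → (∀ t, γ t ∈ C) → ∀ t0, ∀ N ∈ 𝓝 t0,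
      ∀ᶠ z in 𝓝 (γ t0), h z = a → z ∈ γ '' N := fun hγ hC t0 N hN =>
    level_open hs (ode_smooth hvs hγ) hC (by rw [(hγ t0).deriv]; exact hvne _ (hC t0)) (hr _ (hC t0)) hN
  obtain ⟨z0, hz0⟩ := hne
  obtain ⟨γ, h0, hγ, hγC⟩ := curve z0 hz0
  have hγs := ode_smooth hvs hγ
  have hsurj : ∀ z ∈ C, z ∈ range γ := by
    haveI : PreconnectedSpace C := isPreconnected_iff_preconnectedSpace.1 hcon
    have hcl : IsClopen {z : C | (z:ℂ) ∈ range γ} := by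
      constructor
      · rw [← isOpen_compl_iff, isOpen_iff_mem_nhds]
        intro z hz
        obtain ⟨γ', h0', hγ', hγC'⟩ := curve z z.2
        have h1 := opn hγ' hγC' 0 univ univ_mem
        rw [h0'] at h1
        filter_upwards [continuous_subtype_val.continuousAt.eventually h1] with w hw
        rintro ⟨t, ht⟩
        obtain ⟨t', -, ht'⟩ := hw w.2
        apply hz
        refine ⟨t - t', ?_⟩
        have := uniq hγ hγ' (s := t) (s' := t') (ht.trans ht'.symm) (-t')
        rw [← sub_eq_add_neg, add_neg_cancel, h0'] at this
        exact this
      · rw [isOpen_iff_mem_nhds]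
        rintro z ⟨t, ht⟩
        have h1 := opn hγ hγC t univ univ_mem
        rw [ht] at h1
        filter_upwards [continuous_subtype_val.continuousAt.eventually h1] with w hw
        obtain ⟨t', -, ht'⟩ := hw w.2
        exact ⟨t', ht'⟩
    have := hcl.eq_univ ⟨⟨z0, hz0⟩, 0, h0⟩
    intro z hz
    have h1 : (⟨z, hz⟩ : C) ∈ {z : C | (z:ℂ) ∈ range γ} := by rw [this]; trivial
    exact h1

  obtain ⟨n, hn⟩ := hCc.elim_directed_cover (fun n : ℕ => interior {z | h z = a → z ∈ γ '' Ioo (-(n:ℝ)) n})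
    (fun n => isOpen_interior) (by
      intro z hz
      obtain ⟨t, rfl⟩ := hsurj z hz
      obtain ⟨n, hn⟩ := exists_nat_gt |t|
      exact mem_iUnion.2 ⟨n, mem_interior_iff_mem_nhds.2
        (opn hγ hγC t _ (Ioo_mem_nhds (abs_lt.1 hn).1 (abs_lt.1 hn).2))⟩)
    (by
      refine directed_of_isDirected_le fun n m hnm => interior_mono fun z hz hza => ?_
      have hm : (n:ℝ) ≤ m := by exact_mod_cast hnm
      exact image_mono (Ioo_subset_Ioo (by linarith) hm) (hz hza))
  obtain ⟨s, hs1, hs2⟩ := interior_subset (hn (hγC n)) (hγC n)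
  have hper : ∀ {s s'}, γ s = γ s' → ∀ t, γ (s + t) = γ (s' + t) := fun h => uniq hγ hγ h
  let G : AddSubgroup ℝ :=
    { carrier := {T | γ T = γ 0}
      zero_mem' := rfl
      add_mem' := by
        intro T T' h1 h2
        have := hper (show γ T = γ 0 from h1) T'
        rw [zero_add] at this
        exact this.trans h2
      neg_mem' := by
        intro T h1
        have := hper (show γ T = γ 0 from h1) (-T)
        rw [zero_add, add_neg_cancel] at this
        exact this.symm }
  have hGcl : IsClosed (G : Set ℝ) := isClosed_eq hγs.continuous continuous_const
  have hGT : (n:ℝ) - s ∈ G := by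
    have := hper hs2.symm (-s)
    rw [add_neg_cancel, ← sub_eq_add_neg] at this
    exact this
  rcases G.dense_or_cyclic with hd | ⟨T, hT⟩
  · exfalso
    have h1 : ∀ t, γ t = γ 0 := fun t => by
      have : t ∈ closure (G : Set ℝ) := hd t
      rw [hGcl.closure_eq] at this; exact this
    have h2 : γ = fun _ => γ 0 := funext h1
    have h3 := (hγ 0).deriv
    rw [h2] at h3
    simp at h3
    exact hvne _ (hγC 0) h3.symm
  · have hmemG : ∀ t, γ t = γ 0 ↔ ∃ k : ℤ, k • T = t := fun t => by
      have h1 : t ∈ G ↔ ∃ k : ℤ, k • T = t := by rw [hT]; exact AddSubgroup.mem_closure_singleton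
      exact h1
    have hT0 : T ≠ 0 := by
      rintro rfl
      obtain ⟨k, hk⟩ := (hmemG _).1 hGT
      simp at hk
      linarith [hs1.2]
    have hrep : ∀ x y, γ x = γ y ↔ ∃ k : ℤ, x = y + k * T := by
      intro x y
      constructor
      · intro hxy
        have := hper hxy (-y)
        rw [add_neg_cancel] at this
        obtain ⟨k, hk⟩ := (hmemG _).1 this
        exact ⟨k, by rw [zsmul_eq_mul] at hk; linarith⟩
      · rintro ⟨k, rfl⟩
        have := hper ((hmemG (k * T)).2 ⟨k, by rw [zsmul_eq_mul]⟩) y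
        rwa [zero_add, add_comm] at this
    have htp := tp_pos.ne'
    refine ⟨fun x => γ (T / tp * x), hγs.comp (contDiff_const.mul contDiff_id), fun x => ?_, fun x => ?_,
      fun x y hxy => ?_, ?_⟩
    · refine (hrep _ _).2 ⟨1, ?_⟩
      rw [mul_add, div_mul_cancel₀ _ htp]; simp
    · have h1 : HasDerivAt (fun x => γ (T / tp * x)) _ x := (hγ (T / tp * x)).scomp x
        ((hasDerivAt_id x).const_mul (T / tp))
      rw [h1.deriv]
      refine smul_ne_zero ?_ (hvne _ (hγC _))
      rw [mul_one]
      exact div_ne_zero hT0 htp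
    · obtain ⟨k, hk⟩ := (hrep _ _).1 hxy
      refine ⟨k, ?_⟩
      have : T * x = T * (y + k * tp) := by
        rw [div_mul_eq_mul_div, div_mul_eq_mul_div] at hk
        field_simp at hk
        linear_combination T * hk
      exact mul_left_cancel₀ hT0 this
    · apply Subset.antisymm
      · rintro _ ⟨x, rfl⟩; exact hγC _
      · intro z hz
        obtain ⟨t, rfl⟩ := hsurj z hz
        exact ⟨tp / T * t, by simp only; congr 1; field_simp⟩

end Glu

namespace Glu
open Set Filter Topology Metric
open scoped ContDiff

abbrev V4 := ℝ × ℝ × ℝ × ℝ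
def om (u v : V4) : ℝ := u.1 * v.2.2.1 - u.2.2.1 * v.1 + u.2.1 * v.2.2.2 - u.2.2.2 * v.2.1
def dt (u v : ℝ × ℝ) : ℝ := u.1 * v.2 - u.2 * v.1

structure Fr (P : ℝ × ℝ → ℝ × ℝ) (X : ℝ → ℝ) (e : ℝ) : Prop where
  pos : 0 < e
  sm : ∀ q : ℝ × ℝ, |q.2| < e → ContDiffAt ℝ ∞ P q
  per : ∀ x t, P (x + tp, t) = P (x, t)
  det : ∀ q : ℝ × ℝ, |q.2| < e → dt (fderiv ℝ P q (1, 0)) (fderiv ℝ P q (0, 1)) = 1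
  Xs : ContDiff ℝ ∞ X
  Xp : ∀ x, X (x + tp) = X x

lemma deriv_per {Z : Type*} [NormedAddCommGroup Z] [NormedSpace ℝ Z] {g : ℝ → Z}
    (per : ∀ x, g (x + tp) = g x) (x : ℝ) : deriv g (x + tp) = deriv g x := by
  rw [← deriv_comp_add_const]; simp only [per]

lemma area {g : ℝ → ℝ × ℝ} (hg : ContDiff ℝ ∞ g) (per : ∀ x, g (x + tp) = g x) (hd : ∀ x, deriv g x ≠ 0)
    {X : ℝ → ℝ} (Xs : ContDiff ℝ ∞ X) (Xp : ∀ x, X (x + tp) = X x) :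
    ∃ P e, Fr P X e ∧ ∀ x, P (x, 0) = g x := by
  have hg1 : ContDiff ℝ ∞ (deriv g) := (contDiff_infty_iff_deriv.1 hg).2
  set n : ℝ → ℝ := fun x => (deriv g x).1 ^ 2 + (deriv g x).2 ^ 2 with hn
  have hn0 : ∀ x, n x ≠ 0 := by
    intro x h0
    apply hd x
    apply Prod.ext <;> simp only [Prod.fst_zero, Prod.snd_zero] <;>
      nlinarith [sq_nonneg (deriv g x).1, sq_nonneg (deriv g x).2, h0, hn]
  have hns : ContDiff ℝ ∞ n := (hg1.fst.pow 2).add (hg1.snd.pow 2)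
  set ν : ℝ → ℝ × ℝ := fun x => (-(deriv g x).2 / n x, (deriv g x).1 / n x) with hν
  have hνs : ContDiff ℝ ∞ ν := (hg1.snd.neg.div hns hn0).prodMk (hg1.fst.div hns hn0)
  have hνp : ∀ x, ν (x + tp) = ν x := fun x => by simp only [hν, hn, deriv_per per]
  have hν1 : ContDiff ℝ ∞ (deriv ν) := (contDiff_infty_iff_deriv.1 hνs).2
  have hdet : ∀ x, dt (deriv g x) (ν x) = 1 := by
    intro x
    simp only [dt, hν]
    field_simp [hn0 x]
    simp only [hn]; ring_nf
  set b : ℝ → ℝ := fun x => dt (deriv ν x) (ν x) with hb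
  have hbs : ContDiff ℝ ∞ b := (hν1.fst.mul hνs.snd).sub (hν1.snd.mul hνs.fst)
  have hbp : ∀ x, b (x + tp) = b x := fun x => by simp only [hb, deriv_per hνp, hνp]
  obtain ⟨δ, hδ, r, hr, y, ys, yp, y0, ye, -⟩ := pift (Y := ℝ) (Z := ℝ) rfl
    (Φ := fun v : (ℝ × ℝ) × ℝ => v.2 + b v.1.1 * (v.2 ^ 2) / 2 - v.1.2)
    (by intro x t y; simp only [hbp])
    (by
      intro x; refine Eventually.of_forall fun v => ?_
      have : ContDiff ℝ ∞ (fun v : (ℝ × ℝ) × ℝ => b v.1.1) := hbs.comp (by fun_prop)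
      fun_prop)
    (by intro x; simp)
    (by
      intro x y h
      have h0 : HasFDerivAt (fun v : (ℝ × ℝ) × ℝ => b v.1.1) _ ((x, 0), 0) :=
        ((hbs.comp (f := fun v : (ℝ × ℝ) × ℝ => v.1.1) (by fun_prop)).differentiable (by simp) _).hasFDerivAt
      have h1 : HasFDerivAt (fun v : (ℝ × ℝ) × ℝ => v.2 + b v.1.1 * (v.2 ^ 2) / 2 - v.1.2) _ ((x, 0), 0) :=
        ((hasFDerivAt_snd.add ((h0.mul (hasFDerivAt_snd.pow 2)).mul_const (1/2 : ℝ))).sub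
          hasFDerivAt_fst.snd).congr_of_eventuallyEq (Eventually.of_forall fun v => by simp; ring)
      rw [h1.fderiv] at h
      simpa using h)
  refine ⟨fun q => g q.1 + y q • ν q.1, δ, ⟨hδ, fun q hq => ?_, fun x t => ?_, fun q hq => ?_, Xs, Xp⟩, fun x => ?_⟩
  · exact (hg.contDiffAt.comp q contDiffAt_fst).add ((ys q hq).smul (hνs.contDiffAt.comp q contDiffAt_fst))
  · simp only [yp, per, hνp]
  · have hs : ContDiffAt ℝ ∞ (fun q : ℝ × ℝ => g q.1 + y q • ν q.1) q :=
      (hg.contDiffAt.comp q contDiffAt_fst).add ((ys q hq).smul (hνs.contDiffAt.comp q contDiffAt_fst))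
    have gd : HasDerivAt g (deriv g q.1) q.1 := (hg.differentiable (by simp) _).hasDerivAt
    have νd : HasDerivAt ν (deriv ν q.1) q.1 := (hνs.differentiable (by simp) _).hasDerivAt
    have yx := slice_x (ys q hq)
    have yt := slice_t (ys q hq)
    have e1 := (slice_x hs).unique (gd.add (yx.smul νd))
    have e2 := (slice_t hs).unique ((yt.smul_const (ν q.1)).const_add (g q.1))
    have e3 : fderiv ℝ y q (0, 1) * (1 + b q.1 * y q) = 1 := by
      have h1 : HasDerivAt (fun t => y (q.1, t) + b q.1 * y (q.1, t) ^ 2 / 2) _ q.2 :=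
        yt.add (((yt.pow 2).const_mul (b q.1)).div_const 2)
      have h2 : HasDerivAt (fun t => y (q.1, t) + b q.1 * y (q.1, t) ^ 2 / 2) 1 q.2 := by
        refine (hasDerivAt_id q.2).congr_of_eventuallyEq ?_
        have : ∀ᶠ t in 𝓝 q.2, |t| < δ := continuous_abs.continuousAt.eventually_lt_const hq
        filter_upwards [this] with t ht
        have := (ye (q.1, t) ht).1
        simp only at this
        simp only [id]; linarith
      have := h1.unique h2
      simp at this
      linear_combination this
    rw [e1, e2]
    have h3 := hdet q.1
    simp only [dt, Prod.fst_add, Prod.snd_add, Prod.smul_fst, Prod.smul_snd, smul_eq_mul, hb] at h3 e3 ⊢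
    linear_combination e3 + (fderiv ℝ y q (0, 1)) * h3
  · simp [y0]

def Ec (P : ℝ × ℝ → ℝ × ℝ) (X : ℝ → ℝ) (a : ℝ) (w : ℝ × (ℝ × ℝ × ℝ)) : V4 :=
  ((P (w.1, w.2.1)).1, X w.1 + w.2.2.1, (P (w.1, w.2.1)).2, a + w.2.2.2)

namespace Fr
variable {P : ℝ × ℝ → ℝ × ℝ} {X : ℝ → ℝ} {e a : ℝ}

lemma lin (R : Fr P X e) {q : ℝ × ℝ} (hq : |q.2| < e) (s m : ℝ) (h : fderiv ℝ P q (s, m) = 0) : s = 0 ∧ m = 0 := by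
  have h1 : ((s, m) : ℝ × ℝ) = s • (1, 0) + m • (0, 1) := by simp
  rw [h1, map_add, map_smul, map_smul] at h
  have hd := R.det q hq
  have a1 := congrArg Prod.fst h
  have a2 := congrArg Prod.snd h
  simp only [Prod.fst_add, Prod.snd_add, Prod.smul_fst, Prod.smul_snd, smul_eq_mul, Prod.fst_zero,
    Prod.snd_zero, dt] at a1 a2 hd
  constructor
  · linear_combination -s * hd + (fderiv ℝ P q (0, 1)).2 * a1 - (fderiv ℝ P q (0, 1)).1 * a2
  · linear_combination -m * hd - (fderiv ℝ P q (1, 0)).2 * a1 + (fderiv ℝ P q (1, 0)).1 * a2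

lemma hasFD (R : Fr P X e) {Y : Type*} [NormedAddCommGroup Y] [NormedSpace ℝ Y] {θ N x t : Y → ℝ} {q : Y}
    {θ' N' x' t' : Y →L[ℝ] ℝ} (hθ : HasFDerivAt θ θ' q) (hN : HasFDerivAt N N' q) (hx : HasFDerivAt x x' q)
    (ht : HasFDerivAt t t' q) (hq : |N q| < e) (u : Y) :
    DifferentiableAt ℝ (fun q => Ec P X a (θ q, (N q, x q, t q))) q ∧
    fderiv ℝ (fun q => Ec P X a (θ q, (N q, x q, t q))) q u =
      ((fderiv ℝ P (θ q, N q) (θ' u, N' u)).1, θ' u * deriv X (θ q) + x' u,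
       (fderiv ℝ P (θ q, N q) (θ' u, N' u)).2, t' u) := by
  have h1 : HasFDerivAt (fun q => P (θ q, N q)) _ q := HasFDerivAt.comp (g := P) (f := fun q => (θ q, N q)) q
    ((R.sm (θ q, N q) hq).differentiableAt (by simp)).hasFDerivAt (hθ.prodMk hN)
  have h2 : HasFDerivAt (fun q => X (θ q)) _ q :=
    ((R.Xs.differentiable (by simp) (θ q)).hasDerivAt).comp_hasFDerivAt q hθ
  have h3 : HasFDerivAt (fun q => Ec P X a (θ q, (N q, x q, t q))) _ q :=
    h1.fst.prodMk ((h2.add hx).prodMk (h1.snd.prodMk (ht.const_add a)))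
  refine ⟨h3.differentiableAt, ?_⟩
  rw [h3.fderiv]
  simp [mul_comm]

lemma csm (R : Fr P X e) {Y : Type*} [NormedAddCommGroup Y] [NormedSpace ℝ Y] {θ N x t : Y → ℝ} {q : Y}
    (hθ : ContDiffAt ℝ ∞ θ q) (hN : ContDiffAt ℝ ∞ N q) (hx : ContDiffAt ℝ ∞ x q)
    (ht : ContDiffAt ℝ ∞ t q) (hq : |N q| < e) :
    ContDiffAt ℝ ∞ (fun q => Ec P X a (θ q, (N q, x q, t q))) q := by
  have h1 : ContDiffAt ℝ ∞ (fun q => P (θ q, N q)) q :=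
    (R.sm (θ q, N q) hq).comp q (f := fun q => (θ q, N q)) (hθ.prodMk hN)
  exact h1.fst.prodMk (((R.Xs.contDiffAt.comp q hθ).add hx).prodMk (h1.snd.prodMk (contDiffAt_const.add ht)))

lemma graph (R : Fr P X e) {N x : ℝ × ℝ → ℝ} {q : ℝ × ℝ} (hN : ContDiffAt ℝ ∞ N q) (hx : ContDiffAt ℝ ∞ x q)
    (hq : |N q| < e) :
    ContDiffAt ℝ ∞ (fun q => Ec P X a (q.1, (N q, x q, q.2))) q ∧
    (∀ u, fderiv ℝ (fun q => Ec P X a (q.1, (N q, x q, q.2))) q u = 0 → u = 0) ∧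
    om (fderiv ℝ (fun q => Ec P X a (q.1, (N q, x q, q.2))) q (1, 0))
      (fderiv ℝ (fun q => Ec P X a (q.1, (N q, x q, q.2))) q (0, 1)) =
      fderiv ℝ N q (0, 1) + deriv X q.1 + fderiv ℝ x q (1, 0) := by
  have hf := fun u => (R.hasFD (a := a) hasFDerivAt_fst (hN.differentiableAt (by simp)).hasFDerivAt
    (hx.differentiableAt (by simp)).hasFDerivAt hasFDerivAt_snd hq u).2
  refine ⟨R.csm contDiffAt_fst hN hx contDiffAt_snd hq, fun u hu => ?_, ?_⟩
  · rw [hf u] at hu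
    simp only [Prod.mk_eq_zero] at hu
    have := (R.lin (q := (q.1, N q)) hq _ _ (Prod.ext hu.1 hu.2.2.1)).1
    exact Prod.ext this hu.2.2.2
  · rw [hf, hf]
    have h1 : ((1, fderiv ℝ N q (1, 0)) : ℝ × ℝ) = (1, 0) + fderiv ℝ N q (1, 0) • (0, 1) := by simp
    have h2 : ((0, fderiv ℝ N q (0, 1)) : ℝ × ℝ) = fderiv ℝ N q (0, 1) • (0, 1) := by simp
    have hd := R.det (q.1, N q) hq
    simp only [om, ContinuousLinearMap.coe_fst', ContinuousLinearMap.coe_snd', h1, h2, map_add, map_smul,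
      Prod.fst_add, Prod.snd_add, Prod.smul_fst, Prod.smul_snd, smul_eq_mul, dt] at hd ⊢
    linear_combination (fderiv ℝ N q (0, 1)) * hd

lemma inj (R : Fr P X e) (hi : ∀ x y, Ec P X a (x, 0) = Ec P X a (y, 0) → ∃ n : ℤ, x = y + n * tp) :
    ∃ e' > 0, ∀ q q' : ℝ × (ℝ × ℝ × ℝ), ‖q.2‖ < e' → ‖q'.2‖ < e' → Ec P X a q = Ec P X a q' →
      q.2 = q'.2 ∧ ∃ n : ℤ, q.1 = q'.1 + n * tp := by
  have hz : ∀ x : ℝ, |((x, (0 : ℝ × ℝ × ℝ)) : ℝ × (ℝ × ℝ × ℝ)).2.1| < e := fun x => by simpa using R.pos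
  have hs : ∀ x : ℝ, ContDiffAt ℝ ∞ (Ec P X a) (x, 0) := fun x =>
    R.csm (q := (x, (0 : ℝ × ℝ × ℝ))) (θ := fun w : ℝ × (ℝ × ℝ × ℝ) => w.1) (N := fun w => w.2.1)
      (x := fun w => w.2.2.1) (t := fun w => w.2.2.2) (by fun_prop) (by fun_prop) (by fun_prop) (by fun_prop) (hz x)
  refine locInj (X := Ec P X a) ?_ ?_ ?_ ?_
  · intro x v; simp only [Ec, R.per, R.Xp]
  · exact fun x => (hs x).continuousAt
  · intro x
    refine (exists_localInv (by simp) (hs x) fun u hu => ?_).2.1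
    have := (R.hasFD (a := a) (q := (x, (0 : ℝ × ℝ × ℝ))) (θ := fun w : ℝ × (ℝ × ℝ × ℝ) => w.1)
      (N := fun w => w.2.1) (x := fun w => w.2.2.1) (t := fun w => w.2.2.2)
      hasFDerivAt_fst hasFDerivAt_snd.fst hasFDerivAt_snd.snd.fst hasFDerivAt_snd.snd.snd (hz x) u).2
    have h2 := this.symm.trans hu
    simp only [Prod.mk_eq_zero] at h2
    obtain ⟨b1, b2⟩ := R.lin (q := (x, 0)) (by simpa using R.pos) _ _ (Prod.ext h2.1 h2.2.2.1)
    have b3 := h2.2.1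
    have b4 := h2.2.2.2
    simp at b1 b2 b3 b4
    rw [b1] at b3
    simp at b3
    exact Prod.ext b1 (Prod.ext b2 (Prod.ext b3 b4))
  · exact hi

end Fr
end Glu

namespace Glu
open Set Filter Topology Metric
open scoped ContDiff

structure Lag (F : ℂ → V4) : Prop where
  sm : ContDiff ℝ ∞ F
  inj : Function.Injective F
  imm : ∀ z u, fderiv ℝ F z u = 0 → u = 0
  iso : ∀ z u v, om (fderiv ℝ F z u) (fderiv ℝ F z v) = 0
  flat : ∃ R : ℝ, ∀ z : ℂ, R < ‖z‖ → F z = (z.re, z.im, 0, 0)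

namespace Lag
variable {F : ℂ → V4} {a : ℝ}

lemma bdd (LF : Lag F) {b : ℝ} (hb : b < 0) : IsCompact {z | (F z).2.2.2 ≤ b} := by
  obtain ⟨R, hR⟩ := LF.flat
  refine (isCompact_closedBall (0 : ℂ) R).of_isClosed_subset
    (isClosed_le (by have := LF.sm.continuous; fun_prop) continuous_const) fun z hz => ?_
  rw [mem_closedBall_zero_iff]
  by_contra h
  rw [mem_setOf_eq, hR z (not_le.1 h)] at hz
  simp at hz; linarith

lemma hd (LF : Lag F) (z u : ℂ) : fderiv ℝ (fun z => (F z).2.2.2) z u = (fderiv ℝ F z u).2.2.2 := by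
  have := (LF.sm.differentiable (by simp) z).hasFDerivAt.snd.snd.snd
  rw [this.fderiv]; rfl

lemma gd (LF : Lag F) {γ : ℝ → ℂ} (γs : ContDiff ℝ ∞ γ) (x : ℝ) :
    HasDerivAt (fun x => F (γ x)) (fderiv ℝ F (γ x) (deriv γ x)) x :=
  (LF.sm.differentiable (by simp) _).hasFDerivAt.comp_hasDerivAt x (γs.differentiable (by simp) x).hasDerivAt

lemma collar (LF : Lag F) (ha : a < 0) (tr : ∀ z, (F z).2.2.2 = a → fderiv ℝ (fun z => (F z).2.2.2) z ≠ 0)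
    {γ : ℝ → ℂ} (γs : ContDiff ℝ ∞ γ) (γp : ∀ x, γ (x + tp) = γ x) (γd : ∀ x, deriv γ x ≠ 0)
    (γi : ∀ x y, γ x = γ y → ∃ n : ℤ, x = y + n * tp) (γr : range γ = {z | (F z).2.2.2 = a})
    {P : ℝ × ℝ → ℝ × ℝ} {X : ℝ → ℝ} {e : ℝ} (R : Fr P X e)
    (hP : ∀ x, P (x, 0) = ((F (γ x)).1, (F (γ x)).2.2.1)) (hX : ∀ x, X x = (F (γ x)).2.1) :
    ∃ δ c N x, Collar {z | (F z).2.2.2 < a} c δ ∧ (∀ q : ℝ × ℝ, |q.2| < δ → |N q| < e ∧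
      F (c q) = Ec P X a (q.1, (N q, x q, q.2)) ∧ ContDiffAt ℝ ∞ N q ∧ ContDiffAt ℝ ∞ x q ∧
      fderiv ℝ N q (0, 1) + deriv X q.1 + fderiv ℝ x q (1, 0) = 0) ∧
      (∀ x t, N (x + tp, t) = N (x, t)) ∧ (∀ y t, x (y + tp, t) = x (y, t)) ∧
      (∀ x, N (x, 0) = 0) ∧ (∀ y, x (y, 0) = 0) ∧
      (∀ z, |(F z).2.2.2 - a| < δ → ∃ q : ℝ × ℝ, |q.2| < δ ∧ c q = z) := by
  have hγ : ∀ x, (F (γ x)).2.2.2 = a := fun x => by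
    have : γ x ∈ range γ := ⟨x, rfl⟩
    rwa [γr] at this
  have hE0 : ∀ x, F (γ x) = Ec P X a (x, 0) := fun x => by
    refine Prod.ext ?_ (Prod.ext ?_ (Prod.ext ?_ ?_)) <;> simp [Ec, hP, hX, hγ]
  obtain ⟨δ0, hδ0, r, hr, y, ys, yp, y0, ye, -⟩ := pift (Y := ℂ × ℝ × ℝ) (Z := V4) (by simp)
    (Φ := fun v : (ℝ × ℝ) × (ℂ × ℝ × ℝ) => F (γ v.1.1 + v.2.1) - Ec P X a (v.1.1, (v.2.2.1, v.2.2.2, v.1.2)))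
    (by intro x t y; simp only [γp, Ec, R.per, R.Xp])
    (by
      intro x
      have : ∀ᶠ v : (ℝ × ℝ) × (ℂ × ℝ × ℝ) in 𝓝 ((x, 0), 0), |v.2.2.1| < e := by
        have hc : ContinuousAt (fun v : (ℝ × ℝ) × (ℂ × ℝ × ℝ) => |v.2.2.1|) ((x, 0), 0) := by fun_prop
        exact hc.eventually_lt continuousAt_const (by simpa using R.pos)
      filter_upwards [this] with v hv
      refine ContDiffAt.sub ?_ (R.csm (by fun_prop) (by fun_prop) (by fun_prop) (by fun_prop) hv)
      have h1 : ContDiff ℝ ∞ (fun v : (ℝ × ℝ) × (ℂ × ℝ × ℝ) => γ v.1.1 + v.2.1) := by fun_prop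
      exact (LF.sm.comp h1).contDiffAt)
    (by intro x; simp only [add_zero, Prod.fst_zero, Prod.snd_zero, hE0]; exact sub_self _)
    (by
      rintro x ⟨ρ, n, ξ⟩ h
      have hf1 : HasFDerivAt (fun v : (ℝ × ℝ) × (ℂ × ℝ × ℝ) => v.1.1) _ ((x, 0), 0) :=
        ((ContinuousLinearMap.fst ℝ ℝ ℝ).comp (ContinuousLinearMap.fst ℝ (ℝ × ℝ) (ℂ × ℝ × ℝ))).hasFDerivAt
      have hr1 : HasFDerivAt (fun v : (ℝ × ℝ) × (ℂ × ℝ × ℝ) => v.2.1) _ ((x, 0), 0) :=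
        ((ContinuousLinearMap.fst ℝ ℂ (ℝ × ℝ)).comp (ContinuousLinearMap.snd ℝ (ℝ × ℝ) (ℂ × ℝ × ℝ))).hasFDerivAt
      have hg1 : HasFDerivAt (fun v : (ℝ × ℝ) × (ℂ × ℝ × ℝ) => γ v.1.1) _ ((x, 0), 0) :=
        HasFDerivAt.comp (g := γ) ((x, 0), 0) (γs.differentiable (by simp) x).hasDerivAt.hasFDerivAt hf1
      have h1 : HasFDerivAt (fun v : (ℝ × ℝ) × (ℂ × ℝ × ℝ) => F (γ v.1.1 + v.2.1)) _ ((x, 0), 0) :=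
        HasFDerivAt.comp (g := F) (f := fun v : (ℝ × ℝ) × (ℂ × ℝ × ℝ) => γ v.1.1 + v.2.1) ((x, 0), 0)
        (LF.sm.differentiable (by simp) _).hasFDerivAt (hg1.add hr1)
      have h2 := R.hasFD (a := a) (q := (((x, 0), 0) : (ℝ × ℝ) × (ℂ × ℝ × ℝ))) (N := fun v => v.2.2.1)
        (x := fun v => v.2.2.2) (t := fun v => v.1.2) hf1
        ((ContinuousLinearMap.fst ℝ ℝ ℝ).comp ((ContinuousLinearMap.snd ℝ ℂ (ℝ × ℝ)).comp (ContinuousLinearMap.snd ℝ (ℝ × ℝ) (ℂ × ℝ × ℝ)))).hasFDerivAt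
        ((ContinuousLinearMap.snd ℝ ℝ ℝ).comp ((ContinuousLinearMap.snd ℝ ℂ (ℝ × ℝ)).comp (ContinuousLinearMap.snd ℝ (ℝ × ℝ) (ℂ × ℝ × ℝ)))).hasFDerivAt
        ((ContinuousLinearMap.snd ℝ ℝ ℝ).comp (ContinuousLinearMap.fst ℝ (ℝ × ℝ) (ℂ × ℝ × ℝ))).hasFDerivAt
        (by simpa using R.pos) (0, (ρ, n, ξ))
      rw [fderiv_fun_sub h1.differentiableAt h2.1, ContinuousLinearMap.sub_apply, h2.2, h1.fderiv, sub_eq_zero] at h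
      simp at h
      have g1 := LF.gd γs x
      have g2 : HasDerivAt (fun x => P (x, 0)) (fderiv ℝ P (x, 0) (1, 0)) x := slice_x (R.sm (x, 0) (by simpa using R.pos))
      have g3 : fderiv ℝ P (x, 0) (1, 0) = ((fderiv ℝ F (γ x) (deriv γ x)).1, (fderiv ℝ F (γ x) (deriv γ x)).2.2.1) := by
        refine g2.unique ?_
        simp only [hP]
        exact g1.fst.prodMk g1.snd.snd.fst
      have g4 : (fderiv ℝ F (γ x) (deriv γ x)).2.2.2 = 0 := by
        have : HasDerivAt (fun x => (F (γ x)).2.2.2) (fderiv ℝ F (γ x) (deriv γ x)).2.2.2 x := g1.snd.snd.snd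
        simp only [hγ] at this
        exact this.unique (hasDerivAt_const x a)
      obtain ⟨s, rfl⟩ := ker_line (tr (γ x) (hγ x)) (γd x) (by rw [LF.hd]; exact g4)
        (u := ρ) (by rw [LF.hd, h])
      rw [map_smul] at h
      have k1 := congrArg Prod.fst h
      have k2 := congrArg (fun p => p.2.1) h
      have k3 := congrArg (fun p => p.2.2.1) h
      simp only [Prod.smul_fst, Prod.smul_snd] at k1 k2 k3
      have k4 : fderiv ℝ P (x, 0) (s, -n) = 0 := by
        have : ((s, -n) : ℝ × ℝ) = s • (1, 0) - (0, n) := by simp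
        rw [this, map_sub, map_smul, g3]
        refine Prod.ext ?_ ?_ <;> simp only [Prod.fst_sub, Prod.snd_sub, Prod.smul_fst, Prod.smul_snd, k1, k3, sub_self, Prod.fst_zero, Prod.snd_zero]
      obtain ⟨rfl, h5⟩ := R.lin (by simpa using R.pos) s (-n) k4
      simp at k2 h5 ⊢
      exact ⟨h5, k2.symm⟩)
  set c : ℝ × ℝ → ℂ := fun q => γ q.1 + (y q).1 with hc
  have hFc : ∀ q : ℝ × ℝ, |q.2| < δ0 → F (c q) = Ec P X a (q.1, ((y q).2.1, (y q).2.2, q.2)) := fun q hq =>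
    sub_eq_zero.1 (ye q hq).1
  have ht : ∀ q : ℝ × ℝ, |q.2| < δ0 → (F (c q)).2.2.2 = a + q.2 := fun q hq => by rw [hFc q hq]; rfl
  have cs : ∀ q : ℝ × ℝ, |q.2| < δ0 → ContDiffAt ℝ ∞ c q := fun q hq =>
    (γs.contDiffAt.comp q contDiffAt_fst).add (ys q hq).fst
  have cp : ∀ x t, c (x + tp, t) = c (x, t) := fun x t => by simp only [hc, γp, yp]
  have c0 : ∀ x, c (x, 0) = γ x := fun x => by simp [hc, y0]
  obtain ⟨e', he', hi⟩ := R.inj (a := a) (fun x y h => γi x y (LF.inj (by rw [hE0, hE0, h])))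
  have z0 : ∀ x : ℝ, |((x, 0) : ℝ × ℝ).2| < δ0 := fun x => by simpa using hδ0
  obtain ⟨e1, he1, hN⟩ := ext_small (f := fun q => (y q).2.1) (lt_min R.pos he')
    (fun x => (ys _ (z0 x)).continuousAt.snd.fst) (fun x t => by simp only [yp]) (fun x => by simp [y0])
  obtain ⟨e2, he2, hx⟩ := ext_small (f := fun q => (y q).2.2) he'
    (fun x => (ys _ (z0 x)).continuousAt.snd.snd) (fun x t => by simp only [yp]) (fun x => by simp [y0])
  obtain ⟨δ1, hδ1, l0, l1, l2, l3⟩ : ∃ δ1 > 0, δ1 ≤ δ0 ∧ δ1 ≤ e1 ∧ δ1 ≤ e2 ∧ δ1 ≤ e' :=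
    ⟨min (min δ0 e1) (min e2 e'), by positivity, by simp, by simp, by simp, by simp⟩
  have fc : ∀ q : ℝ × ℝ, |q.2| < δ1 → F ∘ c =ᶠ[𝓝 q] fun q => Ec P X a (q.1, ((y q).2.1, (y q).2.2, q.2)) :=
    fun q hq => (abs_lt_nhds hq).mono fun q' hq' => hFc q' (hq'.trans_le l0)
  have fc' : ∀ q : ℝ × ℝ, |q.2| < δ1 → ∀ u, fderiv ℝ (fun q => Ec P X a (q.1, ((y q).2.1, (y q).2.2, q.2))) q u =
      fderiv ℝ F (c q) (fderiv ℝ c q u) := fun q hq u => by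
    rw [← (fc q hq).fderiv_eq, fderiv_comp q (LF.sm.differentiable (by simp) _) ((cs q (hq.trans_le l0)).differentiableAt (by simp))]
    rfl
  have gr := fun (q : ℝ × ℝ) (hq : |q.2| < δ1) => R.graph (a := a) (ys q (hq.trans_le l0)).snd.fst (ys q (hq.trans_le l0)).snd.snd
    ((hN q (hq.trans_le l1)).trans_le (min_le_left _ _))
  have imm : ∀ (q : ℝ × ℝ) u, |q.2| < δ1 → fderiv ℝ c q u = 0 → u = 0 := fun q u hq hu =>
    (gr q hq).2.1 u (by rw [fc' q hq, hu, map_zero])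
  have inj : ∀ q q' : ℝ × ℝ, |q.2| < δ1 → |q'.2| < δ1 → c q = c q' → q.2 = q'.2 ∧ ∃ n : ℤ, q.1 = q'.1 + n * tp := by
    intro q q' hq hq' h
    have := congrArg F h
    rw [hFc q (hq.trans_le l0), hFc q' (hq'.trans_le l0)] at this
    have sm : ∀ q : ℝ × ℝ, |q.2| < δ1 → ‖((y q).2.1, (y q).2.2, q.2)‖ < e' := fun q hq => by
      simp only [Prod.norm_mk, Real.norm_eq_abs, max_lt_iff]
      exact ⟨(hN q (hq.trans_le l1)).trans_le (min_le_right _ _), hx q (hq.trans_le l2), hq.trans_le l3⟩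
    obtain ⟨h1, h2⟩ := hi _ _ (sm q hq) (sm q' hq') this
    exact ⟨congrArg (fun p => p.2.2) h1, h2⟩
  have hcont : Continuous fun z => |(F z).2.2.2 - a| := by have := LF.sm.continuous; fun_prop
  obtain ⟨δ, hδ, l, band⟩ : ∃ δ > 0, δ ≤ δ1 ∧ ∀ z, |(F z).2.2.2 - a| < δ → ∃ q : ℝ × ℝ, |q.2| < δ1 ∧ c q = z := by
    set U := c '' {q | |q.2| < δ1} with hU
    have Uo : IsOpen U := by
      rw [isOpen_iff_mem_nhds]
      rintro _ ⟨q, hq, rfl⟩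
      rw [← (exists_localInv Collar.fd (cs q (lt_of_lt_of_le hq l0)) (fun u => imm q u hq)).1]
      exact image_mem_map (abs_lt_nhds hq)
    have Kc : IsCompact ({z | (F z).2.2.2 ≤ a / 2} \ U) := (LF.bdd (by linarith)).diff Uo
    have pos : ∀ z ∈ {z | (F z).2.2.2 ≤ a / 2} \ U, 0 < |(F z).2.2.2 - a| := by
      rintro z ⟨-, hz⟩
      rw [abs_pos, sub_ne_zero]
      intro h
      have : z ∈ range γ := by rw [γr]; exact h
      obtain ⟨x, rfl⟩ := this
      exact hz ⟨(x, 0), by simpa using hδ1, c0 x⟩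
    obtain ⟨m, hm, hm'⟩ : ∃ m > 0, ∀ z ∈ {z | (F z).2.2.2 ≤ a / 2} \ U, m ≤ |(F z).2.2.2 - a| := by
      rcases ({z | (F z).2.2.2 ≤ a / 2} \ U).eq_empty_or_nonempty with h | h
      · exact ⟨1, one_pos, by simp [h]⟩
      · obtain ⟨z, hz, hm⟩ := Kc.exists_isMinOn h hcont.continuousOn
        exact ⟨_, pos z hz, fun w hw => hm hw⟩
    refine ⟨min δ1 (min m (-a / 2)), by have : 0 < -a / 2 := by linarith
                                        positivity, by simp, fun z hz => ?_⟩
    by_contra hn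
    have h1 := hm' z ⟨by simp only [mem_setOf_eq]; linarith [(abs_lt.1 hz).2, min_le_right δ1 (min m (-a / 2)), min_le_right m (-a / 2)], fun ⟨q, h1, h2⟩ => hn ⟨q, h1, h2⟩⟩
    linarith [min_le_right δ1 (min m (-a / 2)), min_le_left m (-a / 2)]
  have band' : ∀ z, |(F z).2.2.2 - a| < δ → ∃ q : ℝ × ℝ, q.2 = (F z).2.2.2 - a ∧ c q = z := fun z hz => by
    obtain ⟨q, hq, rfl⟩ := band z hz
    exact ⟨q, by rw [ht q (hq.trans_le l0)]; ring, rfl⟩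
  refine ⟨δ, c, fun q => (y q).2.1, fun q => (y q).2.2, ⟨hδ, isOpen_lt (by have := LF.sm.continuous; fun_prop) continuous_const,
    fun q hq => cs q (by linarith), cp, fun q q' hq hq' => inj q q' (by linarith) (by linarith),
    fun q u hq => imm q u (by linarith), fun q hq => ?_, fun δ' h0 h1 => ?_⟩, fun q hq => ?_,
    fun x t => by simp only [yp], fun x t => by simp only [yp], fun x => by simp [y0], fun x => by simp [y0],
    fun z hz => ?_⟩
  · rw [mem_setOf_eq, ht q (by linarith)]; constructor <;> intro h <;> linarith
  · convert LF.bdd (b := a - δ') (by linarith) using 1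
    ext z
    constructor
    · rintro ⟨h2, h3⟩
      by_contra h4
      simp only [mem_setOf_eq, not_le] at h2 h4
      obtain ⟨q, hq, rfl⟩ := band' z (by rw [abs_lt]; constructor <;> linarith)
      exact h3 ⟨q, ⟨by linarith, by linarith⟩, rfl⟩
    · intro h
      rw [mem_setOf_eq] at h
      refine ⟨by simp only [mem_setOf_eq]; linarith, ?_⟩
      rintro ⟨q, ⟨h2, h3⟩, rfl⟩
      rw [ht q (by rw [abs_lt]; constructor <;> linarith)] at h
      linarith
  · have hq1 : |q.2| < δ1 := by linarith
    refine ⟨(hN q (by linarith)).trans_le (min_le_left _ _), hFc q (by linarith), (ys q (by linarith)).snd.fst, (ys q (by linarith)).snd.snd, ?_⟩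
    rw [← (gr q hq1).2.2, fc' q hq1, fc' q hq1, LF.iso]
  · obtain ⟨q, hq, h⟩ := band' z hz
    exact ⟨q, by rwa [hq], h⟩

end Lag
end Glu

namespace Glu
open Set Filter Topology Metric
open scoped ContDiff
namespace Lag
variable {F F' : ℂ → V4} {a : ℝ}

lemma proper (LF : Lag F) : IsProperMap F := by
  rw [isProperMap_iff_tendsto_cocompact]
  refine ⟨LF.sm.continuous, ?_⟩
  obtain ⟨R, hR⟩ := LF.flat
  rw [← cobounded_eq_cocompact, ← cobounded_eq_cocompact, ← tendsto_norm_atTop_iff_cobounded]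
  have h1 : Tendsto (fun z : ℂ => ‖z‖) (Bornology.cobounded ℂ) atTop := tendsto_norm_cobounded_atTop
  refine tendsto_atTop_mono' _ ?_ (h1.atTop_div_const (r := 2) (by norm_num))
  filter_upwards [h1.eventually_gt_atTop R] with z hz
  rw [hR z hz]
  simp only [Prod.norm_mk, Real.norm_eq_abs]
  have := Complex.norm_le_abs_re_add_abs_im z
  rcases le_total |z.re| |z.im| with h | h
  · exact le_trans (by linarith) ((le_max_left _ _).trans (le_max_right _ _))
  · exact le_trans (by linarith) (le_max_left _ _)

lemma emb (LF : Lag F) : IsClosedEmbedding F :=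
  .of_continuous_injective_isClosedMap LF.sm.continuous LF.inj LF.proper.isClosedMap

lemma frame (LF : Lag F) (tr : ∀ z, (F z).2.2.2 = a → fderiv ℝ (fun z => (F z).2.2.2) z ≠ 0)
    {γ : ℝ → ℂ} (γs : ContDiff ℝ ∞ γ) (γp : ∀ x, γ (x + tp) = γ x) (γd : ∀ x, deriv γ x ≠ 0)
    (hγ : ∀ x, (F (γ x)).2.2.2 = a) :
    ∃ P e, Fr P (fun x => (F (γ x)).2.1) e ∧ ∀ x, P (x, 0) = ((F (γ x)).1, (F (γ x)).2.2.1) := by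
  have hs := LF.sm.comp γs
  refine area (g := fun x => ((F (γ x)).1, (F (γ x)).2.2.1)) (hs.fst.prodMk hs.snd.snd.fst)
    (fun x => by simp only [γp]) (fun x h => ?_) hs.snd.fst (fun x => by simp only [γp])
  have g1 := LF.gd γs x
  have g2 : HasDerivAt (fun x => ((F (γ x)).1, (F (γ x)).2.2.1)) ((fderiv ℝ F (γ x) (deriv γ x)).1, (fderiv ℝ F (γ x) (deriv γ x)).2.2.1) x :=
    g1.fst.prodMk g1.snd.snd.fst
  have g4 : (fderiv ℝ F (γ x) (deriv γ x)).2.2.2 = 0 := by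
    have : HasDerivAt (fun x => (F (γ x)).2.2.2) (fderiv ℝ F (γ x) (deriv γ x)).2.2.2 x := g1.snd.snd.snd
    simp only [hγ] at this
    exact this.unique (hasDerivAt_const x a)
  rw [g2.deriv, Prod.mk_eq_zero] at h
  obtain ⟨u, hu⟩ : ∃ u, fderiv ℝ (fun z => (F z).2.2.2) (γ x) u ≠ 0 := by
    by_contra! hu
    exact tr _ (hγ x) (ContinuousLinearMap.ext hu)
  rw [LF.hd] at hu
  have h3 := LF.iso (γ x) (deriv γ x) u
  simp only [om, h.1, h.2, g4, zero_mul, zero_add, sub_zero, mul_eq_zero, hu, or_false] at h3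
  exact γd x (LF.imm (γ x) _ (Prod.ext h.1 (Prod.ext h3 (Prod.ext h.2 g4))))

lemma transfer (LF : Lag F) (LF' : Lag F') {γ : ℝ → ℂ} (γs : ContDiff ℝ ∞ γ) (γp : ∀ x, γ (x + tp) = γ x)
    (γd : ∀ x, deriv γ x ≠ 0) (γi : ∀ x y, γ x = γ y → ∃ n : ℤ, x = y + n * tp) (hr : ∀ x, F (γ x) ∈ range F') :
    ∃ σ : ℝ → ℂ, ContDiff ℝ ∞ σ ∧ (∀ x, σ (x + tp) = σ x) ∧ (∀ x, deriv σ x ≠ 0) ∧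
      (∀ x y, σ x = σ y → ∃ n : ℤ, x = y + n * tp) ∧ ∀ x, F' (σ x) = F (γ x) := by
  choose σ hσ using hr
  have σc : Continuous σ := by
    rw [LF'.emb.isInducing.continuous_iff]
    have : F' ∘ σ = F ∘ γ := funext hσ
    rw [this]; exact LF.sm.continuous.comp γs.continuous
  have σs : ContDiff ℝ ∞ σ := by
    rw [contDiff_iff_contDiffAt]
    intro x
    obtain ⟨p, hp⟩ := LinearMap.exists_leftInverse_of_injective (fderiv ℝ F' (σ x) : ℂ →ₗ[ℝ] V4)
      (LinearMap.ker_eq_bot'.2 fun u hu => LF'.imm _ u hu)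
    set π : V4 →L[ℝ] ℂ := LinearMap.toContinuousLinearMap p with hπ
    have d1 : HasFDerivAt (fun z => π (F' z)) (π.comp (fderiv ℝ F' (σ x))) (σ x) :=
      π.hasFDerivAt.comp (σ x) (LF'.sm.differentiable (by simp) _).hasFDerivAt
    obtain ⟨-, -, k, ks, -, -, hk⟩ := exists_localInv (f := fun z => π (F' z)) (a := σ x) rfl
      (π.contDiff.comp LF'.sm).contDiffAt (fun u hu => by
        rw [d1.fderiv] at hu
        have := LinearMap.congr_fun hp u
        change p (fderiv ℝ F' (σ x) u) = u at this
        rw [← this]; exact hu)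
    have e1 : (fun y => k (π (F (γ y)))) =ᶠ[𝓝 x] σ := by
      filter_upwards [σc.continuousAt.eventually hk] with y hy
      rw [← hσ]; exact hy
    refine ContDiffAt.congr_of_eventuallyEq ?_ e1.symm
    rw [hσ] at ks
    exact ks.comp x ((π.contDiff.comp (LF.sm.comp γs)).contDiffAt)
  refine ⟨σ, σs, fun x => LF'.inj (by rw [hσ, hσ, γp]), fun x h => ?_,
    fun x y h => γi x y (LF.inj (by rw [← hσ, ← hσ, h])), hσ⟩
  have h1 := LF'.gd σs x
  simp only [hσ] at h1
  have h2 := h1.unique (LF.gd γs x)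
  rw [h, map_zero] at h2
  exact γd x (LF.imm _ _ h2.symm)

end Lag
end Glu

namespace Glu
open Set Filter Topology Metric
open scoped ContDiff

lemma mvt0 {f f' : ℝ → ℝ} {M t : ℝ} (h : ∀ s, |s| ≤ |t| → HasDerivAt f (f' s) s) (hM : ∀ s, |s| ≤ |t| → |f' s| ≤ M)
    (h0 : f 0 = 0) : |f t| ≤ M * |t| := by
  have := (convex_Icc (-|t|) |t|).norm_image_sub_le_of_norm_hasDerivWithin_le (f := f) (f' := f') (x := 0) (y := t) (C := M)
    (fun s hs => (h s (abs_le.2 hs)).hasDerivWithinAt) (fun s hs => hM s (abs_le.2 hs)) ⟨by simp, by simp⟩ ⟨neg_abs_le t, le_abs_self t⟩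
  simpa [h0] using this

lemma poin {A B : ℝ × ℝ → ℝ} {δ : ℝ} (hδ : 0 < δ) (As : ∀ q : ℝ × ℝ, |q.2| < δ → ContDiffAt ℝ ∞ A q)
    (Bs : ∀ q : ℝ × ℝ, |q.2| < δ → ContDiffAt ℝ ∞ B q) (Bp : ∀ x t, B (x + tp, t) = B (x, t)) (A0 : ∀ x, A (x, 0) = 0)
    (cl : ∀ q : ℝ × ℝ, |q.2| < δ → fderiv ℝ A q (0, 1) + fderiv ℝ B q (1, 0) = 0) :
    ∃ K : ℝ × ℝ → ℝ, (∀ q : ℝ × ℝ, |q.2| < δ → ContDiffAt ℝ ∞ K q) ∧ (∀ x t, K (x + tp, t) = K (x, t)) ∧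
      (∀ q : ℝ × ℝ, |q.2| < δ → fderiv ℝ K q (1, 0) = - A q) ∧
      (∀ (q : ℝ × ℝ) M, |q.2| < δ → (∀ s, |s| ≤ |q.2| → |B (q.1, s)| ≤ M) → |K q| ≤ M * |q.2|) := by
  set S : Set (ℝ × ℝ) := {q | |q.2| < δ} with hS
  have So : IsOpen S := isOpen_lt (by fun_prop) continuous_const
  have Sc : Convex ℝ S := by
    have : S = univ ×ˢ Ioo (-δ) δ := by ext q; simp [hS, abs_lt]
    rw [this]; exact convex_univ.prod (convex_Ioo _ _)
  set W : ℝ × ℝ → (ℝ × ℝ) →L[ℝ] ℝ := fun q => (-A q) • ContinuousLinearMap.fst ℝ ℝ ℝ + B q • ContinuousLinearMap.snd ℝ ℝ ℝ with hW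
  have Ws : ∀ q ∈ S, ContDiffAt ℝ ∞ W q := fun q hq =>
    ((As q hq).neg.smul contDiffAt_const).add ((Bs q hq).smul contDiffAt_const)
  obtain ⟨K0, hK0⟩ := Sc.exists_forall_hasFDerivAt_of_fderiv_symmetric So
     (fun q hq => ((Ws q hq).differentiableAt (by simp)).differentiableWithinAt) (by
      intro q hq u v
      have h1 : HasFDerivAt W _ q := (((As q hq).differentiableAt (by simp)).hasFDerivAt.neg.smul_const (ContinuousLinearMap.fst ℝ ℝ ℝ)).add
        (((Bs q hq).differentiableAt (by simp)).hasFDerivAt.smul_const (ContinuousLinearMap.snd ℝ ℝ ℝ))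
      rw [h1.fderiv]
      have dec : ∀ (ℓ : (ℝ × ℝ) →L[ℝ] ℝ) u, ℓ u = u.1 * ℓ (1, 0) + u.2 * ℓ (0, 1) := fun ℓ u => by
        have : u = u.1 • (1, 0) + u.2 • (0, 1) := by simp
        conv_lhs => rw [this]
        simp only [map_add, map_smul, smul_eq_mul]
      simp only [ContinuousLinearMap.add_apply, ContinuousLinearMap.smulRight_apply, ContinuousLinearMap.neg_apply,
        ContinuousLinearMap.smul_apply, ContinuousLinearMap.coe_fst', ContinuousLinearMap.coe_snd', smul_eq_mul]
      rw [dec (fderiv ℝ A q) u, dec (fderiv ℝ A q) v, dec (fderiv ℝ B q) u, dec (fderiv ℝ B q) v]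
      linear_combination (u.1 * v.2 - u.2 * v.1) * cl q hq)
  have K0s : ∀ q ∈ S, ContDiffAt ℝ ∞ K0 q := fun q hq => by
    refine ContDiffOn.contDiffAt ?_ (So.mem_nhds hq)
    rw [contDiffOn_infty_iff_fderiv_of_isOpen So]
    refine ⟨fun q hq => (hK0 q hq).differentiableAt.differentiableWithinAt, fun q hq => ?_⟩
    refine ((Ws q hq).congr_of_eventuallyEq ?_).contDiffWithinAt
    filter_upwards [So.mem_nhds hq] with q' hq'
    exact (hK0 q' hq').fderiv
  have dt' : ∀ x t, |t| < δ → HasDerivAt (fun t => K0 (x, t)) (B (x, t)) t := fun x t ht => by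
    have := slice_t (K0s (x, t) ht)
    rw [(hK0 _ ht).fderiv] at this
    simpa [hW] using this
  have dx' : ∀ x, HasDerivAt (fun x => K0 (x, 0)) 0 x := fun x => by
    have h0 : ((x, 0) : ℝ × ℝ) ∈ S := by simpa [hS] using hδ
    have := slice_x (K0s (x, 0) h0)
    rw [(hK0 _ h0).fderiv] at this
    simpa [hW, A0] using this
  have c0 : ∀ x, K0 (x, 0) = K0 (0, 0) := fun x =>
    is_const_of_deriv_eq_zero (fun x => (dx' x).differentiableAt) (fun x => (dx' x).deriv) x 0
  refine ⟨fun q => if |q.2| < δ then K0 q - K0 (0, 0) else 0, ?_⟩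
  have ev : ∀ q ∈ S, (fun q : ℝ × ℝ => if |q.2| < δ then K0 q - K0 (0, 0) else 0) =ᶠ[𝓝 q] fun q => K0 q - K0 (0, 0) := fun q hq => by
    filter_upwards [So.mem_nhds hq] with q' hq'
    exact if_pos hq'
  refine ⟨fun q hq => ((K0s q hq).sub contDiffAt_const).congr_of_eventuallyEq (ev q hq), fun x t => ?_, fun q hq => ?_, fun q M hq hM => ?_⟩
  · simp only
    split_ifs with h
    · have := mvt0 (f := fun t => K0 (x + tp, t) - K0 (x, t)) (f' := fun _ => 0) (M := 0) (t := t) (fun s hs => by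
        have := (dt' (x + tp) s (hs.trans_lt h)).sub (dt' x s (hs.trans_lt h))
        rw [Bp, sub_self] at this; exact this) (by simp) (by rw [c0, c0 x, sub_self])
      simp only [zero_mul, abs_nonpos_iff] at this
      linarith
    · rfl
  · rw [(ev q hq).fderiv_eq, ((hK0 q hq).sub_const _).fderiv]; simp [hW]
  · simp only [if_pos hq]
    exact mvt0 (f := fun t => K0 (q.1, t) - K0 (0, 0)) (f' := fun s => B (q.1, s))
      (fun s hs => (dt' q.1 s (hs.trans_lt hq)).sub_const _) hM (by rw [c0, sub_self])

lemma interp {N N' x x' : ℝ × ℝ → ℝ} {X : ℝ → ℝ} {δ e η : ℝ} (hδ : 0 < δ) (he : 0 < e) (hη : 0 < η)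
    (Ns : ∀ q : ℝ × ℝ, |q.2| < δ → ContDiffAt ℝ ∞ N q) (Ns' : ∀ q : ℝ × ℝ, |q.2| < δ → ContDiffAt ℝ ∞ N' q)
    (xs : ∀ q : ℝ × ℝ, |q.2| < δ → ContDiffAt ℝ ∞ x q) (xs' : ∀ q : ℝ × ℝ, |q.2| < δ → ContDiffAt ℝ ∞ x' q)
    (Np : ∀ x t, N (x + tp, t) = N (x, t)) (Np' : ∀ x t, N' (x + tp, t) = N' (x, t))
    (xp : ∀ y t, x (y + tp, t) = x (y, t)) (xp' : ∀ y t, x' (y + tp, t) = x' (y, t))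
    (N0 : ∀ x, N (x, 0) = 0) (N0' : ∀ x, N' (x, 0) = 0) (x0 : ∀ y, x (y, 0) = 0) (x0' : ∀ y, x' (y, 0) = 0)
    (cl : ∀ q : ℝ × ℝ, |q.2| < δ → fderiv ℝ N q (0, 1) + deriv X q.1 + fderiv ℝ x q (1, 0) = 0)
    (cl' : ∀ q : ℝ × ℝ, |q.2| < δ → fderiv ℝ N' q (0, 1) + deriv X q.1 + fderiv ℝ x' q (1, 0) = 0) :
    ∃ δ1 > 0, ∃ δ2 > 0, δ1 ≤ δ ∧ δ2 < δ1 ∧ δ2 < η ∧ ∃ M y : ℝ × ℝ → ℝ,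
      (∀ x t, M (x + tp, t) = M (x, t)) ∧ (∀ x t, y (x + tp, t) = y (x, t)) ∧
      (∀ q : ℝ × ℝ, |q.2| < δ1 → ContDiffAt ℝ ∞ M q ∧ ContDiffAt ℝ ∞ y q ∧ |M q| < e ∧ |y q| < e ∧
        fderiv ℝ M q (0, 1) + deriv X q.1 + fderiv ℝ y q (1, 0) = 0) ∧
      (∀ q : ℝ × ℝ, q.2 ≤ -δ2 → M q = N q ∧ y q = x q) ∧ (∀ q : ℝ × ℝ, δ2 ≤ q.2 → M q = N' q ∧ y q = x' q) := by
  have z0 : ∀ x : ℝ, |((x, 0) : ℝ × ℝ).2| < δ := fun x => by simpa using hδ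
  obtain ⟨χ, χs, -, χ0, χ1, χb⟩ := bump (a := -1/2) (b := 1/2) (by norm_num)
  have χs' : ContDiff ℝ ∞ (deriv χ) := (contDiff_infty_iff_deriv.1 χs).2
  have d0 : ∀ t ≤ -1, deriv χ t = 0 := fun t ht => by
    have : χ =ᶠ[𝓝 t] fun _ => 0 := by
      filter_upwards [Iio_mem_nhds (show t < -1/2 by linarith)] with s hs
      exact χ0 s (le_of_lt hs)
    rw [this.deriv_eq]; simp
  have d1 : ∀ t ≥ 1, deriv χ t = 0 := fun t ht => by
    have : χ =ᶠ[𝓝 t] fun _ => 1 := by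
      filter_upwards [Ioi_mem_nhds (show 1/2 < t by linarith)] with s hs
      exact χ1 s (le_of_lt hs)
    rw [this.deriv_eq]; simp
  obtain ⟨C, hC, hCb⟩ : ∃ C > 0, ∀ t, |deriv χ t| ≤ C := by
    obtain ⟨C, hC⟩ := (isCompact_Icc (a := (-1 : ℝ)) (b := 1)).exists_bound_of_continuousOn χs'.continuous.continuousOn
    refine ⟨max C 1, by positivity, fun t => ?_⟩
    by_cases h : t ∈ Icc (-1 : ℝ) 1
    · exact (hC t h).trans (le_max_left _ _)
    · have : deriv χ t = 0 := by
        by_cases h2 : t ≤ -1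
        · exact d0 t h2
        · exact d1 t (by by_contra h3; exact h ⟨by linarith, by linarith⟩)
      rw [this]; simp
  have hsm : ∀ f : ℝ × ℝ → ℝ, (∀ q : ℝ × ℝ, |q.2| < δ → ContDiffAt ℝ ∞ f q) → (∀ x t, f (x + tp, t) = f (x, t)) →
      (∀ x, f (x, 0) = 0) → ∀ e > 0, ∃ e' > 0, ∀ q : ℝ × ℝ, |q.2| < e' → |f q| < e := fun f hf hp h0 e he =>
    ext_small he (fun x => (hf _ (z0 x)).continuousAt) hp h0
  obtain ⟨e1, he1, b1⟩ := hsm N Ns Np N0 e he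
  obtain ⟨e2, he2, b2⟩ := hsm N' Ns' Np' N0' e he
  obtain ⟨e3, he3, b3⟩ := hsm x xs xp x0 (e/2) (by positivity)
  obtain ⟨e4, he4, b4⟩ := hsm x' xs' xp' x0' (e/2) (by positivity)
  obtain ⟨e5, he5, b5⟩ := hsm (fun q => x' q - x q) (fun q hq => (xs' q hq).sub (xs q hq)) (fun x t => by simp only [xp, xp'])
    (fun y => by simp only [x0, x0', sub_self]) (e/(2*C)) (by positivity)
  obtain ⟨δ1, hδ1, l0, l1, l2, l3, l4⟩ : ∃ δ1 > 0, δ1 ≤ δ ∧ δ1 ≤ e1 ∧ δ1 ≤ e2 ∧ δ1 ≤ e3 ∧ δ1 ≤ e4 :=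
    ⟨min (min (min δ e1) (min e2 e3)) e4, by positivity, by simp, by simp, by simp, by simp, by simp⟩
  obtain ⟨δ2, hδ2, m0, m1, m2⟩ : ∃ δ2 > 0, δ2 < δ1 ∧ δ2 < η ∧ δ2 < e5 := by
    refine ⟨min (min δ1 η) e5 / 2, by positivity, ?_⟩
    have h1 : min (min δ1 η) e5 ≤ δ1 := by simp
    have h2 : min (min δ1 η) e5 ≤ η := by simp
    have h3 : min (min δ1 η) e5 ≤ e5 := by simp
    refine ⟨by linarith, by linarith, by linarith⟩
  obtain ⟨K, Ks, Kp, Kx, Kb⟩ := poin (A := fun q => N' q - N q) (B := fun q => x' q - x q) hδ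
    (fun q hq => (Ns' q hq).sub (Ns q hq)) (fun q hq => (xs' q hq).sub (xs q hq)) (fun x t => by simp only [xp, xp'])
    (fun y => by simp only [N0, N0', sub_self]) (fun q hq => by
      rw [fderiv_fun_sub ((Ns' q hq).differentiableAt (by simp)) ((Ns q hq).differentiableAt (by simp)),
        fderiv_fun_sub ((xs' q hq).differentiableAt (by simp)) ((xs q hq).differentiableAt (by simp)),
        ContinuousLinearMap.sub_apply, ContinuousLinearMap.sub_apply]
      linear_combination cl' q hq - cl q hq)
  set ψ : ℝ → ℝ := fun t => χ (t / δ2) with hψ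
  set ψ' : ℝ → ℝ := fun t => deriv χ (t / δ2) / δ2 with hψ'
  have ψd : ∀ t, HasDerivAt ψ (ψ' t) t := fun t => by
    have := HasDerivAt.comp (h₂ := χ) t (χs.differentiable (by simp) (t / δ2)).hasDerivAt ((hasDerivAt_id t).div_const δ2)
    exact this.congr_deriv (by simp only [hψ']; ring)
  have ψs : ContDiff ℝ ∞ ψ := χs.comp (by fun_prop)
  have ψs' : ContDiff ℝ ∞ ψ' := (χs'.comp (g := deriv χ) (f := fun t => t / δ2) (by fun_prop)).div_const δ2
  refine ⟨δ1, hδ1, δ2, hδ2, l0, m0, m1, fun q => N q + ψ q.2 * (N' q - N q), fun q => x q + ψ q.2 * (x' q - x q) + ψ' q.2 * K q,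
    fun y t => by simp only [Np, Np'], fun y t => by simp only [xp, xp', Kp], fun q hq => ?_, fun q hq => ?_, fun q hq => ?_⟩
  · have hq' : |q.2| < δ := by linarith
    have n1 := Ns q hq'
    have n2 := Ns' q hq'
    have n3 := xs q hq'
    have n4 := xs' q hq'
    have s1 : ContDiffAt ℝ ∞ (fun q : ℝ × ℝ => ψ q.2) q := ψs.contDiffAt.comp q contDiffAt_snd
    have s2 : ContDiffAt ℝ ∞ (fun q : ℝ × ℝ => ψ' q.2) q := ψs'.contDiffAt.comp q contDiffAt_snd
    have M1 : ContDiffAt ℝ ∞ (fun q => N q + ψ q.2 * (N' q - N q)) q := n1.add (s1.mul (n2.sub n1))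
    have M2 : ContDiffAt ℝ ∞ (fun q => x q + ψ q.2 * (x' q - x q) + ψ' q.2 * K q) q :=
      (n3.add (s1.mul (n4.sub n3))).add (s2.mul (Ks q hq'))
    have cv : ∀ u v E : ℝ, |u| < E → |v| < E → |u + ψ q.2 * (v - u)| < E := by
      intro u v E hu hv
      have h1 := χb (q.2 / δ2)
      change 0 ≤ ψ q.2 ∧ ψ q.2 ≤ 1 at h1
      rw [abs_lt] at *
      rcases le_total u v with h | h
      · constructor
        · nlinarith [mul_nonneg h1.1 (sub_nonneg.2 h)]
        · nlinarith [mul_le_mul_of_nonneg_right h1.2 (sub_nonneg.2 h)]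
      · constructor
        · nlinarith [mul_le_mul_of_nonneg_right h1.2 (sub_nonneg.2 h)]
        · nlinarith [mul_nonneg h1.1 (sub_nonneg.2 h)]
    refine ⟨M1, M2, cv _ _ _ (b1 q (by linarith)) (b2 q (by linarith)), ?_, ?_⟩
    · have h1 := cv _ _ _ (b3 q (by linarith)) (b4 q (by linarith))
      have h2 : |ψ' q.2 * K q| ≤ e / 2 := by
        by_cases hc : |q.2| ≤ δ2
        · have h3 := Kb q (e/(2*C)) hq' fun s hs => (b5 (q.1, s) (lt_of_le_of_lt (hs.trans hc) m2)).le
          rw [abs_mul]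
          have h4 : |ψ' q.2| ≤ C / δ2 := by
            simp only [hψ', abs_div, abs_of_pos hδ2]
            gcongr; exact hCb _
          calc |ψ' q.2| * |K q| ≤ C / δ2 * (e/(2*C) * δ2) := by gcongr; exact h3.trans (by gcongr)
            _ = e / 2 := by field_simp
        · have : ψ' q.2 = 0 := by
            simp only [hψ']
            rcases lt_abs.1 (not_le.1 hc) with h | h
            · rw [d1 _ (by rw [ge_iff_le, le_div_iff₀ hδ2]; linarith)]; simp
            · rw [d0 _ (by rw [div_le_iff₀ hδ2]; linarith)]; simp
          rw [this]; simp; positivity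
      exact (abs_add_le _ _).trans_lt (by linarith)
    · have t1 := (slice_t M1).unique ((slice_t n1).add ((ψd q.2).mul ((slice_t n2).sub (slice_t n1))))
      have t2 := (slice_x M2).unique (((slice_x n3).add (((slice_x n4).sub (slice_x n3)).const_mul (ψ q.2))).add ((slice_x (Ks q hq')).const_mul (ψ' q.2)))
      rw [t1, t2, Kx q hq']
      linear_combination (1 - ψ q.2) * cl q hq' + ψ q.2 * cl' q hq'
  · have h1 : q.2 / δ2 ≤ -1 := by rw [div_le_iff₀ hδ2]; linarith
    simp [hψ, hψ', χ0 _ (show q.2 / δ2 ≤ -1/2 by linarith), d0 _ h1]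
  · have h1 : q.2 / δ2 ≥ 1 := by rw [ge_iff_le, le_div_iff₀ hδ2]; linarith
    simp [hψ, hψ', χ1 _ (show q.2 / δ2 ≥ 1/2 by linarith), d1 _ h1]

end Glu

namespace Glu
open Set Filter Topology Metric
open scoped ContDiff

lemma om_dec (ℓ : (ℝ × ℝ) →L[ℝ] V4) (u v : ℝ × ℝ) :
    om (ℓ u) (ℓ v) = (u.1 * v.2 - u.2 * v.1) * om (ℓ (1, 0)) (ℓ (0, 1)) := by
  have dec : ∀ u, ℓ u = u.1 • ℓ (1, 0) + u.2 • ℓ (0, 1) := fun u => by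
    have : u = u.1 • (1, 0) + u.2 • (0, 1) := by simp
    conv_lhs => rw [this]
    simp only [map_add, map_smul]
  rw [dec u, dec v]
  simp only [om, Prod.fst_add, Prod.snd_add, Prod.smul_fst, Prod.smul_snd, smul_eq_mul]
  ring

lemma assemble {F F' : ℂ → V4} {a δ δ2 : ℝ} (LF : Lag F) (LF' : Lag F') {c c' : ℝ × ℝ → ℂ}
    (C : Collar {z | (F z).2.2.2 < a} c δ) (C' : Collar {z | (F' z).2.2.2 < a} c' δ) (h0 : 0 < δ2) (h1 : δ2 < δ) (h2 : δ2 < -a)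
    {A : ℝ × ℝ → V4} (Ap : ∀ x t, A (x + tp, t) = A (x, t)) (As : ∀ q : ℝ × ℝ, |q.2| < δ → ContDiffAt ℝ ∞ A q)
    (Ai : ∀ (q : ℝ × ℝ) u, |q.2| < δ → fderiv ℝ A q u = 0 → u = 0)
    (Ao : ∀ q : ℝ × ℝ, |q.2| < δ → om (fderiv ℝ A q (1, 0)) (fderiv ℝ A q (0, 1)) = 0) (At : ∀ q, (A q).2.2.2 = a + q.2)
    (Aj : ∀ q q' : ℝ × ℝ, |q.2| < δ → |q'.2| < δ → A q = A q' → q.2 = q'.2 ∧ ∃ n : ℤ, q.1 = q'.1 + n * tp)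
    (lo : ∀ q : ℝ × ℝ, -δ < q.2 → q.2 ≤ -δ2 → A q = F (c q)) (hi : ∀ q : ℝ × ℝ, δ2 ≤ q.2 → q.2 < δ → A q = F' (c' q))
    (ct : ∀ q : ℝ × ℝ, |q.2| < δ → (F (c q)).2.2.2 = a + q.2) (ct' : ∀ q : ℝ × ℝ, |q.2| < δ → (F' (c' q)).2.2.2 = a + q.2)
    (band : ∀ z, |(F z).2.2.2 - a| < δ → ∃ q : ℝ × ℝ, |q.2| < δ ∧ c q = z)
    (band' : ∀ z, |(F' z).2.2.2 - a| < δ → ∃ q : ℝ × ℝ, |q.2| < δ ∧ c' q = z)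
    {Ψ : ℂ → ℂ} (hΨ : Dif Ψ {z | (F' z).2.2.2 < a} {z | (F z).2.2.2 < a})
    (Ψc : ∀ q : ℝ × ℝ, -δ < q.2 → q.2 < 0 → Ψ (c' q) = c q) :
    ∃ G, Lag G ∧ (∀ p : V4, p.2.2.2 < a - δ2 → (p ∈ range G ↔ p ∈ range F)) ∧
      (∀ p : V4, p.2.2.2 > a + δ2 → (p ∈ range G ↔ p ∈ range F')) := by
  have hc' : Continuous fun z => (F' z).2.2.2 := by have := LF'.sm.continuous; fun_prop
  set G : ℂ → V4 := fun z => if (F' z).2.2.2 ≤ a - δ2 then F (Ψ z) else if (F' z).2.2.2 < a + δ2 then A (Collar.inv c' δ z) else F' z with hG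
  have G1 : ∀ z, (F' z).2.2.2 ≤ a - δ2 → G z = F (Ψ z) := fun z hz => if_pos hz
  have G3 : ∀ z, (F' z).2.2.2 ≥ a + δ2 → G z = F' z := fun z hz => by
    simp only [hG]; rw [if_neg (by linarith), if_neg (by linarith)]
  have G2 : ∀ q : ℝ × ℝ, |q.2| < δ → G (c' q) = A q := fun q hq => by
    have hq' := abs_lt.1 hq
    by_cases k1 : q.2 ≤ -δ2
    · rw [G1 _ (by rw [ct' q hq]; linarith), Ψc q hq'.1 (by linarith), lo q hq'.1 k1]
    · by_cases k2 : q.2 < δ2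
      · simp only [hG]; rw [ct' q hq, if_neg (by linarith), if_pos (by linarith), C'.push_eq Ap hq]
      · rw [G3 _ (by rw [ct' q hq]; linarith), hi q (by linarith) hq'.2]
  have low : ∀ z, (F' z).2.2.2 < a - δ2 → (F (Ψ z)).2.2.2 < a - δ2 := fun z hz => by
    by_contra hn
    have hzD : z ∈ {z | (F' z).2.2.2 < a} := by simp only [mem_setOf_eq]; linarith
    have := hΨ.bij.mapsTo hzD
    simp only [mem_setOf_eq] at this
    obtain ⟨q, hq, e1⟩ := band (Ψ z) (by rw [abs_lt]; constructor <;> linarith)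
    have e2 := ct q hq
    rw [e1] at e2
    have hq0 : q.2 < 0 := by linarith
    rw [← Ψc q (abs_lt.1 hq).1 hq0] at e1
    have e3 := hΨ.bij.injOn ((C'.side q hq).2 hq0) hzD e1
    rw [← e3, ct' q hq] at hz
    linarith
  have tri : ∀ z, ((F' z).2.2.2 < a - δ2 ∧ (G z).2.2.2 < a - δ2) ∨ (∃ q : ℝ × ℝ, |q.2| < δ ∧ |q.2| ≤ δ2 ∧ c' q = z) ∨
      ((F' z).2.2.2 > a + δ2) := fun z => by
    rcases lt_or_ge (F' z).2.2.2 (a - δ2) with k | k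
    · exact .inl ⟨k, by rw [G1 z k.le]; exact low z k⟩
    rcases lt_or_ge (a + δ2) (F' z).2.2.2 with k' | k'
    · exact .inr (.inr k')
    obtain ⟨q, hq, rfl⟩ := band' z (by rw [abs_lt]; constructor <;> linarith)
    rw [ct' q hq] at k k'
    exact .inr (.inl ⟨q, hq, by rw [abs_le]; constructor <;> linarith, rfl⟩)
  have ev1 : ∀ z, (F' z).2.2.2 < a - δ2 → G =ᶠ[𝓝 z] F ∘ Ψ := fun z hz => by
    filter_upwards [hc'.continuousAt.eventually_lt continuousAt_const hz] with w hw using G1 w hw.le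
  have ev3 : ∀ z, (F' z).2.2.2 > a + δ2 → G =ᶠ[𝓝 z] F' := fun z hz => by
    filter_upwards [continuousAt_const.eventually_lt hc'.continuousAt hz] with w hw using G3 w hw.le
  have ev2 : ∀ q : ℝ × ℝ, |q.2| < δ → G =ᶠ[𝓝 (c' q)] fun z => A (Collar.inv c' δ z) := fun q hq => by
    refine (C'.ev_iff hq).2 ?_
    filter_upwards [abs_lt_nhds hq] with q' hq'
    rw [G2 q' hq', C'.push_eq Ap hq']
  have sm2 : ∀ q : ℝ × ℝ, |q.2| < δ → ContDiffAt ℝ ∞ G (c' q) := fun q hq =>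
    (C'.push_smooth Ap hq (As q hq)).congr_of_eventuallyEq (ev2 q hq)
  have d2 : ∀ q : ℝ × ℝ, |q.2| < δ → ∀ u, fderiv ℝ G (c' q) (fderiv ℝ c' q u) = fderiv ℝ A q u := fun q hq u => by
    have : G ∘ c' =ᶠ[𝓝 q] A := by filter_upwards [abs_lt_nhds hq] with q' hq' using G2 q' hq'
    rw [← this.fderiv_eq, fderiv_comp q ((sm2 q hq).differentiableAt (by simp)) ((C'.sm q hq).differentiableAt (by simp))]
    rfl
  have sur : ∀ q : ℝ × ℝ, |q.2| < δ → ∀ w : ℂ, ∃ u, fderiv ℝ c' q u = w := fun q hq =>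
    (LinearMap.injective_iff_surjective_of_finrank_eq_finrank (f := (fderiv ℝ c' q : (ℝ × ℝ) →ₗ[ℝ] ℂ)) Collar.fd).1
      ((injective_iff_map_eq_zero _).2 fun u hu => C'.imm q u hq hu)
  have inD : ∀ z, (F' z).2.2.2 < a - δ2 → z ∈ {z | (F' z).2.2.2 < a} := fun z hz => by
    simp only [mem_setOf_eq]; linarith
  have d1 : ∀ z, (F' z).2.2.2 < a - δ2 → ∀ u, fderiv ℝ G z u = fderiv ℝ F (Ψ z) (fderiv ℝ Ψ z u) := fun z hz u => by
    rw [(ev1 z hz).fderiv_eq, fderiv_comp z (LF.sm.differentiable (by simp) _) ((hΨ.sm z (inD z hz)).differentiableAt (by simp))]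
    rfl
  refine ⟨G, ⟨contDiff_iff_contDiffAt.2 fun z => ?_, fun z w e => ?_, fun z u hu => ?_, fun z u v => ?_, ?_⟩, fun p hp => ⟨?_, ?_⟩, fun p hp => ⟨?_, ?_⟩⟩
  · rcases tri z with ⟨k, -⟩ | ⟨q, hq, -, rfl⟩ | k
    · exact (LF.sm.contDiffAt.comp z (hΨ.sm z (inD z k))).congr_of_eventuallyEq (ev1 z k)
    · exact sm2 q hq
    · exact LF'.sm.contDiffAt.congr_of_eventuallyEq (ev3 z k)
  · have e' := congrArg (fun p : V4 => p.2.2.2) e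
    change (G z).2.2.2 = (G w).2.2.2 at e'
    rcases tri z with ⟨k, k'⟩ | ⟨q, hq, hq2, rfl⟩ | k <;> rcases tri w with ⟨l, l'⟩ | ⟨q', hq', hq2', rfl⟩ | l
    · rw [G1 z k.le, G1 w l.le] at e
      exact hΨ.bij.injOn (inD z k) (inD w l) (LF.inj e)
    · rw [G2 q' hq', At] at e'; linarith [(abs_le.1 hq2').1]
    · rw [G3 w l.le] at e'; linarith
    · rw [G2 q hq, At] at e'; linarith [(abs_le.1 hq2).1]
    · rw [G2 q hq, G2 q' hq'] at e
      obtain ⟨e1, n, e2⟩ := Aj q q' hq hq' e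
      have : q = (q'.1 + n * tp, q'.2) := Prod.ext e2 e1
      rw [this, C'.per']
    · rw [G3 w l.le, G2 q hq, At] at e'; linarith [(abs_le.1 hq2).2]
    · rw [G3 z k.le] at e'; linarith
    · rw [G3 z k.le, G2 q' hq', At] at e'; linarith [(abs_le.1 hq2').2]
    · rw [G3 z k.le, G3 w l.le] at e; exact LF'.inj e
  · rcases tri z with ⟨k, -⟩ | ⟨q, hq, -, rfl⟩ | k
    · rw [d1 z k] at hu
      exact hΨ.imm z (inD z k) u (LF.imm _ _ hu)
    · obtain ⟨u, rfl⟩ := sur q hq u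
      rw [d2 q hq] at hu
      rw [Ai q u hq hu, map_zero]
    · rw [(ev3 z k).fderiv_eq] at hu; exact LF'.imm _ _ hu
  · rcases tri z with ⟨k, -⟩ | ⟨q, hq, -, rfl⟩ | k
    · rw [d1 z k, d1 z k, LF.iso]
    · obtain ⟨u, rfl⟩ := sur q hq u
      obtain ⟨v, rfl⟩ := sur q hq v
      rw [d2 q hq, d2 q hq, om_dec, Ao q hq, mul_zero]
    · rw [(ev3 z k).fderiv_eq]; exact LF'.iso _ _ _
  · obtain ⟨R, hR⟩ := LF'.flat
    refine ⟨R, fun z hz => ?_⟩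
    rw [G3 z (by rw [hR z hz]; simp only; linarith), hR z hz]
  · rintro ⟨z, rfl⟩
    rcases tri z with ⟨k, -⟩ | ⟨q, hq, hq2, rfl⟩ | k
    · rw [G1 z k.le]; exact mem_range_self _
    · rw [G2 q hq, At] at hp; linarith [(abs_le.1 hq2).1]
    · rw [G3 z k.le] at hp; linarith
  · rintro ⟨w, rfl⟩
    obtain ⟨z, hz, rfl⟩ := hΨ.bij.surjOn (show w ∈ {z | (F z).2.2.2 < a} by simp only [mem_setOf_eq]; linarith)
    refine ⟨z, G1 z ?_⟩
    by_contra hn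
    simp only [mem_setOf_eq] at hz
    obtain ⟨q, hq, rfl⟩ := band' z (by rw [abs_lt]; constructor <;> linarith)
    rw [ct' q hq] at hz hn
    rw [Ψc q (abs_lt.1 hq).1 (by linarith), ct q hq] at hp
    linarith
  · rintro ⟨z, rfl⟩
    rcases tri z with ⟨k, k'⟩ | ⟨q, hq, hq2, rfl⟩ | k
    · linarith
    · rw [G2 q hq, At] at hp; linarith [(abs_le.1 hq2).2]
    · rw [G3 z k.le]; exact mem_range_self _
  · rintro ⟨z, rfl⟩
    exact ⟨z, G3 z (le_of_lt hp)⟩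

lemma core {F F' : ℂ → V4} {a ε : ℝ} (LF : Lag F) (LF' : Lag F') (ha : a < 0) (hε : 0 < ε)
    (tr : ∀ z, (F z).2.2.2 = a → fderiv ℝ (fun z => (F z).2.2.2) z ≠ 0)
    (tr' : ∀ z, (F' z).2.2.2 = a → fderiv ℝ (fun z => (F' z).2.2.2) z ≠ 0)
    (hne : {z | (F z).2.2.2 = a}.Nonempty) (hcon : IsPreconnected {z | (F z).2.2.2 = a})
    (hS : ∀ p : V4, p.2.2.2 = a → (p ∈ range F ↔ p ∈ range F')) :
    ∃ G, Lag G ∧ (∀ p : V4, p.2.2.2 < a - ε → (p ∈ range G ↔ p ∈ range F)) ∧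
      (∀ p : V4, p.2.2.2 > a + ε → (p ∈ range G ↔ p ∈ range F')) := by
  have hcs : HasCompactSupport fun z => (F z).2.2.2 := by
    obtain ⟨R, hR⟩ := LF.flat
    refine HasCompactSupport.intro (isCompact_closedBall (0 : ℂ) R) fun z hz => ?_
    rw [hR z (by simpa using hz)]
  obtain ⟨γ, γs, γp, γd, γi, γr⟩ := level_circle LF.sm.snd.snd.snd hcs ha.ne tr hne hcon
  have hγ : ∀ x, (F (γ x)).2.2.2 = a := fun x => by
    have : γ x ∈ range γ := ⟨x, rfl⟩
    rwa [γr] at this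
  obtain ⟨σ, σs, σp, σd, σi, hσ⟩ := LF.transfer LF' γs γp γd γi fun x => (hS _ (hγ x)).1 ⟨_, rfl⟩
  have σr : range σ = {z | (F' z).2.2.2 = a} := by
    ext z
    constructor
    · rintro ⟨x, rfl⟩
      simp only [mem_setOf_eq, hσ, hγ]
    · intro hz
      obtain ⟨w, hw⟩ := (hS (F' z) hz).2 ⟨z, rfl⟩
      have : w ∈ range γ := by rw [γr, mem_setOf_eq, hw]; exact hz
      obtain ⟨x, rfl⟩ := this
      exact ⟨x, LF'.inj (by rw [hσ, hw])⟩
  obtain ⟨P, e, R, hP⟩ := LF.frame tr γs γp γd hγ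
  set X : ℝ → ℝ := fun x => (F (γ x)).2.1 with hX
  obtain ⟨δ, c, N, x, C, hc, Np, xp, N0, x0, bd⟩ := LF.collar ha tr γs γp γd γi γr R hP (fun x => rfl)
  obtain ⟨δ', c', N', x', C', hc', Np', xp', N0', x0', bd'⟩ := LF'.collar ha tr' σs σp σd σi σr R
    (fun x => by rw [hP, hσ]) (fun x => by rw [hσ])
  obtain ⟨Ψ, hΨ, ε0, hε0, Ψc⟩ := C.pair C'
  obtain ⟨e', he', hi⟩ := R.inj (a := a) (fun x y h => γi x y (LF.inj (by
    have hE0 : ∀ x, F (γ x) = Ec P X a (x, 0) := fun x => by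
      refine Prod.ext ?_ (Prod.ext ?_ (Prod.ext ?_ ?_)) <;> simp [Ec, hP, hX, hγ]
    rw [hE0, hE0, h])))
  obtain ⟨δ0, hδ0, l1, l2, l3, l4⟩ : ∃ δ0 > 0, δ0 ≤ δ ∧ δ0 ≤ δ' ∧ δ0 ≤ ε0 ∧ δ0 ≤ e' :=
    ⟨min (min δ δ') (min ε0 e'), by have := C.pos; have := C'.pos; positivity, by simp, by simp, by simp, by simp⟩
  obtain ⟨δ1, hδ1, δ2, hδ2, m0, m1, m2, M, y, Mp, yp, hM, ML, MR⟩ := interp (X := X) (e := min e e') (η := min ε (-a)) hδ0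
    (lt_min R.pos he') (lt_min hε (by linarith))
    (fun q hq => (hc q (by linarith)).2.2.1) (fun q hq => (hc' q (by linarith)).2.2.1)
    (fun q hq => (hc q (by linarith)).2.2.2.1) (fun q hq => (hc' q (by linarith)).2.2.2.1) Np Np' xp xp' N0 N0' x0 x0'
    (fun q hq => (hc q (by linarith)).2.2.2.2) (fun q hq => (hc' q (by linarith)).2.2.2.2)
  rw [lt_min_iff] at m2
  have gr := fun (q : ℝ × ℝ) (hq : |q.2| < δ1) => R.graph (a := a) (hM q hq).1 (hM q hq).2.1 ((hM q hq).2.2.1.trans_le (min_le_left _ _))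
  have bd1 : ∀ z, |(F z).2.2.2 - a| < δ1 → ∃ q : ℝ × ℝ, |q.2| < δ1 ∧ c q = z := fun z hz => by
    obtain ⟨q, hq, rfl⟩ := bd z (by linarith)
    refine ⟨q, ?_, rfl⟩
    rw [(hc q hq).2.1] at hz
    simpa [Ec] using hz
  have bd1' : ∀ z, |(F' z).2.2.2 - a| < δ1 → ∃ q : ℝ × ℝ, |q.2| < δ1 ∧ c' q = z := fun z hz => by
    obtain ⟨q, hq, rfl⟩ := bd' z (by linarith)
    refine ⟨q, ?_, rfl⟩
    rw [(hc' q hq).2.1] at hz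
    simpa [Ec] using hz
  obtain ⟨G, LG, g1, g2⟩ := assemble (A := fun q => Ec P X a (q.1, (M q, y q, q.2))) LF LF' (C.restrict hδ1 (by linarith)) (C'.restrict hδ1 (by linarith)) hδ2 m1 m2.2
    (fun x t => by simp only [Ec, Mp, yp, R.per, R.Xp]) (fun q hq => (gr q hq).1) (fun q u hq => (gr q hq).2.1 u)
    (fun q hq => by rw [(gr q hq).2.2]; exact (hM q hq).2.2.2.2) (fun q => rfl)
    (fun q q' hq hq' h => by
      have sm : ∀ q : ℝ × ℝ, |q.2| < δ1 → ‖(M q, y q, q.2)‖ < e' := fun q hq => by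
        simp only [Prod.norm_mk, Real.norm_eq_abs, max_lt_iff]
        exact ⟨(hM q hq).2.2.1.trans_le (min_le_right _ _), (hM q hq).2.2.2.1.trans_le (min_le_right _ _), by linarith⟩
      obtain ⟨h1, h2⟩ := hi _ _ (sm q hq) (sm q' hq') h
      exact ⟨congrArg (fun p => p.2.2) h1, h2⟩)
    (fun q k1 k2 => by rw [(hc q (by rw [abs_lt]; constructor <;> linarith)).2.1, (ML q k2).1, (ML q k2).2])
    (fun q k1 k2 => by rw [(hc' q (by rw [abs_lt]; constructor <;> linarith)).2.1, (MR q k1).1, (MR q k1).2])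
    (fun q hq => by rw [(hc q (by linarith)).2.1]; rfl) (fun q hq => by rw [(hc' q (by linarith)).2.1]; rfl)
    bd1 bd1' hΨ (fun q k1 k2 => Ψc q (by linarith) k2)
  exact ⟨G, LG, fun p hp => g1 p (by linarith [m2.1]), fun p hp => g2 p (by linarith [m2.1])⟩

end Glu

namespace Glu
open Set Filter Topology Metric
open scoped ContDiff

def rho : V4 →L[ℝ] V4 := LinearMap.toContinuousLinearMap
  { toFun := fun p => (p.1, -p.2.1, p.2.2.1, -p.2.2.2)
    map_add' := fun p q => by simp [add_comm]
    map_smul' := fun r p => by simp }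

lemma rho_apply (p : V4) : rho p = (p.1, -p.2.1, p.2.2.1, -p.2.2.2) := rfl
lemma rho_rho (p : V4) : rho (rho p) = p := by simp [rho_apply]
lemma rho_inj {p q : V4} (h : rho p = rho q) : p = q := by rw [← rho_rho p, h, rho_rho]

def rf (F : ℂ → V4) (z : ℂ) : V4 := rho (F (Complex.conjCLE z))

lemma rf_fderiv {F : ℂ → V4} (hF : ContDiff ℝ ∞ F) (z : ℂ) :
    HasFDerivAt (rf F) (rho.comp ((fderiv ℝ F (Complex.conjCLE z)).comp (Complex.conjCLE : ℂ →L[ℝ] ℂ))) z :=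
  rho.hasFDerivAt.comp z ((hF.differentiable (by simp) _).hasFDerivAt.comp z Complex.conjCLE.hasFDerivAt)

lemma Lag.rf {F : ℂ → V4} (LF : Lag F) : Lag (rf F) := by
  refine ⟨rho.contDiff.comp (LF.sm.comp Complex.conjCLE.contDiff), fun z w h => Complex.conjCLE.injective (LF.inj (rho_inj h)),
    fun z u h => ?_, fun z u v => ?_, ?_⟩
  · rw [(rf_fderiv LF.sm z).fderiv] at h
    have h1 := LF.imm (Complex.conjCLE z) (Complex.conjCLE u) (rho_inj (by rw [map_zero]; exact h))
    exact Complex.conjCLE.injective (by rw [h1, map_zero])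
  · rw [(rf_fderiv LF.sm z).fderiv]
    have := LF.iso (Complex.conjCLE z) (Complex.conjCLE u) (Complex.conjCLE v)
    simp only [om, ContinuousLinearMap.comp_apply, rho_apply, ContinuousLinearEquiv.coe_coe] at this ⊢
    linear_combination this
  · obtain ⟨R, hR⟩ := LF.flat
    refine ⟨R, fun z hz => ?_⟩
    rw [Glu.rf, hR _ (by simpa using hz)]
    simp [rho_apply]

lemma rf_range {F : ℂ → V4} (p : V4) : p ∈ range (rf F) ↔ rho p ∈ range F := by
  constructor
  · rintro ⟨z, rfl⟩; exact ⟨_, (rho_rho _).symm⟩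
  · rintro ⟨z, hz⟩
    exact ⟨Complex.conjCLE z, by simp only [rf]; rw [← rho_rho p, ← hz]; simp⟩

lemma rf_tr {F : ℂ → V4} (LF : Lag F) {a : ℝ} (tr : ∀ z, (F z).2.2.2 = a → fderiv ℝ (fun z => (F z).2.2.2) z ≠ 0) (z : ℂ)
    (hz : (rf F z).2.2.2 = -a) : fderiv ℝ (fun z => (rf F z).2.2.2) z ≠ 0 := by
  intro h
  refine tr (Complex.conjCLE z) (neg_injective hz) (ContinuousLinearMap.ext fun u => ?_)
  have := congrArg (fun ℓ : ℂ →L[ℝ] ℝ => ℓ (Complex.conjCLE u)) h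
  simp only [LF.rf.hd, (rf_fderiv LF.sm z).fderiv] at this
  rw [LF.hd]
  simpa [rho_apply] using this

lemma pre {F : ℂ → V4} (LF : Lag F) {a : ℝ} (hne : (range F ∩ {p : V4 | p.2.2.2 = a}).Nonempty)
    (hc : IsPreconnected (range F ∩ {p : V4 | p.2.2.2 = a})) :
    {z | (F z).2.2.2 = a}.Nonempty ∧ IsPreconnected {z | (F z).2.2.2 = a} := by
  have : F '' {z | (F z).2.2.2 = a} = range F ∩ {p : V4 | p.2.2.2 = a} := by
    ext p; constructor
    · rintro ⟨z, hz, rfl⟩; exact ⟨⟨z, rfl⟩, hz⟩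
    · rintro ⟨⟨z, rfl⟩, hz⟩; exact ⟨z, hz, rfl⟩
  rw [← this] at hne hc
  exact ⟨hne.of_image, LF.emb.isInducing.isPreconnected_image.1 hc⟩

lemma core2 {F F' : ℂ → V4} {a ε : ℝ} (LF : Lag F) (LF' : Lag F') (hε : 0 < ε)
    (tr : ∀ z, (F z).2.2.2 = a → fderiv ℝ (fun z => (F z).2.2.2) z ≠ 0)
    (tr' : ∀ z, (F' z).2.2.2 = a → fderiv ℝ (fun z => (F' z).2.2.2) z ≠ 0)
    (hne : (range F ∩ {p : V4 | p.2.2.2 = a}).Nonempty) (hcon : IsPreconnected (range F ∩ {p : V4 | p.2.2.2 = a}))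
    (hS : ∀ p : V4, p.2.2.2 = a → (p ∈ range F ↔ p ∈ range F')) :
    ∃ G, Lag G ∧ (∀ p : V4, p.2.2.2 < a - ε → (p ∈ range G ↔ p ∈ range F)) ∧
      (∀ p : V4, p.2.2.2 > a + ε → (p ∈ range G ↔ p ∈ range F')) := by
  rcases lt_trichotomy a 0 with h | h | h
  · obtain ⟨h1, h2⟩ := pre LF hne hcon
    exact core LF LF' h hε tr tr' h1 h2 hS
  · exfalso
    obtain ⟨R, hR⟩ := LF.flat
    have hz : R < ‖((|R| + 1 : ℝ) : ℂ)‖ := by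
      rw [Complex.norm_real, Real.norm_eq_abs, abs_of_nonneg (by positivity)]; linarith [le_abs_self R]
    refine tr ((|R| + 1 : ℝ) : ℂ) (by rw [hR _ hz, h]) ?_
    have : (fun z => (F z).2.2.2) =ᶠ[𝓝 ((|R| + 1 : ℝ) : ℂ)] fun _ => 0 := by
      filter_upwards [continuousAt_const.eventually_lt continuous_norm.continuousAt hz] with w hw
      rw [hR w hw]
    rw [this.fderiv_eq]; simp
  · have hSr : ∀ p : V4, p.2.2.2 = -a → (p ∈ range (rf F') ↔ p ∈ range (rf F)) := fun p hp => by
      rw [rf_range, rf_range]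
      exact (hS (rho p) (by rw [rho_apply, hp]; simp)).symm
    have im : rho '' (range F ∩ {p : V4 | p.2.2.2 = a}) = range (rf F') ∩ {p : V4 | p.2.2.2 = -a} := by
      ext p; constructor
      · rintro ⟨q, ⟨h1, h2⟩, rfl⟩
        refine ⟨?_, by simp only [mem_setOf_eq, rho_apply] at h2 ⊢; rw [h2]⟩
        rw [rf_range, rho_rho]; exact (hS q h2).1 h1
      · rintro ⟨h1, h2⟩
        have h3 : (rho p).2.2.2 = a := by simp only [mem_setOf_eq] at h2; rw [rho_apply, h2]; simp
        exact ⟨rho p, ⟨(hS _ h3).2 ((rf_range p).1 h1), h3⟩, rho_rho p⟩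
    obtain ⟨h1, h2⟩ := pre LF'.rf (a := -a) (by rw [← im]; exact hne.image _)
      (by rw [← im]; exact hcon.image _ rho.continuous.continuousOn)
    obtain ⟨G, LG, g1, g2⟩ := core LF'.rf LF.rf (by linarith) hε (rf_tr LF' tr') (rf_tr LF tr) h1 h2 hSr
    refine ⟨rf G, LG.rf, fun p hp => ?_, fun p hp => ?_⟩
    · rw [rf_range, g2 _ (by rw [rho_apply]; simp only; linarith), rf_range, rho_rho]
    · rw [rf_range, g1 _ (by rw [rho_apply]; simp only; linarith), rf_range, rho_rho]

def eC : ℂ ≃L[ℝ] ℝ × ℝ := Complex.equivRealProdCLM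

lemma toLag {f : R2 → R4} (hf : IsFlatParam f) : Lag (fun z => f (eC z)) := by
  obtain ⟨hs, hi, -, hm, ho, K, hK, hKf⟩ := hf
  have hs' : ContDiff ℝ ∞ f := hs
  have d : ∀ z, HasFDerivAt (fun z => f (eC z)) ((fderiv ℝ f (eC z)).comp (eC : ℂ →L[ℝ] ℝ × ℝ)) z := fun z =>
    (hs'.differentiable (by simp) _).hasFDerivAt.comp z eC.hasFDerivAt
  refine ⟨hs'.comp eC.contDiff, fun z w h => eC.injective (hi h), fun z u h => ?_, fun z u v => ?_, ?_⟩
  · rw [(d z).fderiv] at h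
    exact eC.injective (hm (eC z) (by rw [map_zero, map_zero]; exact h))
  · rw [(d z).fderiv]; exact ho _ _ _
  · have : IsCompact (eC.symm '' K) := hK.image eC.symm.continuous
    obtain ⟨R, hR⟩ := this.isBounded.exists_norm_le
    refine ⟨R, fun z hz => hKf _ fun hk => ?_⟩
    have := hR z ⟨_, hk, eC.symm_apply_apply z⟩
    linarith

lemma ofLag {F : ℂ → V4} (LF : Lag F) : IsFlatParam (fun p => F (eC.symm p)) := by
  have d : ∀ p, HasFDerivAt (fun p => F (eC.symm p)) ((fderiv ℝ F (eC.symm p)).comp (eC.symm : (ℝ × ℝ) →L[ℝ] ℂ)) p := fun z =>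
    (LF.sm.differentiable (by simp) _).hasFDerivAt.comp z eC.symm.hasFDerivAt
  refine ⟨LF.sm.comp eC.symm.contDiff, fun z w h => eC.symm.injective (LF.inj h),
    LF.proper.comp eC.symm.toHomeomorph.isProperMap, fun p u v h => ?_, fun p u v => ?_, ?_⟩
  · rw [(d p).fderiv] at h
    have h' : fderiv ℝ F (eC.symm p) (eC.symm (u - v)) = 0 := by
      rw [map_sub, map_sub]; exact sub_eq_zero.2 h
    have := LF.imm _ _ h'
    exact sub_eq_zero.1 (eC.symm.injective (by rw [this, map_zero]))
  · rw [(d p).fderiv]; exact LF.iso _ _ _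
  · obtain ⟨R, hR⟩ := LF.flat
    refine ⟨eC '' closedBall 0 R, (isCompact_closedBall _ _).image eC.continuous, fun p hp => ?_⟩
    change F (eC.symm p) = (p.1, p.2, 0, 0)
    rw [hR]
    · rfl
    · by_contra hn
      exact hp ⟨eC.symm p, by simpa using hn, eC.apply_symm_apply p⟩

lemma toTr {f : R2 → R4} (hf : IsFlatParam f) {a : ℝ} (h : ∀ p : R2, (f p).2.2.2 = a → fderiv ℝ (fun q => (f q).2.2.2) p ≠ 0)
    (z : ℂ) (hz : (f (eC z)).2.2.2 = a) : fderiv ℝ (fun z => (f (eC z)).2.2.2) z ≠ 0 := by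
  intro h0
  refine h (eC z) hz (ContinuousLinearMap.ext fun u => ?_)
  have hs' : ContDiff ℝ ∞ f := hf.1
  have d : HasFDerivAt (fun z => (f (eC z)).2.2.2) _ z :=
    HasFDerivAt.comp (g := fun q => (f q).2.2.2) z ((hs'.snd.snd.snd.differentiable (by simp) _).hasFDerivAt) eC.hasFDerivAt
  rw [d.fderiv] at h0
  have := congrArg (fun ℓ : ℂ →L[ℝ] ℝ => ℓ (eC.symm u)) h0
  simpa using this

lemma toRange (f : R2 → R4) : range (fun z => f (eC z)) = range f := eC.surjective.range_comp f

end Glu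

/-- Gluing two flat-at-infinity planar Lagrangians along a common connected slice. -/
theorem gluing (L L' : Set R4) (a : ℝ)
    (hL : IsFlatLagrangian L) (hL' : IsFlatLagrangian L')
    (hLt : TransverseAt L a) (hL't : TransverseAt L' a)
    (S : Set R4) (hSL : L ∩ {p : R4 | p.2.2.2 = a} = S)
    (hSL' : L' ∩ {p : R4 | p.2.2.2 = a} = S)
    (hSne : S.Nonempty) (hSc : IsConnected S)
    (ε : ℝ) (hε : 0 < ε) :
    ∃ L'' : Set R4, IsFlatLagrangian L'' ∧
      L'' ∩ {p : R4 | p.2.2.2 < a - ε} = L ∩ {p : R4 | p.2.2.2 < a - ε} ∧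
      L'' ∩ {p : R4 | p.2.2.2 > a + ε} = L' ∩ {p : R4 | p.2.2.2 > a + ε} := by
  classical
  obtain ⟨f, hf, hfr, hft⟩ := hLt
  obtain ⟨f', hf', hfr', hft'⟩ := hL't
  have r1 := (Glu.toRange f).trans hfr
  have r2 := (Glu.toRange f').trans hfr'
  obtain ⟨G, LG, g1, g2⟩ := Glu.core2 (a := a) (Glu.toLag hf) (Glu.toLag hf') hε (Glu.toTr hf hft) (Glu.toTr hf' hft')
    (by rw [r1, hSL]; exact hSne) (by rw [r1, hSL]; exact hSc.isPreconnected) (fun p hp => by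
      have e := hSL.trans hSL'.symm
      rw [r1, r2]
      constructor
      · intro h
        have : p ∈ L ∩ {p : R4 | p.2.2.2 = a} := ⟨h, hp⟩
        rw [e] at this; exact this.1
      · intro h
        have : p ∈ L' ∩ {p : R4 | p.2.2.2 = a} := ⟨h, hp⟩
        rw [← e] at this; exact this.1)
  rw [r1] at g1
  rw [r2] at g2
  refine ⟨Set.range G, ⟨_, Glu.ofLag LG, Glu.eC.symm.surjective.range_comp G⟩, ?_, ?_⟩
  · ext p
    exact and_congr_left fun hp => g1 p hp
  · ext p
    exact and_congr_left fun hp => g2 p hp
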